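/- arXiv:2508.07113 — 2 statements merged into one kernel-verified Lean document; each statement's English description precedes it below -/
import Mathlib

section
/- Let p be a prime, n ≥ 1, q = p^n, k a divisor of n, v ≥ 1 a divisor of p^k − 1, and let U be an 𝔽_{p^k}-subspace of 𝔽_q with 1 ∈ U, #U = p^{mk}, and #U^v > 2. Assume m > 1 and 2(2m − 1)k ≥ n. If U ≠ {c ∈ 𝔽_q : c^{p^{mk}} = c}, then 𝒫(U^v, q) = {f^v : f ∈ 𝒫(U, q)}. If U = {c ∈ 𝔽_q : c^{p^{mk}} = c}, then, letting e be the smallest positive integer such that s^{p^e} = s for all s ∈ U^v and t = v·(p^e − 1)/(p^{mk} − 1), one has 𝒫(U^v, q) = {f^t : f ∈ 𝒫(𝔽_{p^e}, q)}. -/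
open Polynomial

/-- The value set of a polynomial over a finite field. -/
def valueSet {F : Type*} [Field F] [Fintype F] [DecidableEq F] (f : F[X]) : Finset F :=
  Finset.image (fun a => f.eval a) Finset.univ

/-- A minimal value set polynomial (MVSP): a nonconstant polynomial whose value set has
the minimal possible size `⌊(q-1)/deg f⌋ + 1`. -/
def IsMVSP {F : Type*} [Field F] [Fintype F] [DecidableEq F] (f : F[X]) : Prop :=
  0 < f.natDegree ∧ (valueSet f).card = (Fintype.card F - 1) / f.natDegree + 1

/-- `MVSPset S` is the set `𝒫(S, q)` of all MVSPs with value set `S`. -/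
def MVSPset {F : Type*} [Field F] [Fintype F] [DecidableEq F] (S : Finset F) : Set F[X] :=
  {f | IsMVSP f ∧ valueSet f = S}

/-- `U` is a subspace over the subfield `{c : c ^ r = c}` (with `r = p ^ k`):
an additive subgroup closed under multiplication by elements of that subfield. -/
def IsSubspaceOver {F : Type*} [Field F] (r : ℕ) (U : Set F) : Prop :=
  (0 : F) ∈ U ∧ (∀ x ∈ U, ∀ y ∈ U, x + y ∈ U) ∧ (∀ x ∈ U, -x ∈ U) ∧
    (∀ c : F, c ^ r = c → ∀ x ∈ U, c * x ∈ U)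

/-- An `r`-linearized polynomial (with `r = q` or `r = p ^ k`): of the form `Σ aᵢ x ^ (r ^ i)`. -/
def IsLinearized {F : Type*} [Field F] (r : ℕ) (M : F[X]) : Prop :=
  ∃ (s : ℕ) (a : ℕ → F), M = ∑ i ∈ Finset.range (s + 1), C (a i) * X ^ r ^ i


section MVhasse
variable {K : Type*} [Field K] {p : ℕ}

theorem mv_map_hasse (n : ℕ) (f : K[X]) :
    hasseDeriv n (f.map (C : K →+* K[X])) = (hasseDeriv n f).map C := by
  ext i : 1
  simp [hasseDeriv_coeff]

theorem mv_tay_coeff (n : ℕ) (f : K[X]) :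
    (taylor (X : K[X]) (f.map C)).coeff n = hasseDeriv n f := by
  rw [taylor_coeff, mv_map_hasse, eval_map]
  simp [eval₂_C_X]

variable [hp : Fact p.Prime] [CharP K p]

theorem mv_hasse_pow_aux (a n : ℕ) (T : K[X]) :
    hasseDeriv n (T ^ p ^ a) = if p ^ a ∣ n then (hasseDeriv (n / p ^ a) T) ^ p ^ a else 0 := by
  have hpa : 0 < p ^ a := pow_pos hp.out.pos a
  rw [← mv_tay_coeff, Polynomial.map_pow, taylor_pow, ← map_iterateFrobenius_expand p, coeff_map,
    coeff_expand hpa]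
  split_ifs with h
  · rw [mv_tay_coeff, iterateFrobenius_def]
  · simp

theorem mv_hasse_pow (a n : ℕ) (T : K[X]) :
    hasseDeriv (p ^ a * n) (T ^ p ^ a) = (hasseDeriv n T) ^ p ^ a := by
  rw [mv_hasse_pow_aux, if_pos (dvd_mul_right _ _), Nat.mul_div_cancel_left _ (pow_pos hp.out.pos a)]

theorem mv_hasse_pow_zero (a n : ℕ) (T : K[X]) (h : ¬ p ^ a ∣ n) :
    hasseDeriv n (T ^ p ^ a) = 0 := by
  rw [mv_hasse_pow_aux, if_neg h]

theorem mv_hasse_mul_zero (n : ℕ) (A B : K[X]) (h : ∀ i, 0 < i → i ≤ n → hasseDeriv i A = 0) :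
    hasseDeriv n (A * B) = A * hasseDeriv n B := by
  rw [hasseDeriv_mul, Finset.sum_eq_single (0, n)]
  · simp
  · rintro ⟨i, j⟩ hij hne
    rw [Finset.HasAntidiagonal.mem_antidiagonal] at hij
    simp only at hij ⊢
    rw [h i, zero_mul]
    · rcases Nat.eq_zero_or_pos i with rfl | hi
      · exfalso; apply hne; simp at hij; rw [hij]
      · exact hi
    · omega
  · simp

theorem mv_hasse_pow_mul (a n : ℕ) (A B : K[X]) (h : n < p ^ a) :
    hasseDeriv n (A ^ p ^ a * B) = A ^ p ^ a * hasseDeriv n B := by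
  apply mv_hasse_mul_zero
  intro i hi hin
  apply mv_hasse_pow_zero
  intro hd
  have := Nat.le_of_dvd hi hd
  omega

theorem mv_pth_root [Finite K] (a : ℕ) (x : K) : ∃ y, y ^ p ^ a = x := by
  obtain ⟨y, hy⟩ := (bijective_iterateFrobenius K p a).surjective x
  exact ⟨y, by rw [← hy, iterateFrobenius_def]⟩

theorem mv_deriv_zero_pow [Finite K] (T : K[X]) (h : derivative T = 0) : ∃ S, T = S ^ p := by
  have hpn : p ≠ 0 := hp.out.ne_zero
  have h1 := expand_contract p h hpn
  obtain ⟨S, hS⟩ := Polynomial.map_surjective (frobenius K p) (bijective_frobenius K p).surjective (contract p T)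
  refine ⟨S, ?_⟩
  rw [← map_frobenius_expand p, map_expand, hS, h1]

theorem mv_hasse_zero_pow [Finite K] (l : ℕ) (G : K[X]) (h : ∀ i < l, hasseDeriv (p ^ i) G = 0) :
    ∃ T, G = T ^ p ^ l := by
  induction l with
  | zero => exact ⟨G, by simp⟩
  | succ l ih =>
    obtain ⟨T, hT⟩ := ih (fun i hi => h i (by omega))
    have h2 := h l (by omega)
    have h3 := mv_hasse_pow l 1 T
    rw [mul_one, ← hT, h2, hasseDeriv_one] at h3
    obtain ⟨S, hS⟩ := mv_deriv_zero_pow (p := p) T (pow_eq_zero_iff (pow_pos hp.out.pos l).ne' |>.1 h3.symm)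
    exact ⟨S, by rw [hT, hS, ← pow_mul, pow_succ' p]⟩

theorem mv_hasse_deriv (n : ℕ) (G : K[X]) :
    hasseDeriv n (derivative G) = ((n + 1 : ℕ) : K[X]) * hasseDeriv (n + 1) G := by
  have := LinearMap.congr_fun (hasseDeriv_comp (R := K) n 1) G
  simp only [LinearMap.comp_apply, hasseDeriv_one', LinearMap.smul_apply] at this
  rw [this]
  simp

theorem mv_hasse_pow_lt (a n : ℕ) (T : K[X]) (h0 : 0 < n) (h : n < p ^ a) :
    hasseDeriv n (T ^ p ^ a) = 0 := by
  apply mv_hasse_pow_zero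
  intro hd
  have := Nat.le_of_dvd h0 hd
  omega

theorem mv_dvd_hasse_pow (S : K[X]) (b j : ℕ) : S ^ b ∣ S ^ j * hasseDeriv j (S ^ b) := by
  induction b generalizing j with
  | zero => simp
  | succ b ih =>
    rw [pow_succ, hasseDeriv_mul, Finset.mul_sum]
    apply Finset.dvd_sum
    rintro ⟨i, l⟩ hil
    rw [Finset.HasAntidiagonal.mem_antidiagonal] at hil
    simp only at hil ⊢
    subst hil
    rcases Nat.eq_zero_or_pos l with rfl | hl
    · obtain ⟨c, hc⟩ := ih i
      refine ⟨c, ?_⟩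
      simp only [add_zero, hasseDeriv_zero, LinearMap.id_apply]
      linear_combination S * hc
    · obtain ⟨c, hc⟩ := ih i
      obtain ⟨l, rfl⟩ := Nat.exists_eq_add_of_lt hl
      refine ⟨c * S ^ l * hasseDeriv (0 + l + 1) S, ?_⟩
      have e : S ^ (i + (0 + l + 1)) = S ^ i * S ^ l * S := by ring
      rw [e]
      linear_combination S ^ l * S * hasseDeriv (0 + l + 1) S * hc

end MVhasse


section MVtrip
variable {K : Type*} [Field K]

def MvTrip (F : K[X]) (w c : ℕ) (G S : K[X]) : Prop :=
  G ≠ 0 ∧ S ≠ 0 ∧ F ≠ 0 ∧ G ^ (w + 1) = F ^ (w * c) * S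

theorem MvTrip.deg {F G S : K[X]} {w c : ℕ} (h : MvTrip F w c G S) :
    (w + 1) * G.natDegree = w * c * F.natDegree + S.natDegree := by
  obtain ⟨h1, h2, h3, h4⟩ := h
  have := congrArg natDegree h4
  rwa [natDegree_pow, natDegree_mul (pow_ne_zero _ h3) h2, natDegree_pow] at this

theorem mv_NT {F G S : K[X]} {w c : ℕ} (h : MvTrip F w c G S) (hc : Nat.Coprime c (w + 1))
    (hF : ¬ ∃ (a : K) (g : K[X]), F = C a * g ^ (w + 1)) : 1 ≤ S.natDegree := by
  by_contra hcon
  have hS0 : S.natDegree = 0 := by omega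
  obtain ⟨h1, h2, h3, h4⟩ := h
  obtain ⟨s, rfl⟩ := natDegree_eq_zero.1 hS0
  have hs : s ≠ 0 := by rintro rfl; simp at h2
  apply hF
  rcases Nat.eq_zero_or_pos w with rfl | hw
  · exact ⟨1, F, by simp⟩
  have hcop : Nat.Coprime (w * c) (w + 1) := by
    apply Nat.Coprime.mul_left _ hc
    simp
  obtain ⟨r, hr, hr2⟩ := Nat.exists_mul_mod_eq_one_of_coprime hcop (by omega)
  obtain ⟨t, ht⟩ : ∃ t, w * c * r = 1 + (w + 1) * t := by
    refine ⟨w * c * r / (w + 1), ?_⟩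
    have := Nat.mod_add_div (w * c * r) (w + 1)
    rw [hr2] at this
    exact this.symm
  have e1 : (G ^ r) ^ (w + 1) = (F ^ t) ^ (w + 1) * (F * C (s ^ r)) := by
    calc (G ^ r) ^ (w + 1) = (G ^ (w + 1)) ^ r := by ring
      _ = F ^ (w * c * r) * C s ^ r := by rw [h4, mul_pow, ← pow_mul]
      _ = _ := by rw [ht, C_pow]; ring
  have hd : F ^ t ∣ G ^ r := by
    rw [← IsIntegrallyClosed.pow_dvd_pow_iff (n := w + 1) (by omega)]
    exact ⟨_, e1⟩
  obtain ⟨g, hg⟩ := hd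
  rw [hg, mul_pow] at e1
  have e2 := mul_left_cancel₀ (pow_ne_zero _ (pow_ne_zero _ h3)) e1
  refine ⟨(s ^ r)⁻¹, g, ?_⟩
  rw [e2, mul_comm F, ← mul_assoc, ← C_mul, inv_mul_cancel₀ (pow_ne_zero _ hs)]
  simp

theorem mv_DIV {A B S : K[X]} {P w : ℕ} {e : K} (hA : A ≠ 0) (hS : S ≠ 0)
    (hP : w + 1 ≤ P)
    (h : C e * (A ^ P * S ^ w) = B ^ P * derivative S ^ (w + 1)) : B ∣ A ∨ e = 0 := by
  by_cases he : e = 0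
  · exact Or.inr he
  left
  classical
  have hB : B ≠ 0 := by
    rintro rfl
    rw [zero_pow (by omega), zero_mul] at h
    have : C e * (A ^ P * S ^ w) ≠ 0 :=
      mul_ne_zero (by simpa using he) (mul_ne_zero (pow_ne_zero _ hA) (pow_ne_zero _ hS))
    exact this h
  obtain ⟨A1, hA1⟩ := EuclideanDomain.gcd_dvd_left A B
  obtain ⟨B1, hB1⟩ := EuclideanDomain.gcd_dvd_right A B
  set g := EuclideanDomain.gcd A B with hg
  have hg0 : g ≠ 0 := by
    rintro h0
    rw [h0, zero_mul] at hA1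
    exact hA hA1
  have hcop : IsCoprime A1 B1 := by
    have hx := EuclideanDomain.gcd_eq_gcd_ab A B
    rw [← hg] at hx
    refine ⟨EuclideanDomain.gcdA A B, EuclideanDomain.gcdB A B, ?_⟩
    apply mul_left_cancel₀ hg0
    linear_combination (-1 : K[X]) * hx - EuclideanDomain.gcdA A B * hA1 - EuclideanDomain.gcdB A B * hB1
  have h2 : C e * (A1 ^ P * S ^ w) = B1 ^ P * derivative S ^ (w + 1) := by
    apply mul_left_cancel₀ (pow_ne_zero P hg0)
    have h' := h
    rw [hA1, hB1, mul_pow, mul_pow] at h'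
    linear_combination h'
  by_cases hu : IsUnit B1
  · obtain ⟨c, hc⟩ := hu.dvd (a := A1)
    refine ⟨c, ?_⟩
    linear_combination hA1 + g * hc - c * hB1
  exfalso
  have hB10 : B1 ≠ 0 := by
    rintro h0
    rw [h0, mul_zero] at hB1
    exact hB hB1
  obtain ⟨π, hπ, hπB⟩ := WfDvdMonoid.exists_irreducible_factor hu hB10
  have hprime : Prime π := hπ.prime
  have hπA : ¬ π ∣ A1 := fun hd => hπ.not_isUnit (hcop.isUnit_of_dvd' hd hπB)
  obtain ⟨m, S2, hS2, hS⟩ := WfDvdMonoid.max_power_factor hS hπ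
  have hder : π ^ (m - 1) ∣ derivative S := by
    rw [hS, derivative_mul, derivative_pow]
    apply dvd_add
    · exact Dvd.dvd.mul_right (Dvd.dvd.mul_right (Dvd.dvd.mul_left dvd_rfl _) _) _
    · exact Dvd.dvd.mul_right (pow_dvd_pow _ (by omega)) _
  have h3 : π ^ (m * w + 1) ∣ C e * (A1 ^ P * S ^ w) := by
    rw [h2]
    calc π ^ (m * w + 1) ∣ π ^ (P + (m - 1) * (w + 1)) := by
          apply pow_dvd_pow
          rcases m with _ | m
          · simp; omega
          · simp only [Nat.add_sub_cancel]; nlinarith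
      _ ∣ _ := by
          rw [pow_add, pow_mul]
          exact mul_dvd_mul (pow_dvd_pow_of_dvd hπB _) (pow_dvd_pow_of_dvd hder _)
  rw [hS] at h3
  have h4 : π ∣ C e * A1 ^ P * S2 ^ w := by
    have : C e * (A1 ^ P * (π ^ m * S2) ^ w) = π ^ (m * w) * (C e * A1 ^ P * S2 ^ w) := by
      rw [mul_pow, ← pow_mul]; ring
    rw [this, pow_succ] at h3
    exact (mul_dvd_mul_iff_left (pow_ne_zero _ hπ.ne_zero)).1 h3
  rcases hprime.dvd_or_dvd h4 with h5 | h5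
  · rcases hprime.dvd_or_dvd h5 with h6 | h6
    · exact hπ.not_isUnit (isUnit_of_dvd_unit h6 (isUnit_C.2 (isUnit_iff_ne_zero.2 he)))
    · exact hπA (hprime.dvd_of_dvd_pow h6)
  · exact hS2 (hprime.dvd_of_dvd_pow h5)

variable {p : ℕ} [hp : Fact p.Prime] [CharP K p]

theorem MvTrip.deriv {F G S : K[X]} {w c : ℕ} (h : MvTrip F w c G S) (hpc : p ∣ c) :
    C ((w + 1 : ℕ) : K) * (G ^ w * derivative G) = F ^ (w * c) * derivative S := by
  have h4 := congrArg derivative h.2.2.2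
  obtain ⟨d, rfl⟩ := hpc
  have e : F ^ (w * (p * d)) = (F ^ (w * d)) ^ p := by ring
  rw [derivative_mul, derivative_pow, e, derivative_pow] at h4
  simp only [Nat.add_sub_cancel, CharP.cast_eq_zero, C_0, zero_mul, zero_add] at h4
  rw [e, ← h4]; ring

theorem MvTrip.deriv_deg {F G S : K[X]} {w c : ℕ} (h : MvTrip F w c G S) (hpc : p ∣ c)
    (hG : derivative G ≠ 0) (hv : ((w + 1 : ℕ) : K) ≠ 0) :
    derivative S ≠ 0 ∧
    w * G.natDegree + (derivative G).natDegree = w * c * F.natDegree + (derivative S).natDegree := by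
  have h1 := h.deriv hpc
  have hS : derivative S ≠ 0 := by
    intro h0
    rw [h0, mul_zero] at h1
    exact mul_ne_zero (C_ne_zero.2 hv) (mul_ne_zero (pow_ne_zero _ h.1) hG) h1
  refine ⟨hS, ?_⟩
  have h2 := congrArg natDegree h1
  rwa [natDegree_C_mul hv, natDegree_mul (pow_ne_zero _ h.1) hG, natDegree_pow,
    natDegree_mul (pow_ne_zero _ h.2.2.1) hS, natDegree_pow] at h2

theorem mv_F2 {F G S : K[X]} {w c : ℕ} (h : MvTrip F w c G S) (hpc : p ∣ c)
    (hG : derivative G ≠ 0) (hv : ((w + 1 : ℕ) : K) ≠ 0) :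
    w * c * F.natDegree ≤ (w + 1) * (derivative G).natDegree + w * S.natDegree := by
  have h1 := (h.deriv_deg hpc hG hv).2
  have h2 := h.deg
  nlinarith

theorem mv_DIVC {F G S T : K[X]} {w c1 l : ℕ} (h : MvTrip F w (p ^ l * c1) G S)
    (hl : w + 1 ≤ p ^ l) (hl0 : 0 < l) (hT : derivative G = T ^ p ^ l) (hT0 : T ≠ 0)
    (hv : ((w + 1 : ℕ) : K) ≠ 0) :
    ∃ S1, MvTrip F w c1 T S1 ∧ p ^ l * S1.natDegree + (w + 1) ≤ S.natDegree := by
  have hpc : p ∣ p ^ l * c1 := Dvd.dvd.mul_right (dvd_pow_self p hl0.ne') _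
  have hG : derivative G ≠ 0 := by rw [hT]; exact pow_ne_zero _ hT0
  have h1 := h.deriv hpc
  obtain ⟨hS', hdeg⟩ := h.deriv_deg hpc hG hv
  have h2 := h.deg
  have h3 : C (((w + 1 : ℕ) : K) ^ (w + 1)) * ((T ^ (w + 1)) ^ p ^ l * S ^ w)
      = (F ^ (w * c1)) ^ p ^ l * derivative S ^ (w + 1) := by
    apply mul_left_cancel₀ (pow_ne_zero w (pow_ne_zero (w * (p ^ l * c1)) h.2.2.1))
    have e1 := congrArg (· ^ (w + 1)) h1
    have e2 : (T ^ (w + 1)) ^ p ^ l = derivative G ^ (w + 1) := by rw [hT]; ring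
    have e3 : (G ^ w) ^ (w + 1) = (F ^ (w * (p ^ l * c1)) * S) ^ w := by
      rw [← h.2.2.2]; ring
    have e4 : (F ^ (w * c1)) ^ p ^ l = F ^ (w * (p ^ l * c1)) := by ring
    rw [e2, e4, C_pow]
    rw [mul_pow, mul_pow, mul_pow, e3, mul_pow] at e1
    linear_combination e1
  rcases mv_DIV (pow_ne_zero _ hT0) h.2.1 hl h3 with h4 | h4
  · obtain ⟨S1, hS1⟩ := h4
    have ht : MvTrip F w c1 T S1 := by
      refine ⟨hT0, ?_, h.2.2.1, hS1⟩
      rintro rfl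
      rw [mul_zero] at hS1
      exact pow_ne_zero _ hT0 hS1
    refine ⟨S1, ht, ?_⟩
    have h5 := ht.deg
    have hS0 : S.natDegree ≠ 0 := by
      intro h0
      exact hS' (derivative_of_natDegree_zero h0)
    have h6 := natDegree_derivative_lt hS0
    rw [hT, natDegree_pow] at hdeg
    have h7 := congrArg (p ^ l * ·) h5
    have h8 := congrArg ((w + 1) * ·) hdeg
    nlinarith
  · exact absurd h4 (pow_ne_zero _ hv)

theorem mv_SG {F G S : K[X]} {w t : ℕ} (h : MvTrip F w (p ^ t) G S)
    (hc : Nat.Coprime p (w + 1)) (i : ℕ) (hi : i < p ^ t) : G ∣ S ^ i * hasseDeriv i G := by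
  have hcop : Nat.Coprime (p ^ t) (w + 1) := Nat.Coprime.pow_left _ hc
  obtain ⟨b, c', hb⟩ : ∃ b c', 1 + (w + 1) * b = p ^ t * c' := by
    rcases Nat.eq_zero_or_pos w with rfl | hw
    · exact ⟨p ^ t - 1, 1, by have := Nat.pos_of_ne_zero (pow_ne_zero t hp.out.ne_zero); omega⟩
    · obtain ⟨r, hr, hr2⟩ := Nat.exists_mul_mod_eq_one_of_coprime hcop (by omega)
      refine ⟨p ^ t * r / (w + 1), r, ?_⟩
      have := Nat.mod_add_div (p ^ t * r) (w + 1)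
      rw [hr2] at this
      exact this
  have hM : (F ^ (w * b)) ^ p ^ t * (G * S ^ b) = (G ^ c') ^ p ^ t := by
    calc _ = G * (F ^ (w * p ^ t) * S) ^ b := by ring
      _ = G ^ (1 + (w + 1) * b) := by rw [← h.2.2.2]; ring
      _ = _ := by rw [hb]; ring
  have hD : ∀ i, 0 < i → i < p ^ t → hasseDeriv i (G * S ^ b) = 0 := by
    intro i hi0 hi
    have e1 := mv_hasse_pow_mul t i (F ^ (w * b)) (G * S ^ b) hi
    rw [hM, mv_hasse_pow_lt t i _ hi0 hi] at e1
    rcases mul_eq_zero.1 e1.symm with h0 | h0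
    · exact absurd h0 (pow_ne_zero _ (pow_ne_zero _ h.2.2.1))
    · exact h0
  induction i using Nat.strong_induction_on with
  | _ i ih =>
    rcases Nat.eq_zero_or_pos i with rfl | hi0
    · simp
    have e1 := hD i hi0 hi
    rw [hasseDeriv_mul] at e1
    rw [← Finset.add_sum_erase _ _ (show (i, 0) ∈ Finset.HasAntidiagonal.antidiagonal i by simp)] at e1
    have e2 : G * S ^ b ∣ S ^ i * ∑ x ∈ (Finset.HasAntidiagonal.antidiagonal i).erase (i, 0),
        hasseDeriv x.1 G * hasseDeriv x.2 (S ^ b) := by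
      rw [Finset.mul_sum]
      apply Finset.dvd_sum
      rintro ⟨x, y⟩ hxy
      rw [Finset.mem_erase, Finset.HasAntidiagonal.mem_antidiagonal] at hxy
      obtain ⟨hne, hxy⟩ := hxy
      simp only at hxy ⊢
      have hx : x < i := by
        rcases Nat.lt_or_ge x i with h0 | h0
        · exact h0
        · exfalso; apply hne
          have : x = i ∧ y = 0 := by omega
          rw [this.1, this.2]
      obtain ⟨u, hu⟩ := ih x hx (by omega)
      obtain ⟨z, hz⟩ := mv_dvd_hasse_pow S b y
      refine ⟨u * z, ?_⟩
      rw [← hxy, pow_add]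
      linear_combination S ^ y * hasseDeriv y (S ^ b) * hu + G * u * hz
    have e3 : G * S ^ b ∣ S ^ i * hasseDeriv i G * S ^ b := by
      obtain ⟨z, hz⟩ := e2
      simp only [hasseDeriv_zero, LinearMap.id_apply] at e1
      refine ⟨-z, ?_⟩
      linear_combination S ^ i * e1 - hz
    exact (mul_dvd_mul_iff_right (pow_ne_zero _ h.2.1)).1 e3

end MVtrip


section MVlemR
variable {K : Type*} [Field K] {p : ℕ} [hp : Fact p.Prime] [CharP K p]

theorem mv_cop {k w : ℕ} (hk : 0 < k) (hvd : (w + 1) ∣ p ^ k - 1) : Nat.Coprime p (w + 1) := by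
  rw [hp.out.coprime_iff_not_dvd]
  intro h
  have h1 : p ∣ p ^ k - 1 := h.trans hvd
  have h2 : p ∣ p ^ k := dvd_pow_self p hk.ne'
  have h3 : 0 < p ^ k := pow_pos hp.out.pos k
  have h4 : p ∣ 1 := by
    have := Nat.dvd_sub h2 h1
    rwa [Nat.sub_sub_self h3] at this
  exact hp.out.one_lt.ne' (Nat.dvd_one.1 h4)

theorem mv_cast {k w : ℕ} (hk : 0 < k) (hvd : (w + 1) ∣ p ^ k - 1) : ((w + 1 : ℕ) : K) ≠ 0 := by
  intro h
  rw [CharP.cast_eq_zero_iff K p] at h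
  exact (hp.out.coprime_iff_not_dvd.1 (mv_cop hk hvd)) h

theorem mv_wQ {k w : ℕ} (hk : 0 < k) (hvd : (w + 1) ∣ p ^ k - 1) : w + 2 ≤ p ^ k := by
  have h1 : 1 < p ^ k := Nat.one_lt_pow hk.ne' hp.out.one_lt
  have := Nat.le_of_dvd (by omega) hvd
  omega

theorem mv_LB [Finite K] {k w t l κ : ℕ} (hk : 0 < k) (hvd : (w + 1) ∣ p ^ k - 1)
    (hκ : κ + p ^ k + 1 = p ^ k * p ^ k)
    {F G S : K[X]} (h : MvTrip F w (p ^ t) G S) (hl : ∀ i < l, hasseDeriv (p ^ i) (derivative G) = 0)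
    (hne : hasseDeriv (p ^ l) (derivative G) ≠ 0) (hlt : l < t) (hkt : k < t) :
    w * p ^ t * F.natDegree ≤
      (w + 1) * (hasseDeriv (p ^ l) (derivative G)).natDegree + κ * S.natDegree := by
  have hcop := mv_cop hk hvd
  have hcast : ((w + 1 : ℕ) : K) ≠ 0 := mv_cast hk hvd
  have hwQ := mv_wQ hk hvd
  have hdeg := h.deg
  rcases Nat.lt_or_ge l k with hlk | hlk
  · have h1 : 2 * p ^ l ≤ p ^ k := by
      calc 2 * p ^ l ≤ p * p ^ l := Nat.mul_le_mul_right _ hp.out.two_le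
        _ = p ^ (l + 1) := by ring
        _ ≤ p ^ k := Nat.pow_le_pow_right hp.out.pos hlk
    have h2 : p ^ k < p ^ t := Nat.pow_lt_pow_right hp.out.one_lt hkt
    have h3 : 0 < p ^ l := pow_pos hp.out.pos l
    rw [mv_hasse_deriv] at hne ⊢
    have hc0 : ((p ^ l + 1 : ℕ) : K[X]) ≠ 0 := left_ne_zero_of_mul hne
    have hd0 : hasseDeriv (p ^ l + 1) G ≠ 0 := right_ne_zero_of_mul hne
    obtain ⟨z, hz⟩ := mv_SG h hcop (p ^ l + 1) (by omega)
    have hz0 : z ≠ 0 := by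
      rintro rfl
      rw [mul_zero] at hz
      exact mul_ne_zero (pow_ne_zero _ h.2.1) hd0 hz
    have h4 := congrArg natDegree hz
    rw [natDegree_mul (pow_ne_zero _ h.2.1) hd0, natDegree_pow, natDegree_mul h.1 hz0] at h4
    rw [natDegree_mul hc0 hd0, natDegree_natCast]
    have h5 : (w + 1) * (p ^ l + 1) ≤ κ + 1 := by
      have : (w + 1 + 1) * 2 * (p ^ l) ≤ p ^ k * p ^ k := by
        rw [mul_assoc]; exact Nat.mul_le_mul (by omega) h1
      nlinarith
    have h6 : (w + 1) * (p ^ l + 1) * S.natDegree ≤ (κ + 1) * S.natDegree :=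
      Nat.mul_le_mul_right _ h5
    nlinarith
  · obtain ⟨T, hT⟩ := mv_hasse_zero_pow l _ hl
    have h1 : p ^ k ≤ p ^ l := Nat.pow_le_pow_right hp.out.pos hlk
    obtain ⟨s, rfl⟩ := Nat.exists_eq_add_of_lt hlt
    have e1 := mv_hasse_pow l 1 T
    rw [mul_one, ← hT, hasseDeriv_one] at e1
    have hT' : derivative T ≠ 0 := by
      intro h0
      rw [e1, h0, zero_pow (pow_pos hp.out.pos l).ne'] at hne
      exact hne rfl
    have hT0 : T ≠ 0 := by rintro rfl; simp at hT'
    have e2 : p ^ (l + s + 1) = p ^ l * p ^ (s + 1) := by ring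
    rw [e2] at h hdeg ⊢
    obtain ⟨S1, hS1, hS2⟩ := mv_DIVC h (by omega) (by omega) hT hT0 hcast
    have h2 := mv_F2 (p := p) hS1 (dvd_pow_self p (by omega)) hT' hcast
    rw [e1, natDegree_pow]
    have h3 : w ≤ κ := by nlinarith
    have h4 : w * S.natDegree ≤ κ * S.natDegree := Nat.mul_le_mul_right _ h3
    have h5 := Nat.mul_le_mul_left (p ^ l) h2
    have h6 : w * (p ^ l * S1.natDegree + (w + 1)) ≤ w * S.natDegree := Nat.mul_le_mul_left _ hS2
    nlinarith

theorem mv_lemR [Finite K] {k w κ i j a γ τ : ℕ} (hk : 0 < k) (hvd : (w + 1) ∣ p ^ k - 1)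
    (hκ : κ + p ^ k + 1 = p ^ k * p ^ k) (hi : 1 ≤ i) (hij : i ≤ j) (hia : i ≤ a) (hγ : i < γ)
    {F T S Θ : K[X]} {b : K} (h : MvTrip F w (p ^ (k * γ)) T S) (hT : derivative T ≠ 0)
    (hΘ0 : Θ ≠ 0) (hΘ : (w + 1) * Θ.natDegree + w * F.natDegree = w * F.natDegree * p ^ (k * j))
    (hZ : (w + 1) * (C b * T ^ p ^ (k * j) - X ^ p ^ (k * a) * (derivative T * Θ ^ p ^ (k * γ))).natDegree
      ≤ p ^ (k * γ) * p ^ (k * j) * (w * F.natDegree) + τ)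
    (hlt : κ * S.natDegree + τ < (w + 1) * p ^ (k * a)) :
    ∃ W S1, derivative T = W ^ p ^ (k * i) ∧ MvTrip F w (p ^ (k * (γ - i))) W S1 ∧
      p ^ (k * i) * S1.natDegree + (w + 1) ≤ S.natDegree := by
  have hcast : ((w + 1 : ℕ) : K) ≠ 0 := mv_cast hk hvd
  have hwQ := mv_wQ hk hvd
  have key : ∀ l, l < k * i → hasseDeriv (p ^ l) (derivative T) = 0 := by
    intro l
    induction l using Nat.strong_induction_on with
    | _ l ih =>
      intro hl
      by_contra hne
      have hki : k * i < k * γ := Nat.mul_lt_mul_of_pos_left hγ hk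
      have hkj : k * i ≤ k * j := Nat.mul_le_mul_left _ hij
      have hka : k * i ≤ k * a := Nat.mul_le_mul_left _ hia
      have hk1 : k ≤ k * i := Nat.le_mul_of_pos_right _ hi
      have h1 := mv_LB hk hvd hκ h (fun i' hi' => ih i' hi' (by omega)) hne (by omega) (by omega)
      have hlt' : ∀ x, k * i ≤ x → p ^ l < p ^ x := fun x hx =>
        Nat.pow_lt_pow_right hp.out.one_lt (by omega)
      have e1 : hasseDeriv (p ^ l) (C b * T ^ p ^ (k * j) -
          X ^ p ^ (k * a) * (derivative T * Θ ^ p ^ (k * γ)))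
          = - (X ^ p ^ (k * a) * (Θ ^ p ^ (k * γ) * hasseDeriv (p ^ l) (derivative T))) := by
        rw [map_sub, ← smul_eq_C_mul, map_smul,
          mv_hasse_pow_lt _ _ _ (pow_pos hp.out.pos l) (hlt' _ hkj),
          mv_hasse_pow_mul _ _ _ _ (hlt' _ hka), mul_comm (derivative T),
          mv_hasse_pow_mul _ _ _ _ (hlt' _ hki.le)]
        simp
      have e2 := natDegree_hasseDeriv_le (C b * T ^ p ^ (k * j) -
          X ^ p ^ (k * a) * (derivative T * Θ ^ p ^ (k * γ))) (p ^ l)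
      rw [e1, natDegree_neg, natDegree_mul (pow_ne_zero _ X_ne_zero)
        (mul_ne_zero (pow_ne_zero _ hΘ0) hne), natDegree_mul (pow_ne_zero _ hΘ0) hne,
        natDegree_pow, natDegree_pow, natDegree_X, mul_one] at e2
      have e3 := (Nat.mul_le_mul_left (w + 1) (e2.trans (Nat.sub_le _ _))).trans hZ
      have e4 := congrArg (p ^ (k * γ) * ·) hΘ
      nlinarith
  obtain ⟨W, hW⟩ := mv_hasse_zero_pow (k * i) _ key
  have hW0 : W ≠ 0 := by
    rintro rfl
    rw [zero_pow (pow_pos hp.out.pos _).ne'] at hW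
    exact hT hW
  have e5 : p ^ (k * γ) = p ^ (k * i) * p ^ (k * (γ - i)) := by
    rw [← pow_add, ← mul_add]; congr 2; omega
  rw [e5] at h
  have hk1 : k ≤ k * i := Nat.le_mul_of_pos_right _ hi
  have h1 : p ^ k ≤ p ^ (k * i) := Nat.pow_le_pow_right hp.out.pos hk1
  obtain ⟨S1, hS1, hS2⟩ := mv_DIVC h (by omega) (by omega) hW hW0 hcast
  exact ⟨W, S1, hW, hS1, hS2⟩

end MVlemR


section MVstep
variable {K : Type*} [Field K] {p : ℕ} [hp : Fact p.Prime] [CharP K p]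

theorem mv_hasse_XqX (q n : ℕ) (a : ℕ) (hq : q = p ^ a) (hn : n + 1 < q) (G : K[X]) :
    hasseDeriv (n + 1) ((X ^ q - X) * derivative G)
      = (X ^ q - X) * hasseDeriv (n + 1) (derivative G) - ((n + 1 : ℕ) : K[X]) * hasseDeriv (n + 1) G := by
  rw [sub_mul, map_sub, hq, mv_hasse_pow_mul _ _ _ _ (by omega), sub_mul, sub_sub]
  congr 1
  rw [hasseDeriv_mul, ← Finset.add_sum_erase _ _
    (show (0, n + 1) ∈ Finset.HasAntidiagonal.antidiagonal (n + 1) by simp),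
    ← Finset.add_sum_erase _ _
    (show (1, n) ∈ (Finset.HasAntidiagonal.antidiagonal (n + 1)).erase (0, n + 1) by
      simp [Finset.HasAntidiagonal.mem_antidiagonal, add_comm])]
  rw [Finset.sum_eq_zero, ← mv_hasse_deriv]
  · simp
  · rintro ⟨i, j⟩ hij
    simp only [Finset.mem_erase, Finset.HasAntidiagonal.mem_antidiagonal] at hij
    obtain ⟨h1, h2, h3⟩ := hij
    have : 1 < i := by
      by_contra hc
      rcases (by omega : i = 0 ∨ i = 1) with rfl | rfl
      · apply h2; simp at h3; rw [h3]
      · apply h1; rw [show j = n by omega]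
    simp only
    rw [hasseDeriv_X _ this, zero_mul]

variable {k N L B : ℕ} {a β : ℕ → K} {H : K[X]} {J Θ : ℕ → K[X]}

theorem mv_DJ
    (hJ : ∀ i, J i * Θ i ^ p ^ (k * L) = H ^ p ^ (k * i)) {l : ℕ} (hl : l < k * L) (i : ℕ) :
    Θ i ^ p ^ (k * L) * hasseDeriv (p ^ l) (J i) = 
      if k * i ≤ l then (hasseDeriv (p ^ (l - k * i)) H) ^ p ^ (k * i) else 0 := by
  rw [← mv_hasse_pow_mul _ _ _ _ (Nat.pow_lt_pow_right hp.out.one_lt hl), mul_comm, hJ]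
  split_ifs with h
  · rw [← mv_hasse_pow, ← pow_add]
    congr 2; congr 1; omega
  · apply mv_hasse_pow_lt _ _ _ (pow_pos hp.out.pos l)
    exact Nat.pow_lt_pow_right hp.out.one_lt (by omega)

theorem mv_step0 (hk : 0 < k) (hN : 0 < N) (hNL : N ≤ L) (ha0 : a 0 ≠ 0)
    (hΘ0 : ∀ i, Θ i ≠ 0) (hJ0 : J 0 = H)
    (hJ : ∀ i, J i * Θ i ^ p ^ (k * L) = H ^ p ^ (k * i))
    (hEQ : ∑ i ∈ Finset.range (B + 1), C (a i) * J i
      + C (a 0) * ((X ^ p ^ (k * N) - X) * derivative H) = 0) :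
    hasseDeriv (p ^ 0) (derivative H) = 0 := by
  have hkN : 0 < k * N := Nat.mul_pos hk hN
  have hkL : 0 < k * L := Nat.mul_pos hk (by omega)
  have h1p : 1 < p ^ (k * N) := Nat.one_lt_pow hkN.ne' hp.out.one_lt
  have e := congrArg (hasseDeriv (0 + 1)) hEQ
  have hXq : (X ^ p ^ (k * N) - X : K[X]) ≠ 0 := FiniteField.X_pow_card_sub_X_ne_zero K h1p
  rw [map_zero, map_add, ← smul_eq_C_mul (a 0), map_smul, mv_hasse_XqX _ 0 _ rfl (by simpa using h1p),
    Finset.sum_range_succ', map_add, map_sum, Finset.sum_eq_zero, hJ0,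
    ← smul_eq_C_mul (a 0), map_smul] at e
  · simp only [zero_add, Nat.cast_one, one_mul, ← smul_add, add_sub_cancel] at e
    rw [smul_eq_zero] at e
    rcases e with e | e
    · exact absurd e ha0
    · rcases mul_eq_zero.1 e with e | e
      · exact absurd e hXq
      · simpa using e
  · intro i hi
    rw [← smul_eq_C_mul, map_smul]
    have h2 := mv_DJ hJ hkL (i + 1)
    rw [if_neg (by have := Nat.mul_pos hk (Nat.succ_pos i); simp only [Nat.succ_eq_add_one] at this; omega)] at h2
    rcases mul_eq_zero.1 h2 with h3 | h3
    · exact absurd h3 (pow_ne_zero _ (hΘ0 _))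
    · rw [pow_zero] at h3
      rw [zero_add, h3, smul_zero]

theorem mv_step1 {l : ℕ} (hl0 : 0 < l) (hl : l < k * N) (hJ0 : J 0 = H)
    (hEQ : ∑ i ∈ Finset.range (B + 1), C (a i) * J i
      + C (a 0) * ((X ^ p ^ (k * N) - X) * derivative H) = 0) :
    C (a 0) * (hasseDeriv (p ^ l) H + (X ^ p ^ (k * N) - X) * hasseDeriv (p ^ l) (derivative H))
      = - ∑ i ∈ Finset.range B, C (a (i + 1)) * hasseDeriv (p ^ l) (J (i + 1)) := by
  have hlt : p ^ l < p ^ (k * N) := Nat.pow_lt_pow_right hp.out.one_lt hl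
  have e := congrArg (hasseDeriv (p ^ l)) hEQ
  obtain ⟨n, hn⟩ := Nat.exists_eq_succ_of_ne_zero (pow_pos hp.out.pos l).ne'
  have hz : ((p ^ l : ℕ) : K[X]) = 0 := by
    push_cast
    rw [CharP.cast_eq_zero, zero_pow hl0.ne']
  have e2 := mv_hasse_XqX (p ^ (k * N)) n _ rfl (by omega) H
  rw [← Nat.succ_eq_add_one, ← hn, hz, zero_mul, sub_zero] at e2
  rw [map_zero, map_add, ← smul_eq_C_mul (a 0), map_smul, e2, Finset.sum_range_succ', map_add,
    map_sum, hJ0, ← smul_eq_C_mul (a 0), map_smul] at e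
  simp only [← smul_eq_C_mul, map_smul] at e ⊢
  rw [smul_add]
  linear_combination e

theorem mv_step2 {l : ℕ} (hk : 0 < k) (hl0 : 0 < l) (hl : l < k * N) (hNL : N ≤ L) (ha0 : a 0 ≠ 0) (hJ0 : J 0 = H)
    (hΘ0 : ∀ i, Θ i ≠ 0)
    (hJ : ∀ i, J i * Θ i ^ p ^ (k * L) = H ^ p ^ (k * i))
    (hEQ : ∑ i ∈ Finset.range (B + 1), C (a i) * J i
      + C (a 0) * ((X ^ p ^ (k * N) - X) * derivative H) = 0)
    (hkl : ¬ k ∣ l) (ih : ∀ l' < l, ¬ k ∣ l' → hasseDeriv (p ^ l') H = 0) :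
    hasseDeriv (p ^ l) H + (X ^ p ^ (k * N) - X) * hasseDeriv (p ^ l) (derivative H) = 0 := by
  have e := mv_step1 hl0 hl hJ0 hEQ
  have hkL : l < k * L := lt_of_lt_of_le hl (Nat.mul_le_mul_left _ hNL)
  rw [Finset.sum_eq_zero, neg_zero] at e
  · rcases mul_eq_zero.1 e with e | e
    · exact absurd (C_eq_zero.1 e) ha0
    · exact e
  · intro i hi
    have h2 := mv_DJ hJ hkL (i + 1)
    have h4 : (if k * (i + 1) ≤ l then (hasseDeriv (p ^ (l - k * (i + 1))) H) ^ p ^ (k * (i + 1)) else 0) = 0 := by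
      split_ifs with h
      · rw [ih, zero_pow (pow_pos hp.out.pos _).ne']
        · have := Nat.mul_pos hk (Nat.succ_pos i)
          simp only [Nat.succ_eq_add_one] at this
          omega
        · intro hd
          apply hkl
          have := dvd_add hd (dvd_mul_right k (i + 1))
          rwa [Nat.sub_add_cancel h] at this
      · rfl
    rw [h4] at h2
    rcases mul_eq_zero.1 h2 with h3 | h3
    · exact absurd h3 (pow_ne_zero _ (hΘ0 _))
    · rw [h3, mul_zero]

theorem mv_step3 {j : ℕ} (hk : 0 < k) (hj0 : 0 < j) (hj : j < N) (hNL : N ≤ L) (hB : N ≤ B) (ha0 : a 0 ≠ 0) (hJ0 : J 0 = H)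
    (hΘ0 : ∀ i, Θ i ≠ 0) (hΘ : ∀ i j, Θ (i + j) = Θ i * Θ j ^ p ^ (k * i))
    (hJ : ∀ i, J i * Θ i ^ p ^ (k * L) = H ^ p ^ (k * i))
    (hEQ : ∑ i ∈ Finset.range (B + 1), C (a i) * J i
      + C (a 0) * ((X ^ p ^ (k * N) - X) * derivative H) = 0)
    (hβ : a 0 * β j = - ∑ i ∈ Finset.range j, a (i + 1) * β (j - 1 - i) ^ p ^ (k * (i + 1)))
    (ih : ∀ i < j, hasseDeriv (p ^ (k * i)) H * Θ i ^ p ^ (k * L) = C (β i) * derivative H ^ p ^ (k * i)) :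
    (hasseDeriv (p ^ (k * j)) H + (X ^ p ^ (k * N) - X) * hasseDeriv (p ^ (k * j)) (derivative H))
      * Θ j ^ p ^ (k * L) = C (β j) * derivative H ^ p ^ (k * j) := by
  have hl : k * j < k * N := Nat.mul_lt_mul_of_pos_left hj hk
  have e := mv_step1 (Nat.mul_pos hk hj0) hl hJ0 hEQ
  have hkL : k * j < k * L := lt_of_lt_of_le hl (Nat.mul_le_mul_left _ hNL)
  apply mul_left_cancel₀ (C_ne_zero.2 ha0)
  rw [← mul_assoc, e, ← mul_assoc, ← C_mul, hβ, neg_mul, Finset.sum_mul, C_neg, neg_mul]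
  congr 1
  rw [map_sum, Finset.sum_mul]
  symm
  apply Finset.sum_subset_zero_on_sdiff (Finset.range_subset_range.2 (by omega))
  · intro i hi
    simp only [Finset.mem_sdiff, Finset.mem_range] at hi
    have h2 := mv_DJ hJ hkL (i + 1)
    rw [if_neg (by have : k * j < k * (i + 1) := Nat.mul_lt_mul_of_pos_left (by omega) hk
                   omega)] at h2
    rcases mul_eq_zero.1 h2 with h3 | h3
    · exact absurd h3 (pow_ne_zero _ (hΘ0 _))
    · rw [h3, mul_zero, zero_mul]
  · intro i hi
    rw [Finset.mem_range] at hi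
    have h2 := mv_DJ hJ hkL (i + 1)
    rw [if_pos (Nat.mul_le_mul_left _ hi), ← Nat.mul_sub] at h2
    have h3 := congrArg (· ^ p ^ (k * (i + 1))) (ih (j - (i + 1)) (by omega))
    have h4 := hΘ (i + 1) (j - (i + 1))
    rw [Nat.add_sub_cancel' hi] at h4
    have h5 : derivative H ^ p ^ (k * j) = (derivative H ^ p ^ (k * (j - (i + 1)))) ^ p ^ (k * (i + 1)) := by
      rw [← pow_mul, ← pow_add, ← mul_add, Nat.sub_add_cancel hi]
    rw [h4, h5, C_mul, C_pow, show j - 1 - i = j - (i + 1) by omega]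
    rw [mul_pow, mul_pow, ← h2] at h3
    rw [mul_pow]
    linear_combination (-C (a (i + 1))) * h3

end MVstep


theorem mv_num1 {Q w R m x y : ℕ} (hQ : w + 2 ≤ Q) (hm : 1 ≤ m) (hR : R + 1 = Q ^ m)
    (h : R * Q ^ x < (w + 1) * Q ^ y) : x + m ≤ y := by
  by_contra hc
  have h1 : Q ^ y ≤ Q ^ (x + (m - 1)) := Nat.pow_le_pow_right (by omega) (by omega)
  obtain ⟨m, rfl⟩ := Nat.exists_eq_succ_of_ne_zero (by omega : m ≠ 0)
  simp only [Nat.succ_eq_add_one, Nat.add_sub_cancel] at *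
  have h2 : 0 < Q ^ m := pow_pos (by omega) _
  have h3 : (w + 1) * Q ^ m ≤ R := by
    rw [pow_succ] at hR
    nlinarith
  have h4 : (w + 1) * Q ^ y ≤ R * Q ^ x := by
    calc (w + 1) * Q ^ y ≤ (w + 1) * Q ^ (x + m) := Nat.mul_le_mul_left _ h1
      _ = (w + 1) * Q ^ m * Q ^ x := by ring
      _ ≤ R * Q ^ x := Nat.mul_le_mul_right _ h3
  omega

theorem mv_num3 {Q R m κ : ℕ} (hQ : 2 ≤ Q) (hm : 2 ≤ m) (hR : R + 1 = Q ^ m)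
    (hκ : κ + Q + 1 = Q * Q) : κ + Q ^ (m - 1) ≤ R := by
  obtain ⟨m, rfl⟩ := Nat.exists_eq_add_of_le hm
  rw [show 2 + m - 1 = m + 1 by omega]
  have e : Q ^ (2 + m) = Q * Q ^ (m + 1) := by ring
  rw [e] at hR
  have h2 : 1 ≤ Q ^ m := Nat.one_le_pow _ _ (by omega)
  have h3 : Q ^ (m + 1) = Q * Q ^ m := by ring
  rw [h3] at hR ⊢
  obtain ⟨z, hz⟩ := Nat.exists_eq_add_of_le h2
  rw [hz] at hR ⊢
  have : Q * z ≤ Q * (Q * z) := Nat.le_mul_of_pos_left _ (by omega)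
  nlinarith

theorem mv_num2 {Q R m κ : ℕ} (hQ : 2 ≤ Q) (hm : 2 ≤ m) (hR : R + 1 = Q ^ m)
    (hκ : κ + Q + 1 = Q * Q) : κ + 1 ≤ R := by
  have h1 := mv_num3 hQ hm hR hκ
  have h2 : 1 ≤ Q ^ (m - 1) := Nat.one_le_pow _ _ (by omega)
  omega

section MVstage1
variable {K : Type*} [Field K] [Finite K] {p : ℕ} [hp : Fact p.Prime] [CharP K p]

theorem mv_stage1a {k w κ N L B m R : ℕ} {a β : ℕ → K} {F H : K[X]} {J Θ : ℕ → K[X]}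
    (hk : 0 < k) (hvd : (w + 1) ∣ p ^ k - 1) (hκ : κ + p ^ k + 1 = p ^ k * p ^ k)
    (hm : 2 ≤ m) (hR : R + 1 = (p ^ k) ^ m) (hD : R * F.natDegree < (w + 1) * p ^ (k * N))
    (hN : 0 < N) (hNL : N < L) (hB : N ≤ B)
    (hF : ¬ ∃ (a : K) (g : K[X]), F = C a * g ^ (w + 1))
    (h : MvTrip F w (p ^ (k * L)) H F) (hH : derivative H ≠ 0)
    (ha0 : a 0 ≠ 0) (hJ0 : J 0 = H) (hΘ00 : Θ 0 = 1)
    (hΘ0 : ∀ i, Θ i ≠ 0) (hΘ : ∀ i j, Θ (i + j) = Θ i * Θ j ^ p ^ (k * i))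
    (hJ : ∀ i, J i * Θ i ^ p ^ (k * L) = H ^ p ^ (k * i))
    (hEQ : ∑ i ∈ Finset.range (B + 1), C (a i) * J i
      + C (a 0) * ((X ^ p ^ (k * N) - X) * derivative H) = 0)
    (hβ0 : β 0 = 1)
    (hβ : ∀ j, 0 < j → a 0 * β j = - ∑ i ∈ Finset.range j, a (i + 1) * β (j - 1 - i) ^ p ^ (k * (i + 1))) :
    ∃ j, 0 < j ∧ j < N ∧ (∀ l < k * j, hasseDeriv (p ^ l) (derivative H) = 0) ∧
      hasseDeriv (p ^ (k * j)) (derivative H) ≠ 0 ∧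
      (∀ i < j, hasseDeriv (p ^ (k * i)) H * Θ i ^ p ^ (k * L) = C (β i) * derivative H ^ p ^ (k * i)) ∧
      (hasseDeriv (p ^ (k * j)) H + (X ^ p ^ (k * N) - X) * hasseDeriv (p ^ (k * j)) (derivative H))
      * Θ j ^ p ^ (k * L) = C (β j) * derivative H ^ p ^ (k * j) := by
  have hwQ := mv_wQ hk hvd
  have hcast : ((w + 1 : ℕ) : K) ≠ 0 := mv_cast hk hvd
  have hcop := mv_cop hk hvd
  have hκR := mv_num2 (by omega) hm hR hκ
  have hdegH := h.deg
  have hex : ∃ l, l < k * N ∧ hasseDeriv (p ^ l) (derivative H) ≠ 0 := by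
    by_contra hcon
    push Not at hcon
    obtain ⟨T, hT⟩ := mv_hasse_zero_pow (k * N) _ hcon
    have hT0 : T ≠ 0 := by
      rintro rfl
      rw [zero_pow (pow_pos hp.out.pos _).ne'] at hT
      exact hH hT
    have e5 : p ^ (k * L) = p ^ (k * N) * p ^ (k * (L - N)) := by
      rw [← pow_add, ← mul_add]; congr 2; omega
    have hk1 : k ≤ k * N := Nat.le_mul_of_pos_right _ hN
    have h1 : p ^ k ≤ p ^ (k * N) := Nat.pow_le_pow_right hp.out.pos hk1
    rw [e5] at h
    obtain ⟨S1, hS1, hS2⟩ := mv_DIVC h (by omega) (by omega) hT hT0 hcast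
    have h2 := mv_NT hS1 (Nat.Coprime.pow_left _ hcop) hF
    have h3 : w + 1 ≤ R := by nlinarith
    have h4 : p ^ (k * N) ≤ p ^ (k * N) * S1.natDegree := Nat.le_mul_of_pos_right _ h2
    have h5 : (w + 1) * p ^ (k * N) ≤ R * F.natDegree := Nat.mul_le_mul h3 (by omega)
    omega
  classical
  set l := Nat.find hex with hldef
  obtain ⟨hl1, hl2⟩ : l < k * N ∧ hasseDeriv (p ^ l) (derivative H) ≠ 0 := Nat.find_spec hex
  have hl3 : ∀ i < l, hasseDeriv (p ^ i) (derivative H) = 0 := by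
    intro i hi
    have := Nat.find_min hex hi
    by_contra hc
    exact this ⟨by omega, hc⟩
  have hl0 : 0 < l := by
    by_contra hc
    have h0 : l = 0 := by omega
    rw [h0] at hl2
    exact hl2 (mv_step0 hk hN hNL.le ha0 hΘ0 hJ0 hJ hEQ)
  have claim1 : ∀ l' < l, ¬ k ∣ l' → hasseDeriv (p ^ l') H = 0 := by
    intro l'
    induction l' using Nat.strong_induction_on with
    | _ l' ih =>
      intro hl' hkl
      have h1 := mv_step2 hk (Nat.pos_of_ne_zero (by rintro rfl; simp at hkl)) (by omega) hNL.le ha0 hJ0 hΘ0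
        hJ hEQ hkl (fun l'' h'' hk'' => ih l'' h'' (by omega) hk'')
      rwa [hl3 l' hl', mul_zero, add_zero] at h1
  have hkd : k ∣ l := by
    by_contra hkl
    have h1 := mv_step2 hk hl0 hl1 hNL.le ha0 hJ0 hΘ0 hJ hEQ hkl claim1
    have hkL : k * N < k * L := Nat.mul_lt_mul_of_pos_left hNL hk
    have hkN : k ≤ k * N := Nat.le_mul_of_pos_right _ hN
    have h2 := mv_LB hk hvd hκ h hl3 hl2 (by omega) (by omega)
    have h1p : 1 < p ^ (k * N) := Nat.one_lt_pow (by omega) hp.out.one_lt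
    have hXq : (X ^ p ^ (k * N) - X : K[X]) ≠ 0 := FiniteField.X_pow_card_sub_X_ne_zero K h1p
    have h3 : hasseDeriv (p ^ l) H = - ((X ^ p ^ (k * N) - X) * hasseDeriv (p ^ l) (derivative H)) := by
      linear_combination h1
    have h4 := congrArg natDegree h3
    rw [natDegree_neg, natDegree_mul hXq hl2, FiniteField.X_pow_card_sub_X_natDegree_eq K h1p] at h4
    have h5 := natDegree_hasseDeriv_le H (p ^ l)
    have h6 : (w + 1) * (hasseDeriv (p ^ l) H).natDegree ≤ (w + 1) * H.natDegree :=
      Nat.mul_le_mul_left _ (by omega)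
    rw [h4] at h6
    have h7 : (κ + 1) * F.natDegree ≤ R * F.natDegree := Nat.mul_le_mul_right _ hκR
    nlinarith
  obtain ⟨j, hj⟩ := hkd
  rw [hj] at hl1 hl2 hl3 hl0
  have hj0 : 0 < j := Nat.pos_of_mul_pos_left hl0
  have hjN : j < N := Nat.lt_of_mul_lt_mul_left hl1
  have claim2 : ∀ i < j, hasseDeriv (p ^ (k * i)) H * Θ i ^ p ^ (k * L) = C (β i) * derivative H ^ p ^ (k * i) := by
    intro i
    induction i using Nat.strong_induction_on with
    | _ i ih =>
      intro hi
      rcases Nat.eq_zero_or_pos i with rfl | hi0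
      · simp [hβ0, hΘ00]
      have h1 := mv_step3 hk hi0 (by omega) hNL.le hB ha0 hJ0 hΘ0 hΘ hJ hEQ (hβ i hi0)
        (fun i' h' => ih i' h' (by omega))
      rwa [hl3 (k * i) (Nat.mul_lt_mul_of_pos_left hi hk), mul_zero, add_zero] at h1
  exact ⟨j, hj0, hjN, hl3, hl2, claim2,
    mv_step3 hk hj0 hjN hNL.le hB ha0 hJ0 hΘ0 hΘ hJ hEQ (hβ j hj0) claim2⟩

end MVstage1


theorem mv_div_aux {x y d q : ℕ} (hq : 0 < q) (h : q * x ≤ q * y + d) : x ≤ y + d / q := by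
  have h1 : x - y ≤ d / q := by
    rw [Nat.le_div_iff_mul_le hq, Nat.sub_mul]
    rw [mul_comm x, mul_comm y]; omega
  omega

section MVstage1b
variable {K : Type*} [Field K] [Finite K] {p : ℕ} [hp : Fact p.Prime] [CharP K p]

set_option maxHeartbeats 1000000 in
theorem mv_stage1b {k w κ N L m R j : ℕ} {a β : ℕ → K} {F H : K[X]} {Θ : ℕ → K[X]}
    (hk : 0 < k) (hvd : (w + 1) ∣ p ^ k - 1) (hκ : κ + p ^ k + 1 = p ^ k * p ^ k)
    (hm : 2 ≤ m) (hR : R + 1 = (p ^ k) ^ m) (hD : R * F.natDegree < (w + 1) * p ^ (k * N))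
    (hNL : N < L)
    (hF : ¬ ∃ (a : K) (g : K[X]), F = C a * g ^ (w + 1))
    (h : MvTrip F w (p ^ (k * L)) H F)
    (ham : a m ≠ 0) (ham2 : ∀ i, m < i → a i = 0)
    (hΘ0 : ∀ i, Θ i ≠ 0)
    (hΘd : ∀ i, (w + 1) * (Θ i).natDegree + w * F.natDegree = w * F.natDegree * p ^ (k * i))
    (hβ0 : β 0 = 1)
    (hβ : ∀ j, 0 < j → a 0 * β j = - ∑ i ∈ Finset.range j, a (i + 1) * β (j - 1 - i) ^ p ^ (k * (i + 1)))
    (hj0 : 0 < j) (hjN : j < N) (hj1 : ∀ l < k * j, hasseDeriv (p ^ l) (derivative H) = 0)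
    (hj2 : hasseDeriv (p ^ (k * j)) (derivative H) ≠ 0)
    (hj3 : ∀ i < j, hasseDeriv (p ^ (k * i)) H * Θ i ^ p ^ (k * L) = C (β i) * derivative H ^ p ^ (k * i))
    (hj4 : (hasseDeriv (p ^ (k * j)) H + (X ^ p ^ (k * N) - X) * hasseDeriv (p ^ (k * j)) (derivative H))
      * Θ j ^ p ^ (k * L) = C (β j) * derivative H ^ p ^ (k * j)) :
    ∃ T S b, m ≤ j ∧ 2 * j ≤ N ∧ MvTrip F w (p ^ (k * (L - j))) T S ∧ derivative T ≠ 0 ∧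
      p ^ (k * (j - m)) * (p ^ (k * j) * S.natDegree) ≤ F.natDegree ∧
      (w + 1) * (C b * T ^ p ^ (k * j) -
        X ^ p ^ (k * (N - j)) * (derivative T * Θ j ^ p ^ (k * (L - j)))).natDegree
      ≤ p ^ (k * (L - j)) * p ^ (k * j) * (w * F.natDegree) + F.natDegree / p ^ (k * j) := by
  have hwQ := mv_wQ hk hvd
  have hcast : ((w + 1 : ℕ) : K) ≠ 0 := mv_cast hk hvd
  have hcop := mv_cop hk hvd
  have hκR := mv_num2 (by omega) hm hR hκ
  have hκR3 := mv_num3 (by omega) hm hR hκ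
  have hdegH := h.deg
  have hpp : ∀ x, 0 < p ^ x := fun x => pow_pos hp.out.pos x
  obtain ⟨T, hT⟩ := mv_hasse_zero_pow (k * j) _ hj1
  have eT := mv_hasse_pow (k * j) 1 T
  rw [mul_one, ← hT, hasseDeriv_one] at eT
  have hT' : derivative T ≠ 0 := by
    intro h0
    rw [eT, h0, zero_pow (hpp _).ne'] at hj2
    exact hj2 rfl
  have hT0 : T ≠ 0 := by rintro rfl; simp at hT'
  have e5 : p ^ (k * L) = p ^ (k * j) * p ^ (k * (L - j)) := by
    rw [← pow_add, ← mul_add]; congr 2; omega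
  have hk1 : k ≤ k * j := Nat.le_mul_of_pos_right _ hj0
  have h1 : p ^ k ≤ p ^ (k * j) := Nat.pow_le_pow_right hp.out.pos hk1
  have h' := h
  rw [e5] at h'
  obtain ⟨S, hS1, hS2⟩ := mv_DIVC h' (by omega) (by omega) hT hT0 hcast
  have hδ := mv_NT hS1 (Nat.Coprime.pow_left _ hcop) hF
  have hdegT := hS1.deg
  have hkL : k * N < k * L := Nat.mul_lt_mul_of_pos_left hNL hk
  have hkN : k ≤ k * N := Nat.le_mul_of_pos_right _ (by omega)
  have hkj : k * j < k * N := Nat.mul_lt_mul_of_pos_left hjN hk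
  have hLB := mv_LB hk hvd hκ h hj1 hj2 (by omega) (by omega)
  -- the index i0
  classical
  obtain ⟨i0, hi0, hi1, hi2⟩ : ∃ i0, i0 < j ∧ β i0 ≠ 0 ∧ ∀ i, i0 < i → i < j → β i = 0 := by
    refine ⟨Nat.findGreatest (fun i => β i ≠ 0) (j - 1), ?_, ?_, ?_⟩
    · have := Nat.findGreatest_le (P := fun i => β i ≠ 0) (j - 1); omega
    · exact Nat.findGreatest_spec (P := fun i => β i ≠ 0) (Nat.zero_le (j - 1)) (by rw [hβ0]; exact one_ne_zero)
    · intro i hi hij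
      by_contra hc
      exact Nat.findGreatest_is_greatest hi (by omega) hc
  have hB1 : p ^ (k * i0) * (p ^ (k * j) * S.natDegree) ≤ F.natDegree := by
    have e1 := hj3 i0 hi0
    have hne : C (β i0) * derivative H ^ p ^ (k * i0) ≠ 0 := by
      apply mul_ne_zero (C_ne_zero.2 hi1) (pow_ne_zero _ _)
      rw [hT]; exact pow_ne_zero _ hT0
    have hne2 : hasseDeriv (p ^ (k * i0)) H ≠ 0 := by
      intro h0; rw [← e1, h0, zero_mul] at hne; exact hne rfl
    have e2 := congrArg natDegree e1
    rw [natDegree_mul hne2 (pow_ne_zero _ (hΘ0 _)), natDegree_C_mul hi1, natDegree_pow, natDegree_pow,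
      hT, natDegree_pow] at e2
    have e3 := (natDegree_hasseDeriv_le H (p ^ (k * i0))).trans (Nat.sub_le _ _)
    have e4 := hΘd i0
    have e6 := congrArg (p ^ (k * L) * ·) e4
    have e7 := congrArg ((w + 1) * ·) e2
    have e8 := Nat.mul_le_mul_left (w + 1) e3
    have e9 := congrArg (p ^ (k * i0) * p ^ (k * j) * ·) hdegT
    have e10 : p ^ (k * i0) * p ^ (k * j) * (w * p ^ (k * (L - j)) * F.natDegree + S.natDegree)
      = p ^ (k * i0) * (w * p ^ (k * L) * F.natDegree) + p ^ (k * i0) * (p ^ (k * j) * S.natDegree) := by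
      rw [e5]; ring
    rw [e10] at e9
    linarith
  have hXq0 : p ^ (k * j) * S.natDegree ≤ F.natDegree := by omega
  have h1p : 1 < p ^ (k * N) := Nat.one_lt_pow (by omega) hp.out.one_lt
  have hXq : (X ^ p ^ (k * N) - X : K[X]) ≠ 0 := FiniteField.X_pow_card_sub_X_ne_zero K h1p
  have hge : i0 + m ≤ j := by
    by_contra hcon
    have e1 : (X ^ p ^ (k * N) - X) * (hasseDeriv (p ^ (k * j)) (derivative H) * Θ j ^ p ^ (k * L))
        = C (β j) * derivative H ^ p ^ (k * j) - hasseDeriv (p ^ (k * j)) H * Θ j ^ p ^ (k * L) := by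
      linear_combination hj4
    have e2 := congrArg natDegree e1
    rw [natDegree_mul hXq (mul_ne_zero hj2 (pow_ne_zero _ (hΘ0 _))),
      natDegree_mul hj2 (pow_ne_zero _ (hΘ0 _)), FiniteField.X_pow_card_sub_X_natDegree_eq K h1p,
      natDegree_pow] at e2
    have e3 := natDegree_sub_le (C (β j) * derivative H ^ p ^ (k * j)) (hasseDeriv (p ^ (k * j)) H * Θ j ^ p ^ (k * L))
    rw [← e2] at e3
    have e4 := congrArg (p ^ (k * L) * ·) (hΘd j)
    rcases le_max_iff.1 e3 with e6 | e6
    · have e7 := e6.trans (natDegree_C_mul_le _ _)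
      rw [natDegree_pow, hT, natDegree_pow, ← hT] at e7
      have e8 := Nat.mul_le_mul_left (w + 1) e7
      have e9 := congrArg (p ^ (k * j) * p ^ (k * j) * ·) hdegT
      have e10 : p ^ (k * j) * p ^ (k * j) * (w * p ^ (k * (L - j)) * F.natDegree + S.natDegree)
        = p ^ (k * j) * (w * p ^ (k * L) * F.natDegree) + p ^ (k * j) * (p ^ (k * j) * S.natDegree) := by
        rw [e5]; ring
      rw [e10] at e9
      have e11 : p ^ (k * j) * (p ^ (k * j) * S.natDegree) ≤ (p ^ k) ^ (m - 1) * F.natDegree := by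
        calc p ^ (k * j) * (p ^ (k * j) * S.natDegree)
            = p ^ (k * (j - i0)) * (p ^ (k * i0) * (p ^ (k * j) * S.natDegree)) := by
              rw [← mul_assoc (p ^ (k * (j - i0))), ← pow_add, ← mul_add, Nat.sub_add_cancel hi0.le]
          _ ≤ p ^ (k * (j - i0)) * F.natDegree := Nat.mul_le_mul_left _ hB1
          _ ≤ (p ^ k) ^ (m - 1) * F.natDegree := by
              apply Nat.mul_le_mul_right
              rw [← pow_mul]
              exact Nat.pow_le_pow_right hp.out.pos (Nat.mul_le_mul_left _ (by omega))
      have e12 : (κ + (p ^ k) ^ (m - 1)) * F.natDegree ≤ R * F.natDegree := Nat.mul_le_mul_right _ hκR3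
      linarith
    · have e7 := e6.trans natDegree_mul_le
      rw [natDegree_pow] at e7
      have e8 := (natDegree_hasseDeriv_le H (p ^ (k * j))).trans (Nat.sub_le _ _)
      have e9 : (w + 1) * (p ^ (k * N) + (hasseDeriv (p ^ (k * j)) (derivative H)).natDegree)
          ≤ (w + 1) * H.natDegree := Nat.mul_le_mul_left _ (by omega)
      have e12 : (κ + 1) * F.natDegree ≤ R * F.natDegree := Nat.mul_le_mul_right _ hκR
      linarith
  have hle : j ≤ i0 + m := by
    by_contra hcon
    have e1 := hβ (i0 + m) (by omega)
    rw [hi2 (i0 + m) (by omega) (by omega), mul_zero, eq_comm, neg_eq_zero,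
      Finset.sum_eq_single (m - 1)] at e1
    · rw [show m - 1 + 1 = m by omega, show i0 + m - 1 - (m - 1) = i0 by omega] at e1
      exact mul_ne_zero ham (pow_ne_zero _ hi1) e1
    · intro i hi hne
      rw [Finset.mem_range] at hi
      rcases Nat.lt_or_ge i (m - 1) with hlt | hge'
      · rw [hi2 (i0 + m - 1 - i) (by omega) (by omega), zero_pow (hpp _).ne', mul_zero]
      · rw [ham2 _ (by omega), zero_mul]
    · intro hne
      exact absurd (Finset.mem_range.2 (by omega)) hne
  have hji : j - m = i0 := by omega
  have h2j : 2 * j ≤ N := by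
    have e1 : p ^ (k * (i0 + j)) ≤ F.natDegree := by
      rw [mul_add, pow_add]
      exact (Nat.mul_le_mul_left _ (Nat.le_mul_of_pos_right _ hδ)).trans hB1
    have e2 : R * (p ^ k) ^ (i0 + j) < (w + 1) * (p ^ k) ^ N := by
      rw [← pow_mul, ← pow_mul]
      exact lt_of_le_of_lt (Nat.mul_le_mul_left _ e1) hD
    have := mv_num1 hwQ (by omega) hR e2
    omega
  obtain ⟨b, hb⟩ := mv_pth_root (p := p) (k * j) (β j)
  refine ⟨T, S, b, by omega, h2j, hS1, hT', by rw [hji]; exact hB1, ?_⟩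
  apply mv_div_aux (hpp _)
  set Z := C b * T ^ p ^ (k * j) - X ^ p ^ (k * (N - j)) * (derivative T * Θ j ^ p ^ (k * (L - j))) with hZ
  have eZ : Z ^ p ^ (k * j) = (hasseDeriv (p ^ (k * j)) H - X * hasseDeriv (p ^ (k * j)) (derivative H))
      * Θ j ^ p ^ (k * L) := by
    rw [hZ, sub_pow_expChar_pow, mul_pow, mul_pow, mul_pow, ← C_pow, hb, ← hT, ← eT]
    have e6 : (X ^ p ^ (k * (N - j)) : K[X]) ^ p ^ (k * j) = X ^ p ^ (k * N) := by
      rw [← pow_mul, ← pow_add, ← mul_add, Nat.sub_add_cancel hjN.le]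
    have e7 : (Θ j ^ p ^ (k * (L - j))) ^ p ^ (k * j) = Θ j ^ p ^ (k * L) := by
      rw [← pow_mul, ← pow_add, ← mul_add, Nat.sub_add_cancel (by omega)]
    rw [e6, e7]
    linear_combination (-1 : K[X]) * hj4
  have d1 := congrArg natDegree eZ
  rw [natDegree_pow] at d1
  have d2 : (hasseDeriv (p ^ (k * j)) H - X * hasseDeriv (p ^ (k * j)) (derivative H)).natDegree ≤ H.natDegree := by
    have g1 := (natDegree_hasseDeriv_le H (p ^ (k * j))).trans (Nat.sub_le _ _)
    have g2 := natDegree_hasseDeriv_le (derivative H) (p ^ (k * j))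
    have g3 := natDegree_derivative_le H
    have g4 := natDegree_mul_le (p := (X : K[X])) (q := hasseDeriv (p ^ (k * j)) (derivative H))
    rw [natDegree_X] at g4
    have g5 : H.natDegree ≠ 0 := by
      intro h0
      rw [derivative_of_natDegree_zero h0] at hj2
      simp at hj2
    have g6 := hpp (k * j)
    apply (natDegree_sub_le _ _).trans
    apply max_le g1
    omega
  have d3 : p ^ (k * j) * Z.natDegree ≤ H.natDegree + p ^ (k * L) * (Θ j).natDegree := by
    rw [d1]
    apply natDegree_mul_le.trans
    rw [natDegree_pow]
    omega
  have d4 := Nat.mul_le_mul_left (w + 1) d3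
  have d5 := congrArg (p ^ (k * L) * ·) (hΘd j)
  have d6 : p ^ (k * j) * (p ^ (k * (L - j)) * p ^ (k * j) * (w * F.natDegree))
    = p ^ (k * L) * (w * F.natDegree * p ^ (k * j)) := by rw [e5]; ring
  rw [d6]
  linarith

end MVstage1b


section MVstage2
variable {K : Type*} [Field K] [Finite K] {p : ℕ} [hp : Fact p.Prime] [CharP K p]

set_option maxHeartbeats 1000000 in
theorem mv_stage23 {k w κ N L m R j : ℕ} {F T S Θ : K[X]} {b : K}
    (hk : 0 < k) (hvd : (w + 1) ∣ p ^ k - 1) (hκ : κ + p ^ k + 1 = p ^ k * p ^ k)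
    (hm : 2 ≤ m) (hR : R + 1 = (p ^ k) ^ m) (hD : R * F.natDegree < (w + 1) * p ^ (k * N))
    (hN4 : N < 4 * m) (hNL : 3 * N < L)
    (hF : ¬ ∃ (a : K) (g : K[X]), F = C a * g ^ (w + 1))
    (hΘ0 : Θ ≠ 0)
    (hΘd : (w + 1) * Θ.natDegree + w * F.natDegree = w * F.natDegree * p ^ (k * j))
    (hmj : m ≤ j) (hjN : 2 * j ≤ N) (h : MvTrip F w (p ^ (k * (L - j))) T S) (hT : derivative T ≠ 0)
    (hB1 : p ^ (k * (j - m)) * (p ^ (k * j) * S.natDegree) ≤ F.natDegree)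
    (hZ : (w + 1) * (C b * T ^ p ^ (k * j) -
        X ^ p ^ (k * (N - j)) * (derivative T * Θ ^ p ^ (k * (L - j)))).natDegree
      ≤ p ^ (k * (L - j)) * p ^ (k * j) * (w * F.natDegree) + F.natDegree / p ^ (k * j)) : False := by
  have hwQ := mv_wQ hk hvd
  have hcast : ((w + 1 : ℕ) : K) ≠ 0 := mv_cast hk hvd
  have hcop := mv_cop hk hvd
  have hκR := mv_num2 (by omega) hm hR hκ
  have hpp : ∀ x, 0 < p ^ x := fun x => pow_pos hp.out.pos x
  have hκD : (κ + 1) * F.natDegree < (w + 1) * p ^ (k * N) :=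
    lt_of_le_of_lt (Nat.mul_le_mul_right _ hκR) hD
  have hpadd : ∀ x y z, x + y = z → p ^ (k * x) * p ^ (k * y) = p ^ (k * z) := by
    intro x y z hz; rw [← pow_add, ← mul_add, hz]
  have num1 : ∀ x y, R * p ^ (k * x) < (w + 1) * p ^ (k * y) → x + m ≤ y := by
    intro x y hxy
    rw [pow_mul, pow_mul] at hxy
    exact mv_num1 hwQ (by omega) hR hxy
  have hvR : w + 1 ≤ R := by nlinarith
  set D := F.natDegree with hDdef
  set δ := S.natDegree with hδdef
  set τ := D / p ^ (k * j) with hτ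
  have hτD : p ^ (k * j) * τ ≤ D := Nat.mul_div_le _ _
  have hδD : p ^ (k * j) * δ ≤ D := (Nat.le_mul_of_pos_left _ (hpp _)).trans hB1
  have hqj : p ^ (k * N) = p ^ (k * j) * p ^ (k * (N - j)) := (hpadd _ _ _ (by omega)).symm
  have hq2j : p ^ (k * (N - j)) = p ^ (k * j) * p ^ (k * (N - 2 * j)) := (hpadd _ _ _ (by omega)).symm
  have hcj : p ^ (k * (L - j)) = p ^ (k * j) * p ^ (k * (L - 2 * j)) := (hpadd _ _ _ (by omega)).symm
  have hdegT := h.deg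
  rw [← hDdef, ← hδdef] at hdegT
  -- stage 2
  have c1 : κ * δ + τ < (w + 1) * p ^ (k * (N - j)) := by
    apply Nat.lt_of_mul_lt_mul_left (a := p ^ (k * j))
    calc p ^ (k * j) * (κ * δ + τ) = κ * (p ^ (k * j) * δ) + p ^ (k * j) * τ := by ring
      _ ≤ κ * D + D := Nat.add_le_add (Nat.mul_le_mul_left _ hδD) hτD
      _ = (κ + 1) * D := by ring
      _ < (w + 1) * p ^ (k * N) := hκD
      _ = _ := by rw [hqj]; ring
  obtain ⟨W, S2, hW, hW2, hω⟩ := mv_lemR (i := j) hk hvd hκ (by omega) le_rfl (by omega) (by omega) h hT hΘ0 hΘd hZ c1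
  rw [show L - j - j = L - 2 * j by omega] at hW2
  have hω1 := mv_NT hW2 (Nat.Coprime.pow_left _ hcop) hF
  have hdegW := hW2.deg
  set ω := S2.natDegree with hωdef
  rw [← hDdef] at hdegW
  have hW0 : W ≠ 0 := hW2.1
  obtain ⟨b1, hb1⟩ := mv_pth_root (p := p) (k * j) b
  set Z1 := C b1 * T - X ^ p ^ (k * (N - 2 * j)) * (W * Θ ^ p ^ (k * (L - 2 * j))) with hZ1
  have eZ1 : C b * T ^ p ^ (k * j) -
        X ^ p ^ (k * (N - j)) * (derivative T * Θ ^ p ^ (k * (L - j))) = Z1 ^ p ^ (k * j) := by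
    rw [hZ1, sub_pow_expChar_pow, mul_pow, mul_pow, mul_pow, ← C_pow, hb1, ← hW, ← pow_mul, ← pow_mul,
      mul_comm (p ^ (k * (N - 2 * j))), ← hq2j, mul_comm (p ^ (k * (L - 2 * j))), ← hcj]
  set τ1 := τ / p ^ (k * j) with hτ1
  have hτ1D : p ^ (k * j) * (p ^ (k * j) * τ1) ≤ D :=
    (Nat.mul_le_mul_left _ (Nat.mul_div_le _ _)).trans hτD
  have hZ1d : (w + 1) * Z1.natDegree ≤ p ^ (k * (L - 2 * j)) * p ^ (k * j) * (w * D) + τ1 := by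
    apply mv_div_aux (hpp _)
    rw [eZ1, natDegree_pow] at hZ
    rw [hcj] at hZ
    calc _ = (w + 1) * (p ^ (k * j) * Z1.natDegree) := by ring
      _ ≤ _ := hZ
      _ = _ := by ring
  have hWΘ : (w + 1) * (X ^ p ^ (k * (N - 2 * j)) * (W * Θ ^ p ^ (k * (L - 2 * j)))).natDegree
      = (w + 1) * p ^ (k * (N - 2 * j)) + ω + p ^ (k * (L - 2 * j)) * p ^ (k * j) * (w * D) := by
    rw [natDegree_mul (pow_ne_zero _ X_ne_zero) (mul_ne_zero hW0 (pow_ne_zero _ hΘ0)),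
      natDegree_mul hW0 (pow_ne_zero _ hΘ0), natDegree_pow, natDegree_pow, natDegree_X]
    have := congrArg (p ^ (k * (L - 2 * j)) * ·) hΘd
    linarith
  have hτlt : ¬ ((w + 1) * p ^ (k * (N - 2 * j)) + ω ≤ τ1) := by
    intro hc
    have g1 : (w + 1) * p ^ (k * N) ≤ D := by
      calc (w + 1) * p ^ (k * N) = p ^ (k * j) * (p ^ (k * j) * ((w + 1) * p ^ (k * (N - 2 * j)))) := by
            rw [hqj, hq2j]; ring
        _ ≤ p ^ (k * j) * (p ^ (k * j) * τ1) :=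
            Nat.mul_le_mul_left _ (Nat.mul_le_mul_left _ (by omega))
        _ ≤ D := hτ1D
    have g2 : D ≤ (κ + 1) * D := Nat.le_mul_of_pos_left _ (by omega)
    omega
  have hb10 : b1 ≠ 0 := by
    intro h0
    rw [h0, C_0, zero_mul, zero_sub] at hZ1
    rw [hZ1, natDegree_neg, hWΘ] at hZ1d
    apply hτlt
    linarith
  have hB2' : R * ω < (w + 1) * p ^ (k * (N - 2 * j)) := by
    apply Nat.lt_of_mul_lt_mul_left (a := p ^ (k * (2 * j)))
    have g1 : p ^ (k * (2 * j)) * ω ≤ D := by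
      calc p ^ (k * (2 * j)) * ω = p ^ (k * j) * (p ^ (k * j) * ω) := by
            rw [← hpadd j j (2 * j) (by omega)]; ring
        _ ≤ p ^ (k * j) * δ := Nat.mul_le_mul_left _ (by omega)
        _ ≤ D := hδD
    calc p ^ (k * (2 * j)) * (R * ω) = R * (p ^ (k * (2 * j)) * ω) := by ring
      _ ≤ R * D := Nat.mul_le_mul_left _ g1
      _ < (w + 1) * p ^ (k * N) := hD
      _ = _ := by rw [hqj, hq2j, ← hpadd j j (2 * j) (by omega)]; ring
  have hN2j : m ≤ N - 2 * j := by
    have g1 : R * p ^ (k * 0) ≤ R * ω := Nat.mul_le_mul_left _ (by simpa using hω1)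
    have := num1 0 _ (lt_of_le_of_lt g1 hB2')
    omega
  have hend : ∀ x, p ^ (k * x) ≤ D → 3 * j ≤ x → False := by
    intro x hx hx2
    have := num1 x N (lt_of_le_of_lt (Nat.mul_le_mul_left _ hx) hD)
    omega
  -- stage 3
  have hpk : ∀ x, 0 < x → ((p ^ (k * x) : ℕ) : K[X]) = 0 := by
    intro x hx
    push_cast
    rw [CharP.cast_eq_zero, zero_pow (Nat.mul_pos hk hx).ne']
  have eZ1' : derivative Z1 = C b1 * W ^ p ^ (k * j) -
      X ^ p ^ (k * (N - 2 * j)) * (derivative W * Θ ^ p ^ (k * (L - 2 * j))) := by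
    have g1 : derivative ((X : K[X]) ^ p ^ (k * (N - 2 * j))) = 0 := by
      rw [derivative_pow, C_eq_natCast, hpk _ (by omega), zero_mul, zero_mul]
    have g2 : derivative (Θ ^ p ^ (k * (L - 2 * j))) = 0 := by
      rw [derivative_pow, C_eq_natCast, hpk _ (by omega), zero_mul, zero_mul]
    rw [hZ1, derivative_sub, derivative_C_mul, derivative_mul, derivative_mul, g1, g2, hW]
    ring
  have hZ1'd : (w + 1) * (C b1 * W ^ p ^ (k * j) -
      X ^ p ^ (k * (N - 2 * j)) * (derivative W * Θ ^ p ^ (k * (L - 2 * j)))).natDegree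
      ≤ p ^ (k * (L - 2 * j)) * p ^ (k * j) * (w * D) + τ1 := by
    rw [← eZ1']
    exact (Nat.mul_le_mul_left _ ((natDegree_derivative_le _).trans (Nat.sub_le _ _))).trans hZ1d
  by_cases hW' : derivative W = 0
  · rw [hW', zero_mul, mul_zero, sub_zero, natDegree_C_mul hb10, natDegree_pow] at hZ1'd
    have g1 := congrArg (p ^ (k * j) * ·) hdegW
    have g2 : p ^ (k * j) * ω ≤ τ1 := by linarith
    apply hend (3 * j) _ le_rfl
    calc p ^ (k * (3 * j)) = p ^ (k * j) * (p ^ (k * j) * p ^ (k * j)) := by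
          rw [hpadd j j (2 * j) (by omega), hpadd _ _ _ (by omega : j + 2 * j = 3 * j)]
      _ ≤ p ^ (k * j) * (p ^ (k * j) * (p ^ (k * j) * ω)) :=
          Nat.mul_le_mul_left _ (Nat.mul_le_mul_left _ (Nat.le_mul_of_pos_right _ hω1))
      _ ≤ p ^ (k * j) * (p ^ (k * j) * τ1) := Nat.mul_le_mul_left _ (Nat.mul_le_mul_left _ g2)
      _ ≤ D := hτ1D
  · have hω2 : p ^ (k * j) * (p ^ (k * j) * ω) ≤ D :=
      (Nat.mul_le_mul_left _ (by omega)).trans hδD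
    have c2 : κ * ω + τ1 < (w + 1) * p ^ (k * (N - 2 * j)) := by
      apply Nat.lt_of_mul_lt_mul_left (a := p ^ (k * j) * p ^ (k * j))
      calc p ^ (k * j) * p ^ (k * j) * (κ * ω + τ1)
          = κ * (p ^ (k * j) * (p ^ (k * j) * ω)) + p ^ (k * j) * (p ^ (k * j) * τ1) := by ring
        _ ≤ κ * D + D := Nat.add_le_add (Nat.mul_le_mul_left _ hω2) hτ1D
        _ = (κ + 1) * D := by ring
        _ < (w + 1) * p ^ (k * N) := hκD
        _ = _ := by rw [hqj, hq2j]; ring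
    obtain ⟨Y, S3, hY, hY2, hS3⟩ := mv_lemR (i := min j (N - 2 * j)) hk hvd hκ (by omega) (by omega) (by omega)
      (by omega) hW2 hW' hΘ0 hΘd hZ1'd c2
    have hS31 := mv_NT hY2 (Nat.Coprime.pow_left _ hcop) hF
    have g3 : p ^ (k * min j (N - 2 * j)) ≤ ω := by
      have := Nat.le_mul_of_pos_right (p ^ (k * min j (N - 2 * j))) hS31
      omega
    rcases le_total j (N - 2 * j) with hle | hle
    · rw [min_eq_left hle] at g3
      apply hend (4 * j - m) _ (by omega)
      calc p ^ (k * (4 * j - m)) = p ^ (k * (j - m)) * (p ^ (k * j) * (p ^ (k * j) * p ^ (k * j))) := by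
            rw [hpadd j j (2 * j) (by omega), hpadd _ _ _ (by omega : j + 2 * j = 3 * j),
              hpadd _ _ _ (by omega : j - m + 3 * j = 4 * j - m)]
        _ ≤ p ^ (k * (j - m)) * (p ^ (k * j) * (p ^ (k * j) * ω)) :=
            Nat.mul_le_mul_left _ (Nat.mul_le_mul_left _ (Nat.mul_le_mul_left _ g3))
        _ ≤ p ^ (k * (j - m)) * (p ^ (k * j) * δ) :=
            Nat.mul_le_mul_left _ (Nat.mul_le_mul_left _ (by omega))
        _ ≤ D := hB1
    · rw [min_eq_right hle] at g3
      have g4 := Nat.mul_le_mul hvR g3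
      omega

end MVstage2


section
variable {K : Type*} [Field K] [Finite K] {p : ℕ} [hp : Fact p.Prime] [CharP K p]

noncomputable def mvBeta {K : Type*} [Field K] (Q : ℕ → ℕ) (a : ℕ → K) : ℕ → K
  | 0 => 1
  | (n + 1) => -(a 0)⁻¹ * ∑ i : Fin (n + 1), a (i + 1) * (mvBeta Q a (n - i)) ^ Q (i + 1)
  termination_by n => n
  decreasing_by omega

theorem mv_beta_ex {K : Type*} [Field K] (Q : ℕ → ℕ) (a : ℕ → K) (ha0 : a 0 ≠ 0) :
    ∃ β : ℕ → K, β 0 = 1 ∧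
    ∀ j, 0 < j → a 0 * β j = - ∑ i ∈ Finset.range j, a (i + 1) * β (j - 1 - i) ^ Q (i + 1) := by
  refine ⟨mvBeta Q a, by rw [mvBeta], ?_⟩
  intro j hj
  obtain ⟨n, rfl⟩ : ∃ n, j = n + 1 := ⟨j - 1, by omega⟩
  rw [mvBeta, Fin.sum_univ_eq_sum_range (fun i => a (i + 1) * mvBeta Q a (n - i) ^ Q (i + 1)) (n + 1),
    Nat.add_sub_cancel]
  field_simp

theorem mv_main {k w N m R : ℕ} {a : ℕ → K} {F : K[X]} {s : ℕ → ℕ}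
    (hk : 0 < k) (hvd : (w + 1) ∣ p ^ k - 1)
    (hm : 2 ≤ m) (hR : R + 1 = (p ^ k) ^ m) (hD : R * F.natDegree < (w + 1) * p ^ (k * N))
    (hN : 0 < N) (hN4 : N < 4 * m)
    (hF0 : F ≠ 0) (hF' : derivative F ≠ 0) (ha0 : a 0 ≠ 0) (ham : a m ≠ 0)
    (hs : ∀ i, (w + 1) * s i + 1 = p ^ (k * i))
    (hEQ : C ((w + 1 : ℕ) : K) * ∑ i ∈ Finset.range (m + 1), C (a i) * F ^ (1 + s i)
      + C (a 0) * ((X ^ p ^ (k * N) - X) * derivative F) = 0) :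
    ∃ (a : K) (g : K[X]), F = C a * g ^ (w + 1) := by
  by_contra hF
  have hwQ := mv_wQ hk hvd
  obtain ⟨κ, hκ⟩ : ∃ κ, κ + p ^ k + 1 = p ^ k * p ^ k := by
    have h2 : 2 ≤ p ^ k := by omega
    have : p ^ k + 1 ≤ p ^ k * p ^ k := by nlinarith
    exact ⟨p ^ k * p ^ k - (p ^ k + 1), by omega⟩
  set a' : ℕ → K := fun i => if i ≤ m then a i else 0 with ha'
  have ha'0 : a' 0 = a 0 := by simp [ha']
  have ha'm : a' m = a m := by simp [ha']
  have ha'2 : ∀ i, m < i → a' i = 0 := by intro i hi; simp [ha', hi]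
  obtain ⟨β, hβ0, hβ⟩ := mv_beta_ex (fun i => p ^ (k * i)) a' (by rwa [ha'0])
  set L := 3 * N + 1 with hL
  set u := w * s L + 1 with hu
  have hu1 : (w + 1) * u = w * p ^ (k * L) + 1 := by
    rw [hu, ← hs L]; ring
  have hs0 : s 0 = 0 := by
    have := hs 0; simp at this; simpa using this
  have hsadd : ∀ i j, s (i + j) = s i + p ^ (k * i) * s j := by
    intro i j
    have e1 := hs i
    have e2 := hs j
    have e3 := hs (i + j)
    rw [mul_add, pow_add] at e3
    have : (w + 1) * s (i + j) = (w + 1) * (s i + p ^ (k * i) * s j) := by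
      have : (w + 1) * s (i + j) + 1 = (w + 1) * (s i + p ^ (k * i) * s j) + 1 := by
        rw [e3, mul_add, ← e2]
        calc _ = p ^ (k * i) * ((w + 1) * s j) + p ^ (k * i) := by ring
          _ = p ^ (k * i) * ((w + 1) * s j) + ((w + 1) * s i + 1) := by rw [e1]
          _ = _ := by ring
      omega
    exact Nat.eq_of_mul_eq_mul_left (Nat.succ_pos w) this
  have hcastu : ((u : ℕ) : K) * ((w + 1 : ℕ) : K) = 1 := by
    rw [← Nat.cast_mul, mul_comm, hu1]
    push_cast
    rw [CharP.cast_eq_zero K p, zero_pow (Nat.mul_pos hk (by omega)).ne']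
    simp
  have hu0 : ((u : ℕ) : K) ≠ 0 := left_ne_zero_of_mul_eq_one hcastu
  have hH' : derivative (F ^ u) = C ((u : ℕ) : K) * F ^ (w * s L) * derivative F := by
    rw [derivative_pow, hu, Nat.add_sub_cancel]
  have hH'0 : derivative (F ^ u) ≠ 0 := by
    rw [hH']
    exact mul_ne_zero (mul_ne_zero (C_ne_zero.mpr hu0) (pow_ne_zero _ hF0)) hF'
  have trip : MvTrip F w (p ^ (k * L)) (F ^ u) F := by
    refine ⟨pow_ne_zero _ hF0, hF0, hF0, ?_⟩
    rw [← pow_mul, ← pow_succ, mul_comm u, hu1]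
  have hΘ0 : ∀ i, (fun i => F ^ (w * s i)) i ≠ 0 := fun i => pow_ne_zero _ hF0
  have hΘd : ∀ i, (w + 1) * ((fun i => F ^ (w * s i)) i).natDegree + w * F.natDegree
      = w * F.natDegree * p ^ (k * i) := by
    intro i
    simp only [natDegree_pow]
    rw [← hs i]; ring
  have hEQ2 : ∑ i ∈ Finset.range (m + N + 1), C (a' i) * F ^ (s i + u)
      + C (a' 0) * ((X ^ p ^ (k * N) - X) * derivative (F ^ u)) = 0 := by
    have e1 : ∑ i ∈ Finset.range (m + N + 1), C (a' i) * F ^ (s i + u)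
        = ∑ i ∈ Finset.range (m + 1), C (a i) * F ^ (s i + u) := by
      rw [← Finset.sum_subset (s₁ := Finset.range (m + 1))]
      · apply Finset.sum_congr rfl
        intro i hi
        rw [Finset.mem_range] at hi
        simp [ha', show i ≤ m by omega]
      · intro i hi; simp at hi ⊢; omega
      · intro i _ hi
        simp at hi
        rw [ha'2 i (by omega)]; simp
    have e2 : ∑ i ∈ Finset.range (m + 1), C (a i) * F ^ (s i + u) =
        F ^ (w * s L) * ∑ i ∈ Finset.range (m + 1), C (a i) * F ^ (1 + s i) := by
      rw [Finset.mul_sum]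
      apply Finset.sum_congr rfl
      intro i _
      rw [hu]; ring
    have e3 : C ((u : ℕ) : K) * C ((w + 1 : ℕ) : K) = 1 := by rw [← C_mul, hcastu, C_1]
    rw [e1, e2, ha'0, hH']
    have e4 := congrArg (fun z => C ((u : ℕ) : K) * F ^ (w * s L) * z) hEQ
    simp only [mul_zero] at e4
    rw [← e4]
    linear_combination (- F ^ (w * s L) * ∑ i ∈ Finset.range (m + 1), C (a i) * F ^ (1 + s i)) * e3
  obtain ⟨j, hj0, hjN, hj1, hj2, hj3, hj4⟩ := mv_stage1a (J := fun i => F ^ (s i + u))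
    (Θ := fun i => F ^ (w * s i)) (a := a') (β := β) (B := m + N) hk hvd hκ hm hR hD hN
    (show N < L by omega) (by omega) hF trip hH'0 (by rwa [ha'0]) (by simp [hs0]) (by simp [hs0]) hΘ0
    (by intro i j; rw [hsadd]; ring)
    (by
      intro i
      rw [← pow_mul, ← pow_mul, ← pow_add]
      congr 1
      have e1 : w * p ^ (k * L) + 1 = (w + 1) * u := hu1.symm
      calc s i + u + w * s i * p ^ (k * L) = s i * (w * p ^ (k * L) + 1) + u := by ring
        _ = s i * ((w + 1) * u) + u := by rw [e1]
        _ = u * ((w + 1) * s i + 1) := by ring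
        _ = _ := by rw [hs])
    hEQ2 hβ0 hβ
  obtain ⟨T, S, b, hmj, h2j, hT, hT', hB1, hZ⟩ := mv_stage1b (a := a') (β := β)
    (Θ := fun i => F ^ (w * s i)) hk hvd hκ hm hR hD
    (show N < L by omega) hF trip (by rwa [ha'm]) ha'2 hΘ0 hΘd hβ0 hβ hj0 hjN hj1 hj2 hj3 hj4
  exact mv_stage23 hk hvd hκ hm hR hD hN4 (show 3 * N < L by omega) hF (hΘ0 j) (hΘd j) hmj h2j
    hT hT' hB1 hZ
end


section MVlin
variable {K : Type*} [Field K] [Fintype K] [DecidableEq K] {p : ℕ} [hp : Fact p.Prime] [CharP K p]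

theorem mv_fixcard {k n : ℕ} (hk : 0 < k) (hkn : k ∣ n) (hcard : Fintype.card K = p ^ n) :
    p ^ k ≤ Nat.card ((iterateFrobenius K p k).eqLocusField (RingHom.id K)) := by
  obtain ⟨N, rfl⟩ := hkn
  obtain ⟨g, hg⟩ := IsCyclic.exists_generator (α := Kˣ)
  have hog : orderOf g = p ^ (k * N) - 1 := by
    rw [orderOf_eq_card_of_forall_mem_zpowers hg, Nat.card_eq_fintype_card, Fintype.card_units, hcard]
  have hdvd : p ^ k - 1 ∣ p ^ (k * N) - 1 := by
    rw [pow_mul]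
    simpa using Nat.sub_dvd_pow_sub_pow (p ^ k) 1 N
  obtain ⟨c, hc⟩ := hdvd
  have hpos : 0 < orderOf g := orderOf_pos g
  have hQ : 1 < p ^ k := Nat.one_lt_pow hk.ne' hp.out.one_lt
  have hoh : orderOf (g ^ c) = p ^ k - 1 := by
    rw [orderOf_pow, hog, hc, Nat.gcd_eq_right (Dvd.intro_left _ rfl)]
    apply Nat.mul_div_cancel
    rcases Nat.eq_zero_or_pos c with h | h
    · rw [h, mul_zero] at hc; omega
    · exact h
  set h := g ^ c
  have hpw : (h : Kˣ) ^ (p ^ k - 1) = 1 := by rw [← hoh]; exact pow_orderOf_eq_one h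
  let S := (iterateFrobenius K p k).eqLocusField (RingHom.id K)
  have hmem : ∀ x : K, x ∈ S ↔ x ^ p ^ k = x := fun x => Iff.rfl
  let φ : Option (Fin (p ^ k - 1)) → S := fun o => match o with
    | none => 0
    | some i => ⟨((h ^ (i : ℕ) : Kˣ) : K), by
        rw [hmem, ← Units.val_pow_eq_pow_val, ← pow_mul, mul_comm, pow_mul]
        congr 2
        obtain ⟨r, hr⟩ : ∃ r, p ^ k = r + 1 := ⟨p ^ k - 1, by omega⟩
        rw [hr, pow_succ]
        rw [hr, Nat.add_sub_cancel] at hpw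
        rw [hpw, one_mul]⟩
  have hφ : Function.Injective φ := by
    rintro (_ | i) (_ | j) hij
    · rfl
    · exfalso
      have := congrArg Subtype.val hij
      exact (h ^ (j : ℕ)).ne_zero this.symm
    · exfalso
      have := congrArg Subtype.val hij
      exact (h ^ (i : ℕ)).ne_zero this
    · have := congrArg Subtype.val hij
      have h2 : h ^ (i : ℕ) = h ^ (j : ℕ) := Units.ext this
      have := pow_injOn_Iio_orderOf (x := h) (by simp [hoh]) (by simp [hoh]) h2
      rw [Fin.ext this]
  have := Nat.card_le_card_of_injective φ hφ
  have e : Nat.card (Option (Fin (p ^ k - 1))) = p ^ k - 1 + 1 := by simp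
  rw [e] at this
  change p ^ k ≤ Nat.card S
  omega

theorem mv_lin_zero {k m : ℕ} (hk : 0 < k) {U : Finset K} (hU : p ^ (k * m) ≤ U.card) {b : ℕ → K}
    (hb : ∀ u ∈ U, ∑ i ∈ Finset.range m, b i * u ^ p ^ (k * i) = 0) : ∀ i < m, b i = 0 := by
  intro i hi
  have hQ : 1 < p := hp.out.one_lt
  have h0 : (∑ i ∈ Finset.range m, C (b i) * X ^ p ^ (k * i) : K[X]) = 0 := by
    apply eq_zero_of_natDegree_lt_card_of_eval_eq_zero' _ U
    · intro u hu
      simp only [eval_finsetSum, eval_mul, eval_C, eval_pow, eval_X]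
      exact hb u hu
    · refine lt_of_lt_of_le (?_ : _ < p ^ (k * m)) hU
      apply lt_of_le_of_lt (natDegree_sum_le_of_forall_le (n := p ^ (k * (m - 1))) _ _ ?_)
      · apply Nat.pow_lt_pow_right hQ
        exact Nat.mul_lt_mul_of_pos_left (by omega) hk
      · intro j hj
        rw [Finset.mem_range] at hj
        refine (natDegree_C_mul_X_pow_le _ _).trans ?_
        exact Nat.pow_le_pow_right hp.out.pos (Nat.mul_le_mul_left _ (by omega))
  have h1 := congrArg (fun f => coeff f (p ^ (k * i))) h0
  simp only [finsetSum_coeff, coeff_C_mul, coeff_X_pow, coeff_zero] at h1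
  rw [Finset.sum_eq_single i] at h1
  · simpa using h1
  · intro j _ hji
    rw [if_neg, mul_zero]
    intro h
    have := Nat.pow_right_injective hQ h
    exact hji (Nat.eq_of_mul_eq_mul_left hk this).symm
  · intro h; simp at h; omega

theorem mv_lin {k n m : ℕ} (hk : 0 < k) (hkn : k ∣ n) (hcard : Fintype.card K = p ^ n)
    {U : Finset K} (h0 : (0 : K) ∈ U) (hadd : ∀ x ∈ U, ∀ y ∈ U, x + y ∈ U)
    (hsm : ∀ c : K, c ^ p ^ k = c → ∀ x ∈ U, c * x ∈ U) (hUc : U.card = p ^ (k * m)) :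
    ∃ a : ℕ → K, a 0 ≠ 0 ∧ a m ≠ 0 ∧
      ∀ u ∈ U, ∑ i ∈ Finset.range (m + 1), a i * u ^ p ^ (k * i) = 0 := by
  have hQ : 1 < p ^ k := Nat.one_lt_pow hk.ne' hp.out.one_lt
  let S := (iterateFrobenius K p k).eqLocusField (RingHom.id K)
  have hmem : ∀ x : K, x ∈ S ↔ x ^ p ^ k = x := fun x => Iff.rfl
  have hmemi : ∀ (c : S) (i : ℕ), (c : K) ^ p ^ (k * i) = c := by
    intro c i
    induction i with
    | zero => simp
    | succ i ih => rw [mul_add, pow_add, pow_mul, ih, mul_one]; exact (hmem c).1 c.2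
  let V : Submodule S K :=
    { carrier := (U : Set K)
      add_mem' := fun {x y} hx hy => hadd x hx y hy
      zero_mem' := h0
      smul_mem' := fun c x hx => hsm c ((hmem c).1 c.2) x hx }
  have hd : Module.finrank S V ≤ m := by
    haveI : Fintype S := Fintype.ofFinite _
    haveI : Fintype V := Fintype.ofFinite _
    have e1 := Module.card_eq_pow_finrank (K := S) (V := V)
    have e2 : Nat.card V = U.card := by
      change Nat.card (U : Set K) = _
      simp
    have e3 : p ^ k ≤ Nat.card S := mv_fixcard hk hkn hcard
    rw [Nat.card_eq_fintype_card] at e2 e3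
    rw [← Nat.pow_le_pow_iff_right hQ, ← pow_mul p k m, ← hUc, ← e2, e1]
    exact Nat.pow_le_pow_left e3 _
  let B := Module.finBasis S V
  let φ : (Fin (m + 1) → K) →ₗ[K] (Fin (Module.finrank S V) → K) :=
    LinearMap.pi fun j => ∑ i : Fin (m + 1), ((B j : K) ^ p ^ (k * (i : ℕ))) • LinearMap.proj i
  have hker : LinearMap.ker φ ≠ ⊥ := by
    apply LinearMap.ker_ne_bot_of_finrank_lt
    simp
    omega
  obtain ⟨a, ha, ha0⟩ := (Submodule.ne_bot_iff _).1 hker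
  rw [LinearMap.mem_ker] at ha
  let W : Submodule S K :=
    { carrier := {u | ∑ i : Fin (m + 1), a i * u ^ p ^ (k * (i : ℕ)) = 0}
      add_mem' := by
        intro x y hx hy
        simp only [Set.mem_ofPred_eq] at *
        simp only [add_pow_char_pow, mul_add, Finset.sum_add_distrib]
        rw [hx, hy, add_zero]
      zero_mem' := by
        simp [hp.out.ne_zero]
      smul_mem' := by
        intro c x hx
        simp only [Set.mem_ofPred_eq] at *
        have : c • x = (c : K) * x := rfl
        simp only [this, mul_pow, hmemi]
        rw [← mul_zero (c : K), ← hx, Finset.mul_sum]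
        exact Finset.sum_congr rfl fun i _ => by ring }
  have hVW : ∀ u ∈ U, ∑ i : Fin (m + 1), a i * u ^ p ^ (k * (i : ℕ)) = 0 := by
    intro u hu
    have hb : ∀ j, (B j : K) ∈ W := by
      intro j
      have := congrFun ha j
      simp only [φ, LinearMap.pi_apply, LinearMap.sum_apply, LinearMap.smul_apply, LinearMap.proj_apply,
        smul_eq_mul, Pi.zero_apply] at this
      change ∑ i : Fin (m + 1), a i * (B j : K) ^ p ^ (k * (i : ℕ)) = 0
      rw [← this]
      exact Finset.sum_congr rfl fun i _ => by ring
    have e := B.sum_repr ⟨u, hu⟩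
    have e' := congrArg Subtype.val e
    have : u ∈ W := by
      change (_ : K) = u at e'
      rw [← e', AddSubmonoidClass.coe_finsetSum]
      apply Submodule.sum_mem
      intro j _
      exact W.smul_mem _ (hb j)
    exact this
  let a' : ℕ → K := fun i => if h : i < m + 1 then a ⟨i, h⟩ else 0
  have ha' : ∀ i : Fin (m + 1), a' i = a i := fun i => by simp only [a', i.2, dif_pos]
  have hsum : ∀ u ∈ U, ∑ i ∈ Finset.range (m + 1), a' i * u ^ p ^ (k * i) = 0 := by
    intro u hu
    rw [← hVW u hu, ← Fin.sum_univ_eq_sum_range (fun i => a' i * u ^ p ^ (k * i))]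
    exact Finset.sum_congr rfl fun i _ => by rw [ha']
  have hne : ∃ i ≤ m, a' i ≠ 0 := by
    by_contra hcon
    push Not at hcon
    apply ha0
    funext i
    rw [← ha' i]
    exact hcon i (by omega)
  refine ⟨a', ?_, ?_, hsum⟩
  · intro h
    choose b hb using fun i => mv_pth_root (p := p) k (a' (i + 1))
    have hz := mv_lin_zero (m := m) hk hUc.ge (b := b) (by
      intro u hu
      have := hsum u hu
      rw [Finset.sum_range_succ', h, zero_mul, add_zero] at this
      have h2 : (∑ i ∈ Finset.range m, b i * u ^ p ^ (k * i)) ^ p ^ k = 0 := by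
        rw [sum_pow_char_pow, ← this]
        apply Finset.sum_congr rfl
        intro i _
        rw [mul_pow, hb, ← pow_mul, ← pow_add]
        rfl
      exact eq_zero_of_pow_eq_zero h2)
    obtain ⟨i, hi, hne⟩ := hne
    rcases Nat.eq_zero_or_pos i with h' | h'
    · subst h'; exact hne h
    · obtain ⟨i, rfl⟩ : ∃ j, i = j + 1 := ⟨i - 1, by omega⟩
      apply hne
      rw [← hb, hz i (by omega), zero_pow (by positivity)]
  · intro h
    have hz := mv_lin_zero (m := m) hk hUc.ge (b := a') (by
      intro u hu
      have := hsum u hu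
      rwa [Finset.sum_range_succ, h, zero_mul, add_zero] at this)
    obtain ⟨i, hi, hne⟩ := hne
    rcases Nat.lt_or_ge i m with h' | h'
    · exact hne (hz i h')
    · have : i = m := by omega
      subst this; exact hne h

end MVlin


section MVeq
variable {K : Type*} [Field K] [Fintype K] [DecidableEq K] {p : ℕ} [hp : Fact p.Prime] [CharP K p]

theorem mv_s_lt {k w : ℕ} {s : ℕ → ℕ} (hk : 0 < k) (hp1 : 1 < p)
    (hs : ∀ i, (w + 1) * s i + 1 = p ^ (k * i)) {i j : ℕ} (hij : i < j) : s i < s j := by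
  have h : p ^ (k * i) < p ^ (k * j) :=
    Nat.pow_lt_pow_right hp1 (Nat.mul_lt_mul_of_pos_left hij hk)
  rw [← hs i, ← hs j] at h
  by_contra hc
  push Not at hc
  have := Nat.mul_le_mul_left (w + 1) hc
  omega

theorem mv_T_deg {k w m : ℕ} {s : ℕ → ℕ} (hk : 0 < k)
    (hs : ∀ i, (w + 1) * s i + 1 = p ^ (k * i)) (a : ℕ → K) (ham : a m ≠ 0) (F : K[X])
    (hF : 0 < F.natDegree) :
    (∑ i ∈ Finset.range (m + 1), C (a i) * F ^ (1 + s i)).natDegree = (1 + s m) * F.natDegree := by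
  rw [Finset.sum_range_succ]
  have h1 : (C (a m) * F ^ (1 + s m)).natDegree = (1 + s m) * F.natDegree := by
    rw [natDegree_C_mul ham, natDegree_pow]
  rw [natDegree_add_eq_right_of_natDegree_lt, h1]
  rw [h1]
  rcases Nat.eq_zero_or_pos m with h0 | h0
  · subst h0; simp; omega
  apply lt_of_le_of_lt (natDegree_sum_le_of_forall_le (n := (s m) * F.natDegree) _ _ ?_)
  · rw [add_mul]; omega
  · intro i hi
    rw [Finset.mem_range] at hi
    refine (natDegree_C_mul_le _ _).trans ?_
    rw [natDegree_pow]
    apply Nat.mul_le_mul_right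
    have := mv_s_lt hk hp.out.one_lt hs hi
    omega

theorem mv_T_eval {k w m : ℕ} {s : ℕ → ℕ}
    (hs : ∀ i, (w + 1) * s i + 1 = p ^ (k * i)) (a : ℕ → K) (u : K)
    (h : ∑ i ∈ Finset.range (m + 1), a i * u ^ p ^ (k * i) = 0) :
    ∑ i ∈ Finset.range (m + 1), a i * (u ^ (w + 1)) ^ (1 + s i) = 0 := by
  rw [← mul_zero (u ^ w), ← h, Finset.mul_sum]
  apply Finset.sum_congr rfl
  intro i _
  rw [← hs i]; ring

theorem mv_card {k w m : ℕ} {s : ℕ → ℕ} (hk : 0 < k)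
    (hs : ∀ i, (w + 1) * s i + 1 = p ^ (k * i)) {a : ℕ → K} (ham : a m ≠ 0) {U : Finset K}
    (h0 : (0 : K) ∈ U) (hUc : U.card = p ^ (k * m))
    (hu : ∀ u ∈ U, ∑ i ∈ Finset.range (m + 1), a i * u ^ p ^ (k * i) = 0) :
    (U.image (fun u => u ^ (w + 1))).card = s m + 1 := by
  apply le_antisymm
  · have hd := mv_T_deg hk hs a ham X (by simp)
    by_contra hcon
    push Not at hcon
    have hz : (∑ i ∈ Finset.range (m + 1), C (a i) * X ^ (1 + s i) : K[X]) = 0 := by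
      apply eq_zero_of_natDegree_lt_card_of_eval_eq_zero' _ (U.image (fun u => u ^ (w + 1)))
      · intro y hy
        obtain ⟨u, huU, rfl⟩ := Finset.mem_image.1 hy
        simp only [eval_finsetSum, eval_mul, eval_C, eval_pow, eval_X]
        exact mv_T_eval hs a u (hu u huU)
      · rw [hd, natDegree_X]; omega
    rw [hz] at hd
    simp at hd
    omega
  · have e1 : (U.image (fun u => u ^ (w + 1))) = insert 0 ((U.erase 0).image (fun u => u ^ (w + 1))) := by
      conv_lhs => rw [← Finset.insert_erase h0]
      rw [Finset.image_insert]; simp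
    rw [e1, Finset.card_insert_of_notMem]
    · have e2 : (U.erase 0).card ≤ (w + 1) * ((U.erase 0).image (fun u => u ^ (w + 1))).card := by
        apply Finset.card_le_mul_card_image
        intro y _
        have : ((U.erase 0).filter (fun x => x ^ (w + 1) = y)) ⊆ (nthRoots (w + 1) y).toFinset := by
          intro x hx
          rw [Finset.mem_filter] at hx
          rw [Multiset.mem_toFinset, mem_nthRoots (Nat.succ_pos w)]
          exact hx.2
        exact (Finset.card_le_card this).trans ((Multiset.toFinset_card_le _).trans (card_nthRoots _ _))
      rw [Finset.card_erase_of_mem h0, hUc, ← hs m, Nat.add_sub_cancel] at e2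
      have := Nat.le_of_mul_le_mul_left e2 (Nat.succ_pos w)
      omega
    · intro h
      obtain ⟨u, hu, h'⟩ := Finset.mem_image.1 h
      exact (Finset.mem_erase.1 hu).1 (eq_zero_of_pow_eq_zero h')

theorem mv_EQ {k w m N : ℕ} {s : ℕ → ℕ} (hk : 0 < k) (hvd : (w + 1) ∣ p ^ k - 1) (hN : 0 < N)
    (hcard : Fintype.card K = p ^ (k * N))
    (hs : ∀ i, (w + 1) * s i + 1 = p ^ (k * i)) {a : ℕ → K} (ham : a m ≠ 0)
    {F : K[X]} (hF : 0 < F.natDegree) (hD : s m * F.natDegree ≤ p ^ (k * N) - 1) (h2 : 2 ≤ s m)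
    (hu : ∀ x, ∃ u, F.eval x = u ^ (w + 1) ∧ ∑ i ∈ Finset.range (m + 1), a i * u ^ p ^ (k * i) = 0) :
    derivative F ≠ 0 ∧ C ((w + 1 : ℕ) : K) * ∑ i ∈ Finset.range (m + 1), C (a i) * F ^ (1 + s i)
      + C (a 0) * ((X ^ p ^ (k * N) - X) * derivative F) = 0 := by
  have hF0 : F ≠ 0 := by rintro rfl; simp at hF
  have hcast : ((w + 1 : ℕ) : K) ≠ 0 := mv_cast hk hvd
  set P := ∑ i ∈ Finset.range (m + 1), C (a i) * F ^ (1 + s i) with hP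
  have hPd := mv_T_deg hk hs a ham F hF
  rw [← hP] at hPd
  have hkN : 0 < k * N := Nat.mul_pos hk hN
  set q := p ^ (k * N) with hq
  have hq1 : 1 < q := Nat.one_lt_pow hkN.ne' hp.out.one_lt
  have hM : Monic (X ^ q - X : K[X]) := by
    apply monic_X_pow_sub
    rw [degree_X]; exact_mod_cast hq1
  have hMd : (X ^ q - X : K[X]).natDegree = q := FiniteField.X_pow_card_sub_X_natDegree_eq K hq1
  have hPe : ∀ x, P.eval x = 0 := by
    intro x
    obtain ⟨u, e1, e2⟩ := hu x
    rw [hP]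
    simp only [eval_finsetSum, eval_mul, eval_C, eval_pow, e1]
    exact mv_T_eval hs a u e2
  have hdv : (X ^ q - X : K[X]) ∣ P := by
    rw [← modByMonic_eq_zero_iff_dvd hM]
    apply eq_zero_of_natDegree_lt_card_of_eval_eq_zero' _ Finset.univ
    · intro x _
      have := congrArg (eval x) (modByMonic_add_div P (X ^ q - X : K[X]))
      rw [eval_add, eval_mul, hPe] at this
      have hx : x ^ q = x := by rw [← hcard]; exact FiniteField.pow_card x
      simpa [hx] using this
    · rw [Finset.card_univ, hcard]
      have := natDegree_modByMonic_lt P hM (by intro h; rw [h] at hMd; simp at hMd; omega)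
      rwa [hMd] at this
  obtain ⟨W, hW⟩ := hdv
  have hP0 : P ≠ 0 := by
    intro h; rw [h, natDegree_zero] at hPd
    have : 0 < (1 + s m) * F.natDegree := by positivity
    omega
  have hW0 : W ≠ 0 := by rintro rfl; exact hP0 (by rw [hW, mul_zero])
  have hWd : W.natDegree < F.natDegree := by
    have : P.natDegree = q + W.natDegree := by
      rw [hW, hM.natDegree_mul' hW0, hMd]
    rw [hPd, add_mul] at this
    omega
  have hpk : ∀ i, 0 < i → ((p ^ (k * i) : ℕ) : K) = 0 := by
    intro x hx
    push_cast
    rw [CharP.cast_eq_zero, zero_pow (Nat.mul_pos hk hx).ne']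
  have hs0 : s 0 = 0 := by
    have := hs 0; simp at this; simpa using this
  have hsc : ∀ i, 0 < i → ((w + 1 : ℕ) : K) * ((1 + s i : ℕ) : K) = (w : K) := by
    intro i hi
    have := congrArg (Nat.cast (R := K)) (hs i)
    rw [hpk i hi] at this
    push_cast at this ⊢
    linear_combination this
  have hd1 : C ((w + 1 : ℕ) : K) * (F * derivative P) = (C (w : K) * P + C (a 0) * F) * derivative F := by
    rw [hP, derivative_sum, Finset.sum_range_succ', Finset.sum_range_succ' (fun i => C (a i) * F ^ (1 + s i))]
    rw [hs0]
    have : ∑ i ∈ Finset.range m, C ((w + 1 : ℕ) : K) * (F * derivative (C (a (i + 1)) * F ^ (1 + s (i + 1))))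
      = ∑ i ∈ Finset.range m, C (w : K) * (C (a (i + 1)) * F ^ (1 + s (i + 1))) * derivative F := by
      apply Finset.sum_congr rfl
      intro i _
      have e := hsc (i + 1) (by omega)
      rw [← e, derivative_C_mul, derivative_pow, Nat.add_sub_cancel_left, C_mul, pow_add, pow_one]
      ring
    rw [mul_add, mul_add, Finset.mul_sum, Finset.mul_sum, this, ← Finset.sum_mul, ← Finset.mul_sum]
    simp only [add_zero, pow_one, derivative_C_mul]
    push_cast
    rw [C_add, C_1]
    ring
  have hd2 : derivative P = (X ^ q - X) * derivative W - W := by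
    rw [hW, derivative_mul, derivative_sub, derivative_pow, derivative_X, hpk N hN]
    simp; ring
  have key : P * (C ((w + 1 : ℕ) : K) * F * derivative W - C (w : K) * W * derivative F)
      = F * W * (C ((w + 1 : ℕ) : K) * W + C (a 0) * derivative F) := by
    rw [hd2] at hd1
    rw [hW] at hd1 ⊢
    linear_combination W * hd1
  have hz : F * W * (C ((w + 1 : ℕ) : K) * W + C (a 0) * derivative F) = 0 := by
    by_contra hne
    have hne' := hne
    rw [← key] at hne'
    have h3 := congrArg natDegree key
    rw [natDegree_mul hP0 (right_ne_zero_of_mul hne'), hPd,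
      natDegree_mul (left_ne_zero_of_mul hne) (right_ne_zero_of_mul hne), natDegree_mul hF0 hW0] at h3
    have h4 : (C ((w + 1 : ℕ) : K) * W + C (a 0) * derivative F).natDegree ≤ F.natDegree - 1 := by
      apply (natDegree_add_le _ _).trans
      apply max_le
      · have := natDegree_C_mul_le ((w + 1 : ℕ) : K) W
        omega
      · have := natDegree_C_mul_le (a 0) (derivative F)
        have := natDegree_derivative_le F
        omega
    have h5 : 3 * F.natDegree ≤ (1 + s m) * F.natDegree := Nat.mul_le_mul_right _ (by omega)
    omega
  have hz2 : C ((w + 1 : ℕ) : K) * W + C (a 0) * derivative F = 0 := by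
    rcases mul_eq_zero.1 hz with h | h
    · exact absurd h (mul_ne_zero hF0 hW0)
    · exact h
  constructor
  · intro h
    rw [h, mul_zero, add_zero] at hz2
    exact mul_ne_zero (C_ne_zero.2 hcast) hW0 hz2
  · rw [hW]
    linear_combination (X ^ q - X) * hz2

end MVeq


section MVfinal
variable {K : Type*} [Field K] [Fintype K] [DecidableEq K] {p : ℕ} [hp : Fact p.Prime] [CharP K p]

theorem mv_lower (f : K[X]) (hf : 0 < f.natDegree) :
    (Fintype.card K - 1) / f.natDegree + 1 ≤ (valueSet f).card := by
  have h : (Finset.univ : Finset K).card ≤ f.natDegree * (valueSet f).card := by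
    apply Finset.card_le_mul_card_image
    intro y _
    have hne : f - C y ≠ 0 := by
      intro h
      rw [sub_eq_zero] at h
      rw [h] at hf; simp at hf
    have hsub : (Finset.univ.filter (fun x => f.eval x = y)) ⊆ (f - C y).roots.toFinset := by
      intro x hx
      rw [Finset.mem_filter] at hx
      rw [Multiset.mem_toFinset, mem_roots hne]
      simp [hx.2]
    refine (Finset.card_le_card hsub).trans ((Multiset.toFinset_card_le _).trans ((card_roots' _).trans ?_))
    rw [natDegree_sub_C]
  rw [Finset.card_univ] at h
  have h0 : 0 < Fintype.card K := Fintype.card_pos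
  apply Nat.succ_le_of_lt
  apply Nat.div_lt_of_lt_mul
  omega

theorem mv_core {k w m N : ℕ} {s : ℕ → ℕ} (hk : 0 < k) (hvd : (w + 1) ∣ p ^ k - 1) (hN : 0 < N)
    (hm : 2 ≤ m) (hN4 : N < 4 * m) (hcard : Fintype.card K = p ^ (k * N))
    (hs : ∀ i, (w + 1) * s i + 1 = p ^ (k * i)) {U : Finset K}
    (h0 : (0 : K) ∈ U) (hadd : ∀ x ∈ U, ∀ y ∈ U, x + y ∈ U)
    (hsm : ∀ c : K, c ^ p ^ k = c → ∀ x ∈ U, c * x ∈ U) (hUc : U.card = p ^ (k * m))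
    (hUv : 2 < (U.image (fun u => u ^ (w + 1))).card) :
    (U.image (fun u => u ^ (w + 1))).card = s m + 1 ∧
    MVSPset (U.image (fun u => u ^ (w + 1))) = {g | ∃ f ∈ MVSPset U, g = f ^ (w + 1)} := by
  obtain ⟨a, ha0, ham, hau⟩ := mv_lin (m := m) hk (Dvd.intro N rfl) hcard h0 hadd hsm hUc
  have hc := mv_card hk hs ham h0 hUc hau
  refine ⟨hc, ?_⟩
  have hq0 : 0 < p ^ (k * N) := pow_pos hp.out.pos _
  have hQ : 1 < p ^ k := Nat.one_lt_pow hk.ne' hp.out.one_lt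
  have hcu : U.card = (w + 1) * s m + 1 := by rw [hUc, hs]
  have hr : 2 ≤ s m := by omega
  ext F
  constructor
  · rintro ⟨⟨hF, hFc⟩, hFV⟩
    rw [hFV, hc, hcard] at hFc
    have hr1 : s m * F.natDegree ≤ p ^ (k * N) - 1 := by
      have : s m = (p ^ (k * N) - 1) / F.natDegree := by omega
      rw [this]; exact Nat.div_mul_le_self _ _
    have hval : ∀ x, ∃ u ∈ U, F.eval x = u ^ (w + 1) := by
      intro x
      have : F.eval x ∈ valueSet F := Finset.mem_image_of_mem _ (Finset.mem_univ x)
      rw [hFV] at this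
      obtain ⟨u, hu, e⟩ := Finset.mem_image.1 this
      exact ⟨u, hu, e.symm⟩
    obtain ⟨hF', hEQ⟩ := mv_EQ hk hvd hN hcard hs ham hF hr1 hr (by
      intro x
      obtain ⟨u, hu, e⟩ := hval x
      exact ⟨u, e, hau u hu⟩)
    have hF0 : F ≠ 0 := by rintro rfl; simp at hF
    obtain ⟨c, g, hg⟩ := mv_main (R := (w + 1) * s m) hk hvd hm (by rw [hs, pow_mul]) (by
      rw [mul_assoc]
      apply Nat.mul_lt_mul_of_pos_left _ (Nat.succ_pos w)
      omega) hN hN4 hF0 hF' ha0 ham hs hEQ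
    obtain ⟨α, hα⟩ : ∃ α, F.eval α ≠ 0 := by
      by_contra hcon
      push Not at hcon
      have : valueSet F ⊆ {0} := by
        intro y hy
        obtain ⟨x, _, e⟩ := Finset.mem_image.1 hy
        rw [Finset.mem_singleton, ← e]; exact hcon x
      have := Finset.card_le_card this
      rw [hFV, Finset.card_singleton] at this
      omega
    obtain ⟨b, hb⟩ : ∃ b, c = b ^ (w + 1) := by
      obtain ⟨u, _, e⟩ := hval α
      rw [hg] at e hα
      simp only [eval_mul, eval_C, eval_pow] at e hα
      have hgα : g.eval α ≠ 0 := by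
        intro h; rw [h] at hα; simp at hα
      refine ⟨u / g.eval α, ?_⟩
      rw [div_pow, ← e]
      field_simp
    have hFf : F = (C b * g) ^ (w + 1) := by rw [hg, hb, mul_pow, C_pow]
    set f := C b * g with hf
    have hFd : F.natDegree = (w + 1) * f.natDegree := by rw [hFf, natDegree_pow]
    have hfd : 0 < f.natDegree := by
      rcases Nat.eq_zero_or_pos f.natDegree with h | h
      · rw [h] at hFd; omega
      · exact h
    have hsub : valueSet f ⊆ U := by
      intro y hy
      obtain ⟨x, _, e⟩ := Finset.mem_image.1 hy
      obtain ⟨u, hu, e2⟩ := hval x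
      rw [hFf, eval_pow] at e2
      rw [e] at e2
      by_cases hu0 : u = 0
      · rw [hu0, zero_pow (Nat.succ_ne_zero w)] at e2
        rw [eq_zero_of_pow_eq_zero e2]; exact h0
      · have hz : (y / u) ^ (w + 1) = 1 := by
          rw [div_pow, e2, div_self (pow_ne_zero _ hu0)]
        have hz2 : (y / u) ^ p ^ k = y / u := by
          obtain ⟨t, ht⟩ := hvd
          have : p ^ k = (w + 1) * t + 1 := by omega
          rw [this, pow_succ, pow_mul, hz, one_pow, one_mul]
        have := hsm _ hz2 u hu
        rwa [div_mul_cancel₀ _ hu0] at this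
    have hlow := mv_lower f hfd
    have hge : (w + 1) * s m ≤ (Fintype.card K - 1) / f.natDegree := by
      rw [Nat.le_div_iff_mul_le hfd, hcard]
      rw [hFd] at hr1
      calc _ = s m * ((w + 1) * f.natDegree) := by ring
        _ ≤ _ := hr1
    have hle := Finset.card_le_card hsub
    refine ⟨f, ⟨⟨hfd, ?_⟩, ?_⟩, hFf⟩
    · omega
    · apply Finset.eq_of_subset_of_card_le hsub
      omega
  · rintro ⟨f, ⟨⟨hf, hfc⟩, hfV⟩, rfl⟩
    have hV : valueSet (f ^ (w + 1)) = U.image (fun u => u ^ (w + 1)) := by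
      rw [← hfV]
      unfold valueSet
      rw [Finset.image_image]
      congr 1
      funext x
      simp
    refine ⟨⟨?_, ?_⟩, hV⟩
    · rw [natDegree_pow]; positivity
    · rw [hV, hc, natDegree_pow, mul_comm (w + 1), ← Nat.div_div_eq_div_mul]
      rw [hfV, hcu] at hfc
      have : (Fintype.card K - 1) / f.natDegree = (w + 1) * s m := by omega
      rw [this, Nat.mul_div_cancel_left _ (Nat.succ_pos w)]

theorem mv_e {k w m e : ℕ} {r : ℕ} (hk : 0 < k) (hvd : (w + 1) ∣ p ^ k - 1) (hm : 2 ≤ m)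
    (hr : (w + 1) * r + 1 = p ^ (k * m)) {V : Finset K} (hV : V.card = r + 1)
    (hVm : ∀ s ∈ V, s ^ p ^ (k * m) = s) (he : 0 < e) (heV : ∀ s ∈ V, s ^ p ^ e = s)
    (hmin : ∀ e', 0 < e' → (∀ s ∈ V, s ^ p ^ e' = s) → e ≤ e') : e = k * m := by
  have hp1 : 1 < p := hp.out.one_lt
  have hmul : ∀ c, ∀ s ∈ V, s ^ p ^ (e * c) = s := by
    intro c s hs
    induction c with
    | zero => simp
    | succ c ih => rw [mul_add, pow_add, pow_mul, ih, mul_one]; exact heV s hs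
  have hmod : (k * m) % e = 0 := by
    by_contra hne
    have := hmin ((k * m) % e) (Nat.pos_of_ne_zero hne) (by
      intro s hs
      have h1 := hVm s hs
      rw [← Nat.div_add_mod (k * m) e, pow_add, pow_mul, hmul _ s hs] at h1
      exact h1)
    have := Nat.mod_lt (k * m) he
    omega
  obtain ⟨c, hc⟩ := Nat.dvd_of_mod_eq_zero hmod
  have hVe : r + 1 ≤ p ^ e := by
    rw [← hV]
    have hP1 : 1 < p ^ e := Nat.one_lt_pow he.ne' hp1
    have hd := FiniteField.X_pow_card_sub_X_natDegree_eq K hP1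
    by_contra hcon
    push Not at hcon
    have : (X ^ p ^ e - X : K[X]) = 0 := by
      apply eq_zero_of_natDegree_lt_card_of_eval_eq_zero' _ V
      · intro s hs
        simp [heV s hs]
      · rw [hd]; exact hcon
    rw [this] at hd
    simp at hd
    have := hp.out.ne_zero
    omega
  have hwQ := mv_wQ hk hvd
  have hlt : p ^ (k * m) < p ^ (k + e) := by
    rw [← hr, pow_add]
    calc (w + 1) * r + 1 < (w + 2) * (r + 1) := by nlinarith
      _ ≤ _ := Nat.mul_le_mul hwQ hVe
  have hlt2 : k * m < k + e := (Nat.pow_lt_pow_iff_right hp1).1 hlt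
  have hkm : k * 2 ≤ k * m := Nat.mul_le_mul_left _ hm
  rcases Nat.lt_or_ge c 2 with h | h
  · interval_cases c
    · omega
    · omega
  · have : e * 2 ≤ e * c := Nat.mul_le_mul_left _ h
    omega

end MVfinal

/-- the conjecture holds when `m > 1` and `(2m - 1)k ≥ n/2`,
i.e. `2(2m - 1)k ≥ n`. -/
theorem stmt_6 (p n k v m : ℕ) (hp : p.Prime) (hn : 0 < n) (hk : k ∣ n)
    (hv : 0 < v) (hvd : v ∣ p ^ k - 1)
    (F : Type) [Field F] [Fintype F] [DecidableEq F]
    (hcard : Fintype.card F = p ^ n)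
    (U : Finset F) (hU : IsSubspaceOver (p ^ k) (↑U : Set F)) (h1 : (1 : F) ∈ U)
    (hUcard : U.card = p ^ (m * k))
    (hUv : 2 < (U.image (fun u => u ^ v)).card)
    (hm : 1 < m) (hmk : n ≤ 2 * (2 * m - 1) * k) :
    (U ≠ Finset.univ.filter (fun c : F => c ^ p ^ (m * k) = c) →
      MVSPset (U.image (fun u => u ^ v)) = {g | ∃ f ∈ MVSPset U, g = f ^ v}) ∧
    (U = Finset.univ.filter (fun c : F => c ^ p ^ (m * k) = c) →
      ∀ e t : ℕ, 0 < e → (∀ s ∈ U.image (fun u => u ^ v), s ^ p ^ e = s) →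
        (∀ e', 0 < e' → (∀ s ∈ U.image (fun u => u ^ v), s ^ p ^ e' = s) → e ≤ e') →
        t * (p ^ (m * k) - 1) = v * (p ^ e - 1) →
        MVSPset (U.image (fun u => u ^ v)) =
          {g | ∃ f ∈ MVSPset (Finset.univ.filter (fun c : F => c ^ p ^ e = c)), g = f ^ t}) := by
  haveI : Fact p.Prime := ⟨hp⟩
  haveI : CharP F p := by
    obtain ⟨p', hp'⟩ := CharP.exists F
    obtain ⟨n', hp'', e⟩ := FiniteField.card F p'
    rw [hcard] at e
    have : p = p' := by
      have h1 : p ∣ p' ^ (n' : ℕ) := by rw [← e]; exact dvd_pow_self p hn.ne'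
      exact (Nat.prime_dvd_prime_iff_eq hp hp'').1 (hp.dvd_of_dvd_pow h1)
    rw [this]; exact hp'
  have hk0 : 0 < k := Nat.pos_of_dvd_of_pos hk hn
  obtain ⟨N, rfl⟩ := hk
  have hN : 0 < N := Nat.pos_of_ne_zero (by rintro rfl; simp at hn)
  have hN4 : N < 4 * m := by
    have : k * N ≤ k * (2 * (2 * m - 1)) := by rw [mul_comm k (2 * _)]; exact hmk
    have := Nat.le_of_mul_le_mul_left this hk0
    omega
  obtain ⟨w, rfl⟩ : ∃ w, v = w + 1 := ⟨v - 1, by omega⟩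
  have hs : ∀ i, (w + 1) * ((p ^ (k * i) - 1) / (w + 1)) + 1 = p ^ (k * i) := by
    intro i
    have hd : (w + 1) ∣ p ^ (k * i) - 1 := by
      refine hvd.trans ?_
      rw [pow_mul]
      simpa using Nat.sub_dvd_pow_sub_pow (p ^ k) 1 i
    rw [Nat.mul_div_cancel' hd]
    have := pow_pos hp.pos (k * i)
    omega
  obtain ⟨h0, hadd, -, hsm⟩ := hU
  rw [mul_comm m k] at hUcard ⊢
  obtain ⟨hc, hmain⟩ := mv_core (s := fun i => (p ^ (k * i) - 1) / (w + 1)) hk0 hvd hN hm hN4 hcard hs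
    (by exact_mod_cast h0) (by exact_mod_cast hadd) (by exact_mod_cast hsm) hUcard hUv
  refine ⟨fun _ => hmain, ?_⟩
  intro hUe e t he heV hmin ht
  have hee : e = k * m := mv_e hk0 hvd hm (hs m) hc (by
    intro y hy
    obtain ⟨u, hu, rfl⟩ := Finset.mem_image.1 hy
    rw [hUe, Finset.mem_filter] at hu
    rw [← pow_mul, mul_comm, pow_mul, hu.2]) he heV hmin
  subst hee
  have hpos : 0 < p ^ (k * m) - 1 := by
    have := Nat.one_lt_pow he.ne' hp.one_lt
    omega
  have htv := Nat.eq_of_mul_eq_mul_right hpos ht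
  rw [htv, ← hUe]
  exact hmain
end

section
/- Let p be a prime and q = p^4. Let k be a divisor of 4, v ≥ 1 a divisor of p^k − 1, and let U be an 𝔽_{p^k}-subspace of 𝔽_{p^4} with 1 ∈ U, #U = p^{mk}, and #U^v > 2. If U ≠ {c ∈ 𝔽_{p^4} : c^{p^{mk}} = c} (i.e., U is not the subfield of order p^{mk}), then 𝒫(U^v, p^4) = {f^v : f ∈ 𝒫(U, p^4)}. -/
open Polynomial

lemma aux_pth_root {F : Type*} [Field F] [Fintype F] (p : ℕ) [Fact p.Prime] [CharP F p]
    (f : F[X]) (hf : derivative f = 0) : ∃ g : F[X], f = g ^ p := by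
  have hp : p ≠ 0 := (Fact.out : p.Prime).ne_zero
  have h := Polynomial.expand_contract p hf hp
  have hs : Function.Surjective (frobenius F p) := (bijective_frobenius F p).2
  obtain ⟨g, hg⟩ := Polynomial.map_surjective (frobenius F p) hs (contract p f)
  refine ⟨g, ?_⟩
  rw [← map_frobenius_expand p g, map_expand, hg, h]

lemma aux_pow_inj {F : Type*} [Field F] (p : ℕ) [Fact p.Prime] [CharP F p]
    (f g : F[X]) (h : f ^ p = g ^ p) : f = g :=
  frobenius_inj F[X] p h

/-- additive polynomial predicate -/
def AuxAdd {F : Type*} [Field F] (f : F[X]) : Prop :=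
  ∀ y : F, f.comp (X + C y) = f + C (f.eval y)

lemma aux_add_struct {F : Type*} [Field F] [Fintype F] (p : ℕ) [Fact p.Prime] [CharP F p]
    (f : F[X]) (hf : AuxAdd f) (hd : f.natDegree ≤ Fintype.card F) :
    ∃ (c : F) (g : F[X]), f = C c * X + g ^ p ∧ AuxAdd g ∧ derivative f = C c := by
  have h1 : derivative f = C ((derivative f).eval 0) := by
    have h2 : derivative f - C ((derivative f).eval 0) = 0 := by
      by_cases h0 : f.natDegree = 0
      · rw [derivative_of_natDegree_zero h0]; simp
      apply eq_zero_of_natDegree_lt_card_of_eval_eq_zero' _ Finset.univ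
      · intro y _
        have := congrArg derivative (hf y)
        rw [derivative_comp] at this
        have h3 := congrArg (eval 0) this
        simp at h3
        simp [h3]
      · rw [natDegree_sub_C, Finset.card_univ]
        exact lt_of_lt_of_le (natDegree_derivative_lt h0) hd
    exact sub_eq_zero.mp h2
  set c := (derivative f).eval 0 with hc
  obtain ⟨g, hg⟩ := aux_pth_root p (f - C c * X) (by simp [h1])
  refine ⟨c, g, by rw [← hg]; ring, ?_, h1⟩
  intro y
  apply aux_pow_inj p
  have h3 : (g.comp (X + C y)) ^ p = (g ^ p).comp (X + C y) := by simp
  rw [h3, ← hg, add_pow_char, ← hg, ← C_pow, ← eval_pow, ← hg, sub_comp, hf y]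
  simp
  ring

lemma aux_add_prod {F : Type*} [Field F] [DecidableEq F] (U : Finset F)
    (h0 : (0 : F) ∈ U)
    (hadd : ∀ x ∈ U, ∀ y ∈ U, x + y ∈ U) (hneg : ∀ x ∈ U, -x ∈ U) :
    AuxAdd (∏ u ∈ U, (X - C u)) := by
  intro y
  set M : F[X] := ∏ u ∈ U, (X - C u) with hM
  have hMm : M.Monic := monic_prod_of_monic _ _ (fun u _ => monic_X_sub_C u)
  have hMd : M.natDegree = U.card := natDegree_finsetProd_X_sub_C_eq_card U (fun u => u)
  have hpos : 0 < U.card := Finset.card_pos.mpr ⟨0, h0⟩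
  have hinv : ∀ u ∈ U, M.eval (u + y) = M.eval y := by
    intro u hu
    simp only [hM, eval_prod, eval_sub, eval_X, eval_C]
    refine Finset.prod_bij' (fun w _ => w - u) (fun w _ => w + u) ?_ ?_ ?_ ?_ ?_
    · intro w hw; rw [sub_eq_add_neg]; exact hadd _ hw _ (hneg _ hu)
    · intro w hw; exact hadd _ hw _ hu
    · intros; ring
    · intros; ring
    · intros; ring
  have hz : ∀ u ∈ U, M.eval u = 0 := by
    intro u hu
    simp only [hM, eval_prod, eval_sub, eval_X, eval_C]
    exact Finset.prod_eq_zero hu (sub_self u)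
  have hcm : (M.comp (X + C y)).Monic := hMm.comp_X_add_C y
  have hcd : (M.comp (X + C y)).natDegree = M.natDegree := by
    rw [natDegree_comp]; simp
  have hD : (M.comp (X + C y) - M) - C (M.eval y) = 0 := by
    apply eq_zero_of_natDegree_lt_card_of_eval_eq_zero' _ U
    · intro u hu
      simp [hinv u hu, hz u hu]
    · rw [natDegree_sub_C]
      by_cases hne : M.comp (X + C y) - M = 0
      · rw [hne]; simpa using hpos
      rw [← hMd, ← hcd]
      apply natDegree_lt_natDegree hne
      apply degree_sub_lt_left
      · rw [degree_eq_natDegree hcm.ne_zero, degree_eq_natDegree hMm.ne_zero, hcd]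
      · exact hcm.ne_zero
      · rw [hcm, hMm]
  have := sub_eq_zero.mp hD
  rw [← this]; ring

lemma aux_card_roots {F : Type*} [Field F] [Fintype F] [DecidableEq F] (v : ℕ) (hv : 0 < v)
    (hd : v ∣ Fintype.card F - 1) :
    (Finset.univ.filter (fun c : F => c ^ v = 1)).card = v := by
  obtain ⟨g, hg⟩ := IsCyclic.exists_generator (α := Fˣ)
  have ho : orderOf g = Fintype.card F - 1 := by
    rw [orderOf_eq_card_of_forall_mem_zpowers hg, Nat.card_eq_fintype_card, Fintype.card_units]
  obtain ⟨w, hw⟩ := hd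
  have hq : 0 < Fintype.card F - 1 := by
    have := Fintype.one_lt_card (α := F); omega
  have hpr : IsPrimitiveRoot (g : F) (Fintype.card F - 1) := by
    rw [← ho]; exact (IsPrimitiveRoot.orderOf g).map_of_injective (f := Units.coeHom F) Units.val_injective
  have h2 : IsPrimitiveRoot ((g : F) ^ w) v := hpr.pow hq (by rw [hw]; ring)
  refine Eq.trans ?_ h2.card_nthRootsFinset
  congr 1
  ext c
  simp [mem_nthRootsFinset hv]

lemma aux_H {F : Type*} [Field F] [Fintype F] [DecidableEq F] :
    (∏ a : F, (X - C a)) = (X ^ Fintype.card F - X : F[X]) := by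
  have h1 := Fintype.one_lt_card (α := F)
  symm
  apply eq_of_monic_of_dvd_of_natDegree_le
  · exact monic_prod_of_monic _ _ (fun u _ => monic_X_sub_C u)
  · exact monic_X_pow_sub (by rw [degree_X]; exact_mod_cast h1)
  · apply Finset.prod_dvd_of_coprime
    · intro a _ b _ hab
      exact isCoprime_X_sub_C_of_isUnit_sub (sub_ne_zero.mpr hab).isUnit
    · intro a _
      rw [dvd_iff_isRoot]
      simp [FiniteField.pow_card]
  · rw [natDegree_finsetProd_X_sub_C_eq_card, FiniteField.X_pow_card_sub_X_natDegree_eq F h1]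
    simp

lemma aux_prod_dvd {F : Type*} [Field F] [DecidableEq F] (S : Finset F) (g : F[X])
    (h : ∀ a ∈ S, g.eval a = 0) : (∏ a ∈ S, (X - C a)) ∣ g := by
  apply Finset.prod_dvd_of_coprime
  · intro a _ b _ hab
    exact isCoprime_X_sub_C_of_isUnit_sub (sub_ne_zero.mpr hab).isUnit
  · intro a ha
    rw [dvd_iff_isRoot]
    exact h a ha

lemma aux_mills {F : Type*} [Field F] [Fintype F] [DecidableEq F] (p v : ℕ) [Fact p.Prime]
    [CharP F p] (hv : 0 < v) (hvp : v < p) (f R L : F[X]) (w0 : F) (hw0 : w0 ≠ 0)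
    (hR : C (v : F) * X * derivative R = C w0 - R) (hR0 : R.eval 0 = w0)
    (hval : ∀ a, f.eval a = 0 ∨ R.eval (f.eval a) = 0)
    (hd : 0 < f.natDegree) (hdq : 2 * f.natDegree ≤ Fintype.card F)
    (hdR : f.natDegree * R.natDegree < Fintype.card F)
    (hL : L = ∏ a ∈ Finset.univ.filter (fun a : F => f.eval a = 0), (X - C a)) :
    (∃ N, f = L ^ v * N ^ p) ∧ derivative (derivative L) = 0 ∧
      L * R.comp f = - C w0 * (X ^ Fintype.card F - X) * derivative L := by
  have hvF : (v : F) ≠ 0 := by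
    rw [Ne, CharP.cast_eq_zero_iff F p]
    exact fun h => absurd (Nat.le_of_dvd hv h) (by omega)
  have hf0 : f ≠ 0 := by rintro rfl; simp at hd
  set q := Fintype.card F with hq
  set J : F[X] := ∏ a ∈ Finset.univ.filter (fun a : F => ¬ f.eval a = 0), (X - C a) with hJ
  have hLJ : L * J = X ^ q - X := by
    rw [hL, hJ, Finset.prod_filter_mul_prod_filter_not, aux_H]
  have hLm : L.Monic := by rw [hL]; exact monic_prod_of_monic _ _ (fun u _ => monic_X_sub_C u)
  have hJm : J.Monic := monic_prod_of_monic _ _ (fun u _ => monic_X_sub_C u)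
  have hdeg : L.natDegree + J.natDegree = q := by
    rw [← hLm.natDegree_mul hJm, hLJ, FiniteField.X_pow_card_sub_X_natDegree_eq F Fintype.one_lt_card]
  have hLf : L ∣ f := by
    rw [hL]; exact aux_prod_dvd _ _ (by simp)
  have hLd : L.natDegree ≤ f.natDegree := natDegree_le_of_dvd hLf hf0
  obtain ⟨f1, hf1⟩ := hLf
  have hJR : J ∣ R.comp f := by
    apply aux_prod_dvd
    intro a ha
    simp at ha
    rw [eval_comp]
    exact (hval a).resolve_left ha
  obtain ⟨K, hK⟩ := hJR
  have hR1 : R ≠ 0 := by rintro rfl; simp at hR0; exact hw0 hR0.symm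
  have hRc : R.comp f ≠ 0 := by
    intro h
    have := (comp_eq_zero_iff.mp h)
    rcases this with h | ⟨_, h⟩
    · exact hR1 h
    · rw [h] at hd; simp at hd
  have hK0 : K ≠ 0 := by rintro rfl; simp at hK; exact hRc hK
  have hf10 : f1 ≠ 0 := by rintro rfl; simp at hf1; exact hf0 hf1
  -- derivative relations
  have hRf : C (v : F) * f * derivative (R.comp f) = (C w0 - R.comp f) * derivative f := by
    have := congrArg (fun g => g.comp f) hR
    simp only [mul_comp, C_comp, X_comp, sub_comp] at this
    rw [derivative_comp, ← this]; ring
  have hqF : ((q : ℕ) : F) = 0 := by rw [hq]; exact Nat.cast_card_eq_zero F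
  have hH' : derivative L * J + L * derivative J = -1 := by
    rw [← derivative_mul, hLJ]
    rw [derivative_sub, derivative_X_pow, hqF]; simp
  have hdegG : (f1 * K).natDegree < f.natDegree := by
    have h1 : (f * R.comp f).natDegree = f.natDegree + f.natDegree * R.natDegree := by
      rw [natDegree_mul hf0 hRc, natDegree_comp]; ring
    have h2 : f * R.comp f = (L * J) * (f1 * K) := by rw [hK]; nth_rw 1 [hf1]; ring
    rw [h2, natDegree_mul (mul_ne_zero hLm.ne_zero hJm.ne_zero) (mul_ne_zero hf10 hK0),
      hLm.natDegree_mul hJm, hdeg] at h1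
    omega
  have hE : C w0 * derivative f + C (v : F) * (f1 * K) = 0 := by
    have hJE : J ∣ C w0 * derivative f + C (v : F) * (f1 * K) := by
      have h3 : C w0 * derivative f + C (v : F) * (f1 * K) =
          J * (K * derivative f + C (v : F) * (f * derivative K - f1 * K * derivative L)
            - C (v : F) * f1 * K * 0) + 0 := by
        rw [hK, derivative_mul] at hRf
        have : f * derivative J * K = f1 * K * (-1 - derivative L * J) := by
          rw [← hH']; nth_rw 1 [hf1]; ring
        linear_combination (-1 : F[X]) * hRf + C (v : F) * this
      rw [h3]; simp
    by_contra hne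
    have h4 := natDegree_le_of_dvd hJE hne
    have h5 : (C w0 * derivative f + C (v : F) * (f1 * K)).natDegree < f.natDegree := by
      apply lt_of_le_of_lt (natDegree_add_le _ _)
      apply max_lt
      · exact lt_of_le_of_lt (natDegree_C_mul_le _ _) (natDegree_derivative_lt hd.ne')
      · exact lt_of_le_of_lt (natDegree_C_mul_le _ _) hdegG
    omega
  -- C w0 * L * f' = - v f K
  have hfK : C w0 * L * derivative f = - C (v : F) * f * K := by
    nth_rw 2 [hf1]; linear_combination L * hE
  have hKeq : C w0 * (L * derivative K - K * derivative L) = K ^ 2 := by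
    have h6 : (C (v : F) * f * J) * (C w0 * (L * derivative K - K * derivative L)) = (C (v : F) * f * J) * K ^ 2 := by
      rw [hK, derivative_mul] at hRf
      linear_combination C w0 * L * hRf + (C w0 - J * K) * hfK - C (v : F) * f * C w0 * K * hH'
    refine mul_left_cancel₀ ?_ h6
    exact mul_ne_zero (mul_ne_zero (C_ne_zero.mpr hvF) hf0) hJm.ne_zero
  have hcop : IsCoprime K L := by
    rw [hL]
    apply IsCoprime.prod_right
    intro a ha
    simp at ha
    have hKa : K.eval a ≠ 0 := by
      intro h
      have := congrArg (eval a) hK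
      rw [eval_comp, ha, hR0, eval_mul, h, mul_zero] at this
      exact hw0 this
    apply IsCoprime.symm
    rw [(irreducible_X_sub_C a).coprime_iff_not_dvd, dvd_iff_isRoot]
    exact hKa
  have hK' : derivative K = 0 := by
    rw [← dvd_derivative_iff]
    have h7 : K ∣ C w0 * L * derivative K :=
      ⟨K + C w0 * derivative L, by linear_combination hKeq⟩
    have h8 : K ∣ L * derivative K := by
      rw [mul_assoc] at h7
      exact (dvd_C_mul hw0).mp h7
    exact hcop.dvd_of_dvd_mul_left h8
  have hKL : K = - C w0 * derivative L := by
    apply mul_left_cancel₀ hK0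
    rw [hK'] at hKeq
    linear_combination -hKeq
  have hLL : derivative (derivative L) = 0 := by
    rw [hKL] at hK'
    simpa [hw0] using hK'
  refine ⟨?_, hLL, ?_⟩
  · have h9 : L * derivative f = C (v : F) * f * derivative L := by
      have : C w0 * (L * derivative f) = C w0 * (C (v : F) * f * derivative L) := by
        rw [hKL] at hfK; linear_combination hfK
      exact mul_left_cancel₀ (by simpa using hw0) this
    have h10 : derivative (f * L ^ (p - v)) = 0 := by
      have hpv : ((p - v : ℕ) : F) = - (v : F) := by
        rw [Nat.cast_sub hvp.le]; simp
      obtain ⟨t, ht⟩ : ∃ t, p - v = t + 1 := ⟨p - v - 1, by omega⟩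
      rw [derivative_mul, derivative_pow, hpv, ht]
      simp only [Nat.add_sub_cancel, map_neg]
      linear_combination L ^ t * h9
    obtain ⟨W, hW⟩ := aux_pth_root p _ h10
    have hLW : L ∣ W := by
      rw [hL]
      apply aux_prod_dvd
      intro a ha
      simp at ha
      have := congrArg (eval a) hW
      rw [eval_mul, ha, zero_mul, eval_pow] at this
      exact pow_eq_zero_iff (by omega) |>.mp this.symm
    obtain ⟨N, hN⟩ := hLW
    refine ⟨N, ?_⟩
    apply mul_right_cancel₀ (pow_ne_zero (p - v) hLm.ne_zero)
    rw [hW, hN, mul_pow]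
    have : L ^ p = L ^ v * L ^ (p - v) := by rw [← pow_add]; congr 1; omega
    rw [this]; ring
  · rw [hK, ← hLJ]; nth_rw 1 [hKL]; ring

lemma aux_fiber {F : Type*} [Field F] [Fintype F] [DecidableEq F] (v : ℕ) (hv : 0 < v)
    (hd : v ∣ Fintype.card F - 1) (U : Finset F) (h0 : (0 : F) ∈ U)
    (hmul : ∀ c : F, c ^ v = 1 → ∀ x ∈ U, c * x ∈ U) :
    U.card = v * ((U.image (fun u => u ^ v)).card - 1) + 1 := by
  have h0S : (0 : F) ∈ U.image (fun u => u ^ v) :=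
    Finset.mem_image.mpr ⟨0, h0, by simp [hv.ne']⟩
  have him : (U.erase 0).image (fun u => u ^ v) = (U.image (fun u => u ^ v)).erase 0 := by
    ext s
    simp only [Finset.mem_image, Finset.mem_erase]
    constructor
    · rintro ⟨u, ⟨hu, huU⟩, rfl⟩
      exact ⟨pow_ne_zero _ hu, u, huU, rfl⟩
    · rintro ⟨hs, u, huU, rfl⟩
      refine ⟨u, ⟨?_, huU⟩, rfl⟩
      rintro rfl
      simp [hv.ne'] at hs
  have h1 := Finset.card_eq_sum_card_image (fun u : F => u ^ v) (U.erase 0)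
  have h2 : ∀ b ∈ (U.erase 0).image (fun u : F => u ^ v),
      ((U.erase 0).filter (fun a => a ^ v = b)).card = v := by
    intro b hb
    obtain ⟨u, hu, rfl⟩ := Finset.mem_image.mp hb
    obtain ⟨hu0, huU⟩ := Finset.mem_erase.mp hu
    refine Eq.trans (Eq.symm ?_) (aux_card_roots (F := F) v hv hd)
    apply Finset.card_bij (fun c _ => c * u)
    · intro c hc
      simp only [Finset.mem_filter, Finset.mem_univ, true_and] at hc
      simp only [Finset.mem_filter, Finset.mem_erase]
      refine ⟨⟨mul_ne_zero ?_ hu0, hmul c hc u huU⟩, by rw [mul_pow, hc, one_mul]⟩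
      rintro rfl
      simp [hv.ne'] at hc
    · intro a _ b _ h
      exact mul_right_cancel₀ hu0 h
    · intro w hw
      simp only [Finset.mem_filter, Finset.mem_erase] at hw
      refine ⟨w / u, ?_, by field_simp⟩
      simp only [Finset.mem_filter, Finset.mem_univ, true_and]
      rw [div_pow, hw.2, div_self (pow_ne_zero _ hu0)]
  rw [Finset.sum_congr rfl h2, Finset.sum_const, him, Finset.card_erase_of_mem h0,
    Finset.card_erase_of_mem h0S, smul_eq_mul] at h1
  have : 0 < U.card := Finset.card_pos.mpr ⟨0, h0⟩
  rw [mul_comm v]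
  omega

lemma aux_R {F : Type*} [Field F] [Fintype F] [DecidableEq F] (p v : ℕ) [Fact p.Prime] [CharP F p]
    (hv : 0 < v)
    (hd : v ∣ Fintype.card F - 1) (U : Finset F) (h0 : (0 : F) ∈ U)
    (hadd : ∀ x ∈ U, ∀ y ∈ U, x + y ∈ U) (hneg : ∀ x ∈ U, -x ∈ U)
    (hmul : ∀ c : F, c ^ v = 1 → ∀ x ∈ U, c * x ∈ U) :
    ∃ (R : F[X]) (w0 : F), R.natDegree = (U.image (fun u => u ^ v)).card - 1 ∧ w0 ≠ 0 ∧
      R.eval 0 = w0 ∧ C (v : F) * X * derivative R = C w0 - R ∧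
      (∀ s ∈ U.image (fun u => u ^ v), s = 0 ∨ R.eval s = 0) ∧
      X * expand F v R = ∏ u ∈ U, (X - C u) := by
  set S := U.image (fun u => u ^ v) with hS
  have h0S : (0 : F) ∈ S :=
    Finset.mem_image.mpr ⟨0, h0, by simp [hv.ne']⟩
  set R : F[X] := ∏ s ∈ S.erase 0, (X - C s) with hR
  have hRm : R.Monic := monic_prod_of_monic _ _ (fun u _ => monic_X_sub_C u)
  have hRd : R.natDegree = S.card - 1 := by
    rw [hR, natDegree_finsetProd_X_sub_C_eq_card, Finset.card_erase_of_mem h0S]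
  have hRs : ∀ s ∈ S, s = 0 ∨ R.eval s = 0 := by
    intro s hs
    by_cases h : s = 0
    · exact Or.inl h
    · right
      rw [hR, eval_prod]
      exact Finset.prod_eq_zero (Finset.mem_erase.mpr ⟨h, hs⟩) (by simp)
  have hR0 : R.eval 0 ≠ 0 := by
    rw [hR, eval_prod, Finset.prod_ne_zero_iff]
    intro s hs
    simpa using (Finset.mem_erase.mp hs).1
  have hc := aux_fiber v hv hd U h0 hmul
  rw [← hS] at hc
  have hXR : X * expand F v R = ∏ u ∈ U, (X - C u) := by
    apply eq_of_monic_of_dvd_of_natDegree_le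
    · exact monic_prod_of_monic _ _ (fun u _ => monic_X_sub_C u)
    · exact monic_X.mul (hRm.expand hv)
    · apply aux_prod_dvd
      intro u hu
      rw [eval_mul, eval_X, expand_eval]
      rcases hRs (u ^ v) (Finset.mem_image_of_mem _ hu) with h | h
      · rw [eq_zero_of_pow_eq_zero h, zero_mul]
      · rw [h, mul_zero]
    · rw [natDegree_finsetProd_X_sub_C_eq_card, monic_X.natDegree_mul (hRm.expand hv),
        natDegree_expand, natDegree_X, hRd, hc]
      rw [mul_comm]; omega
  have hA := aux_add_prod U h0 hadd hneg
  obtain ⟨c, g, -, -, hder⟩ := aux_add_struct p _ hA (by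
    rw [natDegree_finsetProd_X_sub_C_eq_card]; exact Finset.card_le_univ U)
  have hrel : R + C (v : F) * X * derivative R = C c := by
    rw [← expand_inj hv]
    rw [← hXR, derivative_mul, derivative_expand] at hder
    simp only [map_add, map_mul, expand_C, expand_X]
    rw [← hder]
    have : (X : F[X]) ^ v = X * X ^ (v - 1) := by
      rw [← pow_succ']; congr 1; omega
    rw [this]
    simp
    ring
  have hcR : R.eval 0 = c := by
    have := congrArg (eval 0) hrel
    simpa using this
  refine ⟨R, c, hRd, hcR ▸ hR0, hcR, by rw [← hrel]; ring, hRs, hXR⟩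

lemma aux_R2 {F : Type*} [Field F] [Fintype F] [DecidableEq F] (p v e : ℕ) [Fact p.Prime]
    [CharP F p] (hv : 0 < v) (hve : v * e = p - 1) (U : Finset F) (h0 : (0 : F) ∈ U)
    (hadd : ∀ x ∈ U, ∀ y ∈ U, x + y ∈ U) (hneg : ∀ x ∈ U, -x ∈ U)
    (hcard : U.card = p ^ 2) (R : F[X]) (hR : X * expand F v R = ∏ u ∈ U, (X - C u)) :
    ∃ w0 w1 w2 : F, w2 ≠ 0 ∧ R = C w0 + C w1 * X ^ e + C w2 * X ^ (e * (p + 1)) := by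
  have hp : p.Prime := Fact.out
  have hp2 := hp.two_le
  have hA := aux_add_prod U h0 hadd hneg
  have hMd : (∏ u ∈ U, (X - C u)).natDegree = p ^ 2 := by
    rw [natDegree_finsetProd_X_sub_C_eq_card, hcard]
  have hq : p ^ 2 ≤ Fintype.card F := hcard ▸ Finset.card_le_univ U
  obtain ⟨w0, P, hP, hPA, -⟩ := aux_add_struct p _ hA (by rw [hMd]; exact hq)
  have hlin : ∀ c : F, (C c * X : F[X]).natDegree ≤ 1 := fun c =>
    (natDegree_C_mul_le _ _).trans natDegree_X_le
  have hdP : P.natDegree = p := by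
    have h1 : (P ^ p).natDegree = p ^ 2 := by
      have : P ^ p = (∏ u ∈ U, (X - C u)) - C w0 * X := by rw [hP]; ring
      rw [this, natDegree_sub_eq_left_of_natDegree_lt, hMd]
      rw [hMd]
      have := hlin w0
      nlinarith
    rw [natDegree_pow] at h1
    nlinarith
  obtain ⟨w1, Q, hQ, hQA, -⟩ := aux_add_struct p P hPA (by rw [hdP]; nlinarith)
  have hdQ : Q.natDegree = 1 := by
    have h1 : (Q ^ p).natDegree = p := by
      have : Q ^ p = P - C w1 * X := by nth_rw 1 [hQ]; ring
      rw [this, natDegree_sub_eq_left_of_natDegree_lt, hdP]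
      rw [hdP]
      have := hlin w1
      omega
    rw [natDegree_pow] at h1
    nlinarith
  have hQ0 : Q.coeff 0 = 0 := by
    have := congrArg (eval 0) (hQA 0)
    rw [coeff_zero_eq_eval_zero]
    simpa using this
  have hQe : Q = C (Q.coeff 1) * X := by
    have := eq_X_add_C_of_natDegree_le_one hdQ.le
    rw [hQ0] at this
    simpa using this
  have hQ1 : Q.coeff 1 ≠ 0 := by
    intro h; rw [h] at hQe; rw [hQe] at hdQ; simp at hdQ
  refine ⟨w0, w1 ^ p, (Q.coeff 1) ^ (p ^ 2), pow_ne_zero _ hQ1, ?_⟩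
  rw [← expand_inj hv]
  apply mul_left_cancel₀ (X_ne_zero (R := F))
  rw [hR, hP, hQ, hQe, add_pow_char]
  simp only [map_add, map_mul, map_pow, expand_C, expand_X, mul_pow, ← pow_mul]
  have e1 : (X : F[X]) ^ p = X * X ^ (v * e) := by
    rw [hve, ← pow_succ']; congr 1; omega
  have e2 : (X : F[X]) ^ (p * p) = X * X ^ (v * (e * (p + 1))) := by
    rw [← mul_assoc, hve, ← pow_succ']; congr 1
    obtain ⟨t, rfl⟩ : ∃ t, p = t + 1 := ⟨p - 1, by omega⟩
    simp; ring
  rw [e1, e2]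
  simp
  ring

lemma aux_m2a {F : Type*} [Field F] [Fintype F] [DecidableEq F] (p v e : ℕ) [Fact p.Prime]
    [CharP F p] (hv : 0 < v) (hve : v * e = p - 1) (hcard : Fintype.card F = p ^ 4)
    (L N : F[X]) (w0 w1 w2 : F) (hw0 : w0 ≠ 0)
    (hN : N ≠ 0) (hsep : IsCoprime L (derivative L)) (hL1 : 1 ≤ L.natDegree)
    (hL'' : derivative (derivative L) = 0)
    (hd : v * L.natDegree + p * N.natDegree ≤ v * (p ^ 2 + 1))
    (hmain : C w0 * L + C w1 * L ^ p * N ^ (p * e) + C w2 * L ^ (p ^ 2) * N ^ (p * (e * (p + 1)))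
      = - C w0 * (X ^ Fintype.card F - X) * derivative L) :
    derivative N = 0 := by
  have hp : p.Prime := Fact.out
  have hp2 := hp.two_le
  obtain ⟨A, hA⟩ := aux_pth_root p _ hL''
  obtain ⟨B, hB⟩ := aux_pth_root p (L - X * derivative L) (by simp [hL''])
  have hLAB : L = X * A ^ p + B ^ p := by rw [← hA, ← hB]; ring
  have hcop : IsCoprime A B := by
    rw [hA] at hsep
    nth_rw 1 [hLAB] at hsep
    have h1 : IsCoprime (B ^ p) (A ^ p) := by
      have := IsCoprime.add_mul_right_left hsep (-X)
      have e0 : X * A ^ p + B ^ p + -X * A ^ p = B ^ p := by ring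
      rwa [e0] at this
    exact ((IsCoprime.pow_iff hp.pos hp.pos).mp h1).symm
  have hsurj : Function.Surjective (frobenius F p) := (bijective_frobenius F p).2
  obtain ⟨u0, hu0⟩ := hsurj (-w0)
  obtain ⟨u1, hu1⟩ := hsurj w1
  obtain ⟨u2, hu2⟩ := hsurj w2
  rw [frobenius_def] at hu0 hu1 hu2
  have hu00 : u0 ≠ 0 := by
    rintro rfl
    rw [zero_pow hp.ne_zero] at hu0
    exact hw0 (neg_eq_zero.mp hu0.symm)
  have hroot : C u1 * L * N ^ e + C u2 * L ^ p * N ^ (e * (p + 1)) =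
      C u0 * (X ^ (p ^ 3) * A + B) := by
    apply aux_pow_inj p
    rw [add_pow_char, mul_pow, mul_pow, mul_pow, mul_pow, mul_pow, add_pow_char, mul_pow, ← C_pow,
      ← C_pow, ← C_pow, hu0, hu1, hu2, ← hA, ← hB]
    rw [hcard] at hmain
    simp only [← pow_mul]
    have e1 : p ^ 3 * p = p ^ 4 := by ring
    have e2 : e * p = p * e := by ring
    have e3 : p * p = p ^ 2 := by ring
    have e4 : e * (p + 1) * p = p * (e * (p + 1)) := by ring
    rw [e1, e2, e3, e4]
    simp only [C_neg]
    linear_combination hmain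
  have hpF : (p : F[X]) = 0 := CharP.cast_eq_zero F[X] p
  have hveF : (v : F[X]) * (e : F[X]) = -1 := by
    rw [← Nat.cast_mul, hve, Nat.cast_sub hp.one_le, hpF]; simp
  have hNe : ∀ t : ℕ, N * derivative (N ^ t) = (t : F[X]) * N ^ t * derivative N := by
    intro t
    rcases t with _ | t
    · simp
    · rw [derivative_pow_succ]; simp; ring
  have hLp : derivative (L ^ p) = 0 := by
    rw [derivative_pow]; simp
  have hXp : derivative ((X : F[X]) ^ (p ^ 3)) = 0 := by
    rw [derivative_X_pow]; simp
  have hder := congrArg derivative hroot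
  simp only [derivative_add, derivative_mul, derivative_C, hLp, hXp] at hder
  have hkey : X ^ (p ^ 3) * (C u0 * ((v : F[X]) * N * derivative A + derivative N * A)) +
      (C u0 * ((v : F[X]) * N * derivative B + derivative N * B) - (v : F[X]) * C u1 * A ^ p * N ^ (e + 1)) = 0 := by
    have h1 := hNe e
    have h2 := hNe (e * (p + 1))
    push_cast at h2
    rw [hpF] at h2
    rw [← hA]
    rw [pow_succ]
    linear_combination (-(v : F[X]) * N) * hder - derivative N * hroot
      + (v : F[X]) * C u1 * L * h1 + (v : F[X]) * C u2 * L ^ p * h2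
      + derivative N * (C u1 * L * N ^ e + C u2 * L ^ p * N ^ (e * (p + 1))) * hveF
  -- degrees
  have hpB : p * B.natDegree ≤ L.natDegree := by
    rw [← natDegree_pow, ← hB]
    refine (natDegree_sub_le _ _).trans (max_le le_rfl ?_)
    refine natDegree_mul_le.trans ?_
    have := natDegree_derivative_lt (p := L) (by omega)
    rw [natDegree_X]; omega
  have hpA : (A ^ p).natDegree ≤ L.natDegree := by
    rw [← hA]
    exact (natDegree_derivative_lt (p := L) (by omega)).le
  have hBl : B.natDegree ≤ L.natDegree := by nlinarith
  set l := L.natDegree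
  set n := N.natDegree
  have hbound : l + n * (e + 1) < p ^ 3 := by
    have hvp : v ≤ p - 1 := by
      rw [← hve]
      rcases Nat.eq_zero_or_pos e with h | h
      · rw [h] at hve; omega
      · exact Nat.le_mul_of_pos_right v h
    obtain ⟨t, rfl⟩ : ∃ t, p = t + 1 := ⟨p - 1, by omega⟩
    simp only [Nat.add_sub_cancel] at hve hvp
    by_contra hcon
    push Not at hcon
    have hlb : l ≤ (t + 1) ^ 2 + 1 := by
      have : v * l ≤ v * ((t + 1) ^ 2 + 1) := by omega
      exact Nat.le_of_mul_le_mul_left this hv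
    obtain ⟨s, hs⟩ := Nat.exists_eq_add_of_le hlb
    have hn : (t + 1) * n ≤ v * s := by
      rw [hs, mul_add] at hd; omega
    have h1 : (t + 1) * (n * (e + 1)) ≤ 2 * t * s := by
      calc (t + 1) * (n * (e + 1)) = ((t + 1) * n) * (e + 1) := by ring
        _ ≤ v * s * (e + 1) := Nat.mul_le_mul_right _ hn
        _ = (v * e + v) * s := by ring
        _ ≤ 2 * t * s := by rw [hve]; exact Nat.mul_le_mul_right _ (by omega)
    have h2 : (t + 1) * (t + 1) ^ 3 ≤ (t + 1) * l + 2 * t * s := by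
      calc (t + 1) * (t + 1) ^ 3 ≤ (t + 1) * (l + n * (e + 1)) := Nat.mul_le_mul_left _ hcon
        _ ≤ _ := by rw [mul_add]; omega
    have h3 : (t + 1) * l + 2 * t * s ≤ 2 * t * ((t + 1) ^ 2 + 1) := by
      rw [hs]
      nlinarith
    have ht : 1 ≤ t := by omega
    obtain ⟨t', rfl⟩ : ∃ t', t = t' + 1 := ⟨t - 1, by omega⟩
    have h4 := h2.trans h3
    ring_nf at h4
    nlinarith [Nat.zero_le t', Nat.zero_le (t' ^ 2), Nat.zero_le (t' ^ 3), Nat.zero_le (t' ^ 4)]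
  set X1 := C u0 * ((v : F[X]) * N * derivative A + derivative N * A) with hX1
  set X2 := C u0 * ((v : F[X]) * N * derivative B + derivative N * B) - (v : F[X]) * C u1 * A ^ p * N ^ (e + 1) with hX2
  have hvdeg : ((v : F[X])).natDegree = 0 := natDegree_natCast v
  have hX2d : X2.natDegree < p ^ 3 := by
    refine lt_of_le_of_lt ?_ hbound
    have hnn : n + l ≤ l + n * (e + 1) := by nlinarith
    have hN' : (derivative N).natDegree ≤ n := (natDegree_derivative_le N).trans (Nat.sub_le _ _)
    have hB' : (derivative B).natDegree ≤ l :=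
      ((natDegree_derivative_le B).trans (Nat.sub_le _ _)).trans hBl
    refine (natDegree_sub_le _ _).trans (max_le ?_ ?_)
    · refine (natDegree_C_mul_le _ _).trans ((natDegree_add_le _ _).trans (max_le ?_ ?_))
      · refine natDegree_mul_le.trans ?_
        have : ((v : F[X]) * N).natDegree ≤ n := natDegree_mul_le.trans (by omega)
        omega
      · refine natDegree_mul_le.trans ?_
        omega
    · refine natDegree_mul_le.trans ?_
      have h1 : ((v : F[X]) * C u1 * A ^ p).natDegree ≤ l := by
        refine natDegree_mul_le.trans ?_
        have : ((v : F[X]) * C u1).natDegree ≤ 0 := natDegree_mul_le.trans (by simp)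
        omega
      have h2 : (N ^ (e + 1)).natDegree = (e + 1) * n := natDegree_pow _ _
      rw [h2]
      nlinarith
  have hX1z : X1 = 0 := by
    by_contra hne
    have h1 : X ^ (p ^ 3) * X1 = - X2 := by linear_combination hkey
    have h2 := congrArg natDegree h1
    rw [natDegree_neg, natDegree_mul (pow_ne_zero _ X_ne_zero) hne, natDegree_X_pow] at h2
    omega
  have hX2z : X2 = 0 := by rw [hX1z] at hkey; simpa using hkey
  have hCu0 : C u0 * C u0⁻¹ = 1 := by rw [← C_mul, mul_inv_cancel₀ hu00, C_1]
  have hdA : N ∣ derivative N * A := by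
    refine ⟨- (v * derivative A), ?_⟩
    have : C u0 * (derivative N * A) = C u0 * (N * (- (v * derivative A))) := by
      linear_combination hX1z
    exact mul_left_cancel₀ (C_ne_zero.mpr hu00) this
  have hdB : N ∣ derivative N * B := by
    refine ⟨- (v * derivative B) + C u0⁻¹ * v * C u1 * A ^ p * N ^ e, ?_⟩
    have : C u0 * (derivative N * B) = C u0 * (N * (- (v * derivative B) + C u0⁻¹ * v * C u1 * A ^ p * N ^ e)) := by
      rw [hX2, pow_succ] at hX2z
      linear_combination hX2z - v * C u1 * A ^ p * N ^ e * N * hCu0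
    exact mul_left_cancel₀ (C_ne_zero.mpr hu00) this
  rw [← dvd_derivative_iff]
  obtain ⟨s, t, hst⟩ := hcop
  have : derivative N = s * (derivative N * A) + t * (derivative N * B) := by
    linear_combination (-derivative N) * hst
  rw [this]
  exact dvd_add (hdA.mul_left s) (hdB.mul_left t)

lemma aux_m2 {F : Type*} [Field F] [Fintype F] [DecidableEq F] (p v e : ℕ) [Fact p.Prime]
    [CharP F p] (hv : 0 < v) (hve : v * e = p - 1) (hcard : Fintype.card F = p ^ 4)
    (f R L N : F[X]) (w0 w1 w2 : F) (hw0 : w0 ≠ 0) (hw2 : w2 ≠ 0)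
    (hR : R = C w0 + C w1 * X ^ e + C w2 * X ^ (e * (p + 1)))
    (hf0 : f ≠ 0) (hLm : L.Monic) (hf : f = L ^ v * N ^ p)
    (hsep : IsCoprime L (derivative L)) (hL1 : 1 ≤ L.natDegree)
    (hL'' : derivative (derivative L) = 0)
    (hd : f.natDegree ≤ v * (p ^ 2 + 1)) (hRd : R.natDegree = e * (p + 1))
    (hmain : L * R.comp f = - C w0 * (X ^ Fintype.card F - X) * derivative L) :
    ∃ (c : F) (g : F[X]), f = C c * g ^ v := by
  have hp : p.Prime := Fact.out
  have hp2 := hp.two_le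
  have he : 0 < e := by
    rcases Nat.eq_zero_or_pos e with h | h
    · rw [h] at hve; omega
    · exact h
  have hN : N ≠ 0 := by rintro rfl; rw [zero_pow hp.ne_zero, mul_zero] at hf; exact hf0 hf
  have hfd : f.natDegree = v * L.natDegree + p * N.natDegree := by
    rw [hf, natDegree_mul (pow_ne_zero _ hLm.ne_zero) (pow_ne_zero _ hN), natDegree_pow, natDegree_pow]
  have hm2 : C w0 * L + C w1 * L ^ p * N ^ (p * e) + C w2 * L ^ (p ^ 2) * N ^ (p * (e * (p + 1)))
      = - C w0 * (X ^ Fintype.card F - X) * derivative L := by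
    rw [← hmain, hR]
    simp only [add_comp, mul_comp, C_comp, pow_comp, X_comp]
    rw [hf, mul_pow, mul_pow, ← pow_mul, ← pow_mul, ← pow_mul, ← pow_mul, ← mul_assoc v e, hve]
    have e1 : L ^ p = L * L ^ (p - 1) := by rw [← pow_succ']; congr 1; omega
    have e2 : L ^ (p ^ 2) = L * L ^ ((p - 1) * (p + 1)) := by
      rw [← pow_succ']; congr 1
      obtain ⟨t, rfl⟩ : ∃ t, p = t + 1 := ⟨p - 1, by omega⟩
      simp; ring
    rw [e1, e2]
    ring
  have hN' := aux_m2a p v e hv hve hcard L N w0 w1 w2 hw0 hN hsep hL1 hL'' (hfd ▸ hd) hm2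
  obtain ⟨N1, hN1⟩ := aux_pth_root p N hN'
  have hN10 : N1 ≠ 0 := by rintro rfl; rw [zero_pow hp.ne_zero] at hN1; exact hN hN1
  have hnd : N.natDegree = p * N1.natDegree := by rw [hN1, natDegree_pow]
  have hL'0 : derivative L ≠ 0 := by
    intro h
    rw [h, isCoprime_zero_right] at hsep
    have := natDegree_eq_zero_of_isUnit hsep
    omega
  have hL'd := natDegree_derivative_lt (p := L) (by omega)
  have hdeg : L.natDegree + f.natDegree * (e * (p + 1)) = p ^ 4 + (derivative L).natDegree := by
    have hfp : f.natDegree ≠ 0 := by rw [hfd]; have := Nat.mul_pos hv hL1; omega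
    have hRc : R.comp f ≠ 0 := by
      intro h
      rcases comp_eq_zero_iff.mp h with h | ⟨_, h⟩
      · rw [h] at hRd; simp at hRd; omega
      · rw [h] at hfp; simp at hfp
    have h1 := congrArg natDegree hmain
    have h1c := Fintype.one_lt_card (α := F)
    rw [natDegree_mul hLm.ne_zero hRc, natDegree_comp, natDegree_mul
      (mul_ne_zero (neg_ne_zero.mpr (C_ne_zero.mpr hw0)) (FiniteField.X_pow_card_sub_X_ne_zero F h1c)) hL'0,
      natDegree_mul (neg_ne_zero.mpr (C_ne_zero.mpr hw0)) (FiniteField.X_pow_card_sub_X_ne_zero F h1c),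
      FiniteField.X_pow_card_sub_X_natDegree_eq F h1c, natDegree_neg, natDegree_C, hRd, hcard] at h1
    rw [mul_comm f.natDegree]; omega
  obtain ⟨A, hA⟩ := aux_pth_root p _ hL''
  obtain ⟨B, hB⟩ := aux_pth_root p (L - X * derivative L) (by simp [hL''])
  set l := L.natDegree with hl
  set n := N1.natDegree with hn
  set l' := (derivative L).natDegree with hl'
  rw [hnd] at hfd
  by_cases hn0 : n = 0
  · obtain ⟨c, hc⟩ := natDegree_eq_zero.mp hn0
    refine ⟨(c ^ p) ^ p, L, ?_⟩
    rw [hf, hN1, ← hc]; simp; ring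
  -- arithmetic
  have hvr : v * (e * (p + 1)) + 1 = p ^ 2 := by
    rw [← mul_assoc, hve]
    obtain ⟨t, rfl⟩ : ∃ t, p = t + 1 := ⟨p - 1, by omega⟩
    simp; ring
  have hdeg2 : p ^ 2 * l + p ^ 2 * (n * (e * (p + 1))) = p ^ 4 + l' := by
    rw [← hdeg, hfd, ← hvr]
    have : p * (p * n) = p ^ 2 * n := by ring
    rw [this, ← hvr]; ring
  have hlp : l ≤ p ^ 2 := by
    have : v * l < v * (p ^ 2 + 1) := by
      have : 0 < p * (p * n) := by positivity
      omega
    have := Nat.lt_of_mul_lt_mul_left this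
    omega
  have hl'0 : l' = 0 := by
    have h1 : p ^ 2 ∣ l' := by
      have h2 : p ^ 2 ∣ p ^ 4 + l' := by
        rw [← hdeg2]
        exact dvd_add (dvd_mul_right _ _) (dvd_mul_right _ _)
      exact (Nat.dvd_add_right (pow_dvd_pow p (by norm_num))).mp h2
    exact Nat.eq_zero_of_dvd_of_lt h1 (by omega)
  have hdeg3 : l + n * (e * (p + 1)) = p ^ 2 := by
    rw [hl'0] at hdeg2
    have : p ^ 2 * (l + n * (e * (p + 1))) = p ^ 2 * p ^ 2 := by rw [mul_add, hdeg2]; ring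
    exact Nat.eq_of_mul_eq_mul_left (by positivity) this
  have hnv : n ≤ v := by
    have h1 : p ^ 2 * n ≤ p ^ 2 * v := by
      have : v ≤ v * l := Nat.le_mul_of_pos_right v hL1
      have e1 : p * (p * n) = p ^ 2 * n := by ring
      have e2 : v * (p ^ 2 + 1) = p ^ 2 * v + v := by ring
      omega
    exact Nat.le_of_mul_le_mul_left h1 (by positivity)
  have hl1 : l = 1 := by
    by_contra hne
    have hLB : (B ^ p).natDegree = l := by
      rw [← hB, natDegree_sub_eq_left_of_natDegree_lt]
      rw [natDegree_mul X_ne_zero hL'0, natDegree_X]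
      omega
    rw [natDegree_pow] at hLB
    have h1 : p ∣ n * e := by
      have h2 : p ∣ l + n * (e * (p + 1)) := by rw [hdeg3]; exact dvd_pow_self p (by norm_num)
      have h3 : p ∣ n * (e * (p + 1)) := (Nat.dvd_add_right ⟨_, hLB.symm⟩).mp h2
      have h4 : n * (e * (p + 1)) = n * e * p + n * e := by ring
      rw [h4] at h3
      exact (Nat.dvd_add_right (dvd_mul_left _ _)).mp h3
    have h5 : n * e ≤ p - 1 := by rw [← hve]; exact Nat.mul_le_mul_right e hnv
    have h6 : 0 < n * e := Nat.mul_pos (Nat.pos_of_ne_zero hn0) he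
    have := Nat.le_of_dvd h6 h1
    omega
  have hnv2 : n = v := by
    have h1 : n * (e * (p + 1)) = v * (e * (p + 1)) := by omega
    exact Nat.eq_of_mul_eq_mul_right (by positivity) h1
  obtain ⟨a, ha⟩ : ∃ a : F, L = X - C a := by
    refine ⟨- L.coeff 0, ?_⟩
    have := hLm.eq_X_add_C hl1
    rw [C_neg, sub_neg_eq_add]; exact this
  have hN1d : N1 ∣ (X - C a) ^ (p ^ 4) := by
    have h1 : (X - C a) ^ (p ^ 4) = X ^ (p ^ 4) - C a := by
      rw [sub_pow_char_pow, ← C_pow, ← hcard, FiniteField.pow_card]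
    have h2 : N1 ∣ N ^ (p * e) := by
      rw [hN1, ← pow_mul]
      exact dvd_pow_self _ (by positivity)
    have h3 : N1 ∣ N ^ (p * (e * (p + 1))) := by
      rw [hN1, ← pow_mul]
      exact dvd_pow_self _ (by positivity)
    have h4 : C w0 * (X - C a) ^ (p ^ 4) =
       - (C w1 * L ^ p * N ^ (p * e) + C w2 * L ^ (p ^ 2) * N ^ (p * (e * (p + 1)))) := by
      have hLd1 : derivative L = 1 := by rw [ha]; simp
      rw [hLd1, hcard] at hm2
      rw [h1]
      nth_rw 1 [ha] at hm2
      linear_combination hm2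
    rw [← dvd_C_mul hw0, h4, dvd_neg]
    exact dvd_add (h2.mul_left _) (h3.mul_left _)
  obtain ⟨i, -, hi⟩ := (dvd_prime_pow (prime_X_sub_C a) _).mp hN1d
  have hiv : i = v := by
    have := natDegree_eq_of_degree_eq (degree_eq_degree_of_associated hi)
    rw [natDegree_pow, natDegree_X_sub_C] at this
    omega
  obtain ⟨u, hu⟩ := hi.symm
  obtain ⟨c, -, hc⟩ := isUnit_iff.mp u.isUnit
  refine ⟨(c ^ p) ^ p, (X - C a) * ((X - C a) ^ p) ^ p, ?_⟩
  rw [hf, hN1, ← hu, ← hc, ha, hiv]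
  simp only [mul_pow, ← pow_mul, C_pow]
  ring

lemma aux_core {F : Type*} [Field F] [Fintype F] [DecidableEq F] (p v m : ℕ) [Fact p.Prime]
    [CharP F p] (hm : m = 2 ∨ m = 3) (hv : 0 < v) (hvd : v ∣ p - 1)
    (hcard : Fintype.card F = p ^ 4) (U : Finset F) (h0 : (0 : F) ∈ U)
    (hadd : ∀ x ∈ U, ∀ y ∈ U, x + y ∈ U) (hneg : ∀ x ∈ U, -x ∈ U)
    (hmul : ∀ c : F, c ^ v = 1 → ∀ x ∈ U, c * x ∈ U) (hU : U.card = p ^ m)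
    (hvq : v ∣ Fintype.card F - 1)
    (f : F[X]) (hf : IsMVSP f) (hfS : valueSet f = U.image (fun u => u ^ v)) :
    ∃ (c : F) (g : F[X]), f = C c * g ^ v := by
  have hp : p.Prime := Fact.out
  have hp2 := hp.two_le
  obtain ⟨e, he⟩ := hvd
  have hve : v * e = p - 1 := he.symm
  have he0 : 0 < e := by
    rcases Nat.eq_zero_or_pos e with h | h
    · rw [h] at hve; omega
    · exact h
  have hvp : v < p := by
    have : v ≤ v * e := Nat.le_mul_of_pos_right v he0
    omega
  obtain ⟨hd0, hcS⟩ := hf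
  have hfib := aux_fiber v hv hvq U h0 hmul
  obtain ⟨R, w0, hRd, hw0, hR0, hRrel, hRs, hXR⟩ := aux_R p v hv hvq U h0 hadd hneg hmul
  rw [hfS] at hcS
  set r := (U.image (fun u => u ^ v)).card - 1 with hr
  set d := f.natDegree with hd
  have hrd : r = (p ^ 4 - 1) / d := by rw [hr, hcS, hcard]; rfl
  have hq1 : 1 ≤ p ^ 4 := Nat.one_le_pow _ _ hp.pos
  have hup : d * r + 1 ≤ p ^ 4 := by
    have := Nat.mul_div_le (p ^ 4 - 1) d
    rw [← hrd] at this; omega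
  have hlow : p ^ 4 ≤ d * (r + 1) := by
    have := Nat.lt_mul_div_succ (p ^ 4 - 1) hd0
    rw [← hrd] at this; omega
  have hvr : v * r + 1 = p ^ m := by rw [← hU, hfib]
  have hdm : (m = 2 → d ≤ v * (p ^ 2 + 1)) ∧ (m = 3 → d = v * p) := by
    obtain ⟨t, rfl⟩ : ∃ t, p = t + 1 := ⟨p - 1, by omega⟩
    have h1 : d * (v * r) + v ≤ v * (t + 1) ^ 4 := by
      calc d * (v * r) + v = v * (d * r + 1) := by ring
        _ ≤ _ := Nat.mul_le_mul_left _ hup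
    have h2 : v * (t + 1) ^ 4 ≤ d * (v * r + v) := by
      calc v * (t + 1) ^ 4 ≤ v * (d * (r + 1)) := Nat.mul_le_mul_left _ hlow
        _ = _ := by ring
    constructor
    · rintro rfl
      have h3 : v * r = t * (t + 2) := by
        have : (t + 1) ^ 2 = t * (t + 2) + 1 := by ring
        omega
      rw [h3] at h1
      have h4 : v * (t + 1) ^ 4 = v * ((t + 1) ^ 2 + 1) * (t * (t + 2)) + v := by ring
      rw [h4] at h1
      have h5 : d * (t * (t + 2)) ≤ v * ((t + 1) ^ 2 + 1) * (t * (t + 2)) := by omega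
      have ht : 0 < t := by omega
      exact Nat.le_of_mul_le_mul_right h5 (by positivity)
    · rintro rfl
      have h3 : v * r = t ^ 3 + 3 * t ^ 2 + 3 * t := by
        have : (t + 1) ^ 3 = t ^ 3 + 3 * t ^ 2 + 3 * t + 1 := by ring
        omega
      rw [h3] at h1 h2
      have hvt : v ≤ t := by omega
      have ht : 0 < t := by omega
      apply le_antisymm
      · by_contra hcon
        push Not at hcon
        have h5 : (v * (t + 1) + 1) * (t ^ 3 + 3 * t ^ 2 + 3 * t) ≤ d * (t ^ 3 + 3 * t ^ 2 + 3 * t) :=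
          Nat.mul_le_mul_right _ hcon
        have h6 : v * t ≤ t * t := Nat.mul_le_mul_right _ hvt
        have h7 : (v * (t + 1) + 1) * (t ^ 3 + 3 * t ^ 2 + 3 * t) + v ≤ v * (t + 1) ^ 4 := by omega
        nlinarith [pow_pos ht 3]
      · by_contra hcon
        push Not at hcon
        have h5 : (d + 1) * (t ^ 3 + 3 * t ^ 2 + 3 * t + v) ≤ (v * (t + 1)) * (t ^ 3 + 3 * t ^ 2 + 3 * t + v) :=
          Nat.mul_le_mul_right _ hcon
        have h6 : v * v ≤ t * t := Nat.mul_le_mul hvt hvt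
        have h7 : v * v * (t + 1) ≤ t * t * (t + 1) := Nat.mul_le_mul_right _ h6
        nlinarith
  have h2d : 2 * d ≤ p ^ 4 := by
    rcases hm with rfl | rfl
    · have h1 := hdm.1 rfl
      obtain ⟨t, rfl⟩ : ∃ t, p = t + 1 := ⟨p - 1, by omega⟩
      have hvt : v ≤ t := by omega
      have h3 : v * ((t + 1) ^ 2 + 1) ≤ t * ((t + 1) ^ 2 + 1) := Nat.mul_le_mul_right _ hvt
      nlinarith [Nat.zero_le (t ^ 4), Nat.zero_le (t ^ 3), Nat.zero_le (t ^ 2)]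
    · have h1 := hdm.2 rfl
      obtain ⟨t, rfl⟩ : ∃ t, p = t + 1 := ⟨p - 1, by omega⟩
      have hvt : v ≤ t := by omega
      have h3 : v * (t + 1) ≤ t * (t + 1) := Nat.mul_le_mul_right _ hvt
      nlinarith [Nat.zero_le (t ^ 4), Nat.zero_le (t ^ 3), Nat.zero_le (t ^ 2)]
  obtain ⟨L, hL⟩ : ∃ L : F[X], L = ∏ a ∈ Finset.univ.filter (fun a : F => f.eval a = 0), (X - C a) :=
    ⟨_, rfl⟩
  have hval : ∀ a, f.eval a = 0 ∨ R.eval (f.eval a) = 0 := by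
    intro a
    apply hRs
    rw [← hfS]
    exact Finset.mem_image_of_mem _ (Finset.mem_univ a)
  obtain ⟨⟨N, hN⟩, hL'', hmain⟩ := aux_mills p v hv hvp f R L w0 hw0 hRrel hR0 hval hd0
    (by rw [hcard]; exact h2d) (by rw [hcard, hRd]; exact hup) hL
  have hLm : L.Monic := by rw [hL]; exact monic_prod_of_monic _ _ (fun u _ => monic_X_sub_C u)
  have hL1 : 1 ≤ L.natDegree := by
    rw [hL, natDegree_finsetProd_X_sub_C_eq_card]
    apply Finset.card_pos.mpr
    have : (0 : F) ∈ valueSet f := by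
      rw [hfS]; exact Finset.mem_image.mpr ⟨0, h0, by simp [hv.ne']⟩
    obtain ⟨a, -, ha⟩ := Finset.mem_image.mp this
    exact ⟨a, by simpa using ha⟩
  have hf0 : f ≠ 0 := by rintro rfl; simp [hd] at hd0
  rcases hm with rfl | rfl
  · obtain ⟨w0', w1, w2, hw2, hR2⟩ := aux_R2 p v e hv hve U h0 hadd hneg hU R hXR
    have hw : w0' = w0 := by
      rw [← hR0, hR2]; simp [he0.ne']
    subst hw
    have hsep : IsCoprime L (derivative L) := by
      have : L.Separable := by
        rw [hL]
        apply separable_prod_X_sub_C_iff'.mpr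
        intro x _ y _ h; exact h
      exact this
    have hre : R.natDegree = e * (p + 1) := by
      rw [hRd]
      have : v * r = v * (e * (p + 1)) := by
        rw [← mul_assoc, hve]
        obtain ⟨t, rfl⟩ : ∃ t, p = t + 1 := ⟨p - 1, by omega⟩
        have : (t + 1) ^ 2 = t * (t + 2) + 1 := by ring
        simp only [Nat.add_sub_cancel]
        have : t * (t + 1 + 1) = t * (t + 2) := by ring
        omega
      exact Nat.eq_of_mul_eq_mul_left hv this
    exact aux_m2 p v e hv hve hcard f R L N w0' w1 w2 hw0 hw2 hR2 hf0 hLm hN hsep hL1 hL''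
      (hdm.1 rfl) hre hmain
  · have hdd := hdm.2 rfl
    have hN0 : N ≠ 0 := by rintro rfl; rw [zero_pow hp.ne_zero, mul_zero] at hN; exact hf0 hN
    have hfd : d = v * L.natDegree + p * N.natDegree := by
      rw [hd, hN, natDegree_mul (pow_ne_zero _ hLm.ne_zero) (pow_ne_zero _ hN0), natDegree_pow, natDegree_pow]
    have h1 : p ∣ v * L.natDegree := by
      have : p ∣ v * L.natDegree + p * N.natDegree := by
        rw [← hfd, hdd]; exact dvd_mul_left _ _
      exact (Nat.dvd_add_left (dvd_mul_right _ _)).mp this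
    have h2 : p ∣ L.natDegree := by
      rcases hp.dvd_mul.mp h1 with h | h
      · exact absurd (Nat.le_of_dvd hv h) (by omega)
      · exact h
    have h3 : p ≤ L.natDegree := Nat.le_of_dvd hL1 h2
    have h4 : v * p ≤ v * L.natDegree := Nat.mul_le_mul_left _ h3
    have h5 : N.natDegree = 0 := by
      have : p * N.natDegree = 0 := by omega
      rcases Nat.mul_eq_zero.mp this with h | h
      · omega
      · exact h
    obtain ⟨c, hc⟩ := natDegree_eq_zero.mp h5
    refine ⟨c ^ p, L, ?_⟩
    rw [hN, ← hc, C_pow]; exact mul_comm _ _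

lemma aux_lower {F : Type*} [Field F] [Fintype F] [DecidableEq F] (g : F[X])
    (hd : 0 < g.natDegree) : (Fintype.card F - 1) / g.natDegree + 1 ≤ (valueSet g).card := by
  have h := Finset.card_le_mul_card_image (f := fun a => g.eval a) (Finset.univ : Finset F)
    g.natDegree (by
      intro b _
      have hne : g - C b ≠ 0 := by
        intro h
        have := congrArg natDegree h
        rw [natDegree_sub_C] at this
        simp at this; omega
      calc _ ≤ (g - C b).roots.toFinset.card := by
            apply Finset.card_le_card
            intro a ha
            simp only [Finset.mem_filter, Finset.mem_univ, true_and] at ha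
            simp [mem_roots hne, ha]
        _ ≤ Multiset.card (g - C b).roots := Multiset.toFinset_card_le _
        _ ≤ (g - C b).natDegree := card_roots' _
        _ = g.natDegree := natDegree_sub_C)
  rw [Finset.card_univ] at h
  change _ ≤ g.natDegree * (valueSet g).card at h
  have h1 := Fintype.one_lt_card (α := F)
  have : (Fintype.card F - 1) / g.natDegree < (valueSet g).card := by
    rw [Nat.div_lt_iff_lt_mul hd, mul_comm]; omega
  omega

lemma aux_final {F : Type*} [Field F] [Fintype F] [DecidableEq F] (p v m : ℕ) [Fact p.Prime]
    [CharP F p] (hm : m = 2 ∨ m = 3) (hv : 0 < v) (hvd : v ∣ p - 1)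
    (hcard : Fintype.card F = p ^ 4) (U : Finset F) (h0 : (0 : F) ∈ U)
    (hadd : ∀ x ∈ U, ∀ y ∈ U, x + y ∈ U) (hneg : ∀ x ∈ U, -x ∈ U)
    (hmul : ∀ c : F, c ^ v = 1 → ∀ x ∈ U, c * x ∈ U) (hU : U.card = p ^ m)
    (hvq : v ∣ Fintype.card F - 1) :
    MVSPset (U.image (fun u => u ^ v)) = {g | ∃ f ∈ MVSPset U, g = f ^ v} := by
  have hp : p.Prime := Fact.out
  have hp2 := hp.two_le
  have hfib := aux_fiber v hv hvq U h0 hmul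
  have h0S : (0 : F) ∈ U.image (fun u => u ^ v) :=
    Finset.mem_image.mpr ⟨0, h0, by simp [hv.ne']⟩
  have hSpos : 0 < (U.image (fun u => u ^ v)).card := Finset.card_pos.mpr ⟨0, h0S⟩
  ext f
  constructor
  · rintro ⟨hf, hfS⟩
    obtain ⟨c, g, hcg⟩ := aux_core p v m hm hv hvd hcard U h0 hadd hneg hmul hU hvq f hf hfS
    obtain ⟨hd0, hcS⟩ := hf
    have hf0 : f ≠ 0 := by rintro rfl; simp at hd0
    -- a nonzero value
    have hU1 : 1 < U.card := by
      rw [hU]; exact Nat.one_lt_pow (by rcases hm with h | h <;> omega) hp.one_lt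
    obtain ⟨u, huU, hu0⟩ : ∃ u ∈ U, u ≠ 0 := by
      obtain ⟨u, hu, hne⟩ := Finset.exists_mem_ne hU1 0
      exact ⟨u, hu, hne⟩
    have hmem : u ^ v ∈ valueSet f := by rw [hfS]; exact Finset.mem_image_of_mem _ huU
    obtain ⟨a, -, ha⟩ := Finset.mem_image.mp hmem
    have hga : c * (g.eval a) ^ v = u ^ v := by
      rw [← ha, hcg]; simp
    have hga0 : g.eval a ≠ 0 := by
      intro h
      rw [h, zero_pow hv.ne', mul_zero] at hga
      exact pow_ne_zero v hu0 hga.symm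
    set h : F[X] := C (u / g.eval a) * g with hh
    have hfh : f = h ^ v := by
      rw [hcg, hh, mul_pow, ← C_pow, div_pow, ← hga]
      congr 2
      field_simp
    have hhd : f.natDegree = v * h.natDegree := by rw [hfh, natDegree_pow]
    have hhd0 : 0 < h.natDegree := by
      rcases Nat.eq_zero_or_pos h.natDegree with h' | h'
      · rw [h', mul_zero] at hhd; omega
      · exact h'
    have hsub : valueSet h ⊆ U := by
      intro s hs
      obtain ⟨b, -, rfl⟩ := Finset.mem_image.mp hs
      have hb : f.eval b ∈ valueSet f := Finset.mem_image_of_mem _ (Finset.mem_univ b)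
      rw [hfS] at hb
      obtain ⟨w, hw, hwb⟩ := Finset.mem_image.mp hb
      simp only [hfh, eval_pow] at hwb
      change h.eval b ∈ U
      by_cases hw0 : w = 0
      · rw [hw0, zero_pow hv.ne'] at hwb
        rw [eq_zero_of_pow_eq_zero hwb.symm]
        exact h0
      · have := hmul (h.eval b / w) (by rw [div_pow, ← hwb, div_self (pow_ne_zero _ hw0)]) w hw
        rwa [div_mul_cancel₀ _ hw0] at this
    have hlow := aux_lower h hhd0
    have hle := Finset.card_le_card hsub
    have hdv : (Fintype.card F - 1) / f.natDegree * v ≤ (Fintype.card F - 1) / h.natDegree := by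
      rw [Nat.le_div_iff_mul_le hhd0]
      calc _ = (Fintype.card F - 1) / f.natDegree * f.natDegree := by rw [hhd]; ring
        _ ≤ _ := Nat.div_mul_le_self _ _
    rw [hfS] at hcS
    rw [hcS, Nat.add_sub_cancel, mul_comm] at hfib
    have hUeq : valueSet h = U := Finset.eq_of_subset_of_card_le hsub (by omega)
    refine ⟨h, ⟨⟨hhd0, ?_⟩, hUeq⟩, hfh⟩
    omega
  · rintro ⟨g, ⟨⟨hd0, hcg⟩, hgU⟩, rfl⟩
    have hS : valueSet (g ^ v) = U.image (fun u => u ^ v) := by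
      rw [← hgU]
      ext s
      simp [valueSet]
    refine ⟨⟨?_, ?_⟩, hS⟩
    · rw [natDegree_pow]; positivity
    · rw [hS, natDegree_pow, mul_comm, ← Nat.div_div_eq_div_mul]
      rw [hgU, hfib] at hcg
      have : (Fintype.card F - 1) / g.natDegree = v * ((U.image (fun u => u ^ v)).card - 1) := by omega
      rw [this, Nat.mul_div_cancel_left _ hv]
      omega

/-- the conjecture holds for `q = p^4` in the case where `U` is not a subfield:
`𝒫(U^v, p^4) = {f^v : f ∈ 𝒫(U, p^4)}`. -/
theorem stmt_7 (p k v m : ℕ) (hp : p.Prime) (hk : k ∣ 4)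
    (hv : 0 < v) (hvd : v ∣ p ^ k - 1)
    (F : Type) [Field F] [Fintype F] [DecidableEq F]
    (hcard : Fintype.card F = p ^ 4)
    (U : Finset F) (hU : IsSubspaceOver (p ^ k) (↑U : Set F)) (h1 : (1 : F) ∈ U)
    (hUcard : U.card = p ^ (m * k))
    (hUv : 2 < (U.image (fun u => u ^ v)).card)
    (hUne : U ≠ Finset.univ.filter (fun c : F => c ^ p ^ (m * k) = c)) :
    MVSPset (U.image (fun u => u ^ v)) = {g | ∃ f ∈ MVSPset U, g = f ^ v} := by
  haveI : Fact p.Prime := ⟨hp⟩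
  haveI : CharP F p := charP_of_card_eq_prime_pow hcard
  have hp2 := hp.two_le
  obtain ⟨h0, hadd, hneg, hmul⟩ := hU
  simp only [Finset.mem_coe] at h0 hadd hneg hmul
  have hk0 : k ≠ 0 := by rintro rfl; simp at hk
  have hmk4 : m * k ≤ 4 := by
    have := Finset.card_le_univ U
    rw [hUcard, hcard] at this
    exact (Nat.pow_le_pow_iff_right hp.one_lt).mp this
  have hm0 : m ≠ 0 := by
    rintro rfl
    have := Finset.card_image_le (s := U) (f := fun u => u ^ v)
    rw [hUcard] at this
    simp at this
    omega
  have hne4 : m * k ≠ 4 := by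
    intro h
    apply hUne
    have hUu : U = Finset.univ := by
      rw [← Finset.card_eq_iff_eq_univ, hUcard, hcard, h]
    rw [hUu, h]
    ext c
    simp [← hcard, FiniteField.pow_card]
  have hdvd : p ^ k - 1 ∣ Fintype.card F - 1 := by
    obtain ⟨j, hj⟩ := hk
    rw [hcard, hj, pow_mul]
    simpa using Nat.sub_dvd_pow_sub_pow (p ^ k) 1 j
  have hpk : 1 < p ^ k := Nat.one_lt_pow hk0 hp.one_lt
  have hm1 : m ≠ 1 := by
    rintro rfl
    apply hUne
    symm
    rw [one_mul] at hUcard ⊢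
    apply Finset.eq_of_subset_of_card_le
    · intro c hc
      simp only [Finset.mem_filter, Finset.mem_univ, true_and] at hc
      have := hmul c hc 1 h1
      rwa [mul_one] at this
    · rw [hUcard]
      have hr := aux_card_roots (F := F) (p ^ k - 1) (by omega) hdvd
      have h2 : insert (0 : F) (Finset.univ.filter (fun c : F => c ^ (p ^ k - 1) = 1)) ⊆
          Finset.univ.filter (fun c : F => c ^ p ^ k = c) := by
        intro c hc
        simp only [Finset.mem_insert, Finset.mem_filter, Finset.mem_univ, true_and] at hc ⊢
        rcases hc with rfl | hc
        · exact zero_pow (by omega)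
        · have : p ^ k = (p ^ k - 1) + 1 := by omega
          rw [this, pow_succ, hc, one_mul]
      have h3 := Finset.card_le_card h2
      rw [Finset.card_insert_of_notMem, hr] at h3
      · omega
      · simp only [Finset.mem_filter, Finset.mem_univ, true_and]
        rw [zero_pow (by omega)]
        exact zero_ne_one
  have hkm : k = 1 ∧ (m = 2 ∨ m = 3) := by
    have hk4 : k ≤ 4 := Nat.le_of_dvd (by norm_num) hk
    have hm4 : m ≤ 4 := le_trans (Nat.le_mul_of_pos_right m (Nat.pos_of_ne_zero hk0)) hmk4
    interval_cases k <;> interval_cases m <;> simp_all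
  obtain ⟨rfl, hm⟩ := hkm
  rw [pow_one] at hvd hmul
  rw [mul_one] at hUcard
  refine aux_final p v m hm hv hvd hcard U h0 hadd hneg ?_ hUcard ?_
  · intro c hc x hx
    apply hmul c _ x hx
    obtain ⟨e, he⟩ := hvd
    have : p = v * e + 1 := by omega
    rw [this, pow_succ, pow_mul, hc, one_pow, one_mul]
  · rw [pow_one] at hdvd
    exact hvd.trans hdvd
end
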